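/- Let T and U be computable consistent extensions of PA and n ≥ 1. The following are equivalent: (1) T + Th_{Σ_n∧Π_n}(U) is consistent; (2) there is a B(Σ_n) sentence in HCons(Σ_n∧Π_n,T) ∩ HCons(Σ_n∧Π_n,U) \ Th(T); (3) HCons(Σ_n∧Π_n,U) \ Th(T) ≠ ∅. -/

import Mathlib

open FirstOrder Language
open scoped FirstOrder

namespace Guaspari

/-- The first-order language of arithmetic: a constant `0`, a unary function `S`,
binary functions `+` (coded `false`) and `·` (coded `true`), and a binary relation `≤`. -/
def LA : FirstOrder.Language :=
  ⟨fun n => match n with | 0 => Unit | 1 => Unit | 2 => Bool | _ => Empty,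
   fun n => match n with | 2 => Unit | _ => Empty⟩

/-- Sentences of the language of arithmetic. -/
abbrev Snt : Type := LA.Sentence

/-- Theories (sets of sentences) in the language of arithmetic. -/
abbrev Thy : Type := LA.Theory

/-- The term `0`. -/
def zeroT {α : Type} {n : ℕ} : LA.Term (α ⊕ Fin n) :=
  Constants.term (show LA.Constants from Unit.unit)

/-- The term `S t`. -/
def succT {α : Type} {n : ℕ} (t : LA.Term (α ⊕ Fin n)) : LA.Term (α ⊕ Fin n) :=
  Functions.apply₁ (show LA.Functions 1 from Unit.unit) t

/-- The term `t + u`. -/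
def addT {α : Type} {n : ℕ} (t u : LA.Term (α ⊕ Fin n)) : LA.Term (α ⊕ Fin n) :=
  Functions.apply₂ (show LA.Functions 2 from false) t u

/-- The term `t * u`. -/
def mulT {α : Type} {n : ℕ} (t u : LA.Term (α ⊕ Fin n)) : LA.Term (α ⊕ Fin n) :=
  Functions.apply₂ (show LA.Functions 2 from true) t u

/-- The atomic formula `t ≤ u`. -/
def leF {α : Type} {n : ℕ} (t u : LA.Term (α ⊕ Fin n)) : LA.BoundedFormula α n :=
  Relations.boundedFormula₂ (show LA.Relations 2 from Unit.unit) t u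

/-- The `i`-th (de Bruijn-indexed) bound variable as a term. -/
def vT {m : ℕ} (i : Fin m) : LA.Term (Empty ⊕ Fin m) := Term.var (Sum.inr i)

/-- The induction axiom for the formula `φ(x₀,…,x_{k-1}, x_k)` with induction on `x_k`,
universally closed over the parameters `x₀,…,x_{k-1}`. -/
def indAxiom {k : ℕ} (φ : LA.BoundedFormula Empty (k + 1)) : Snt :=
  let base := ∀' ((vT (Fin.last k) =' zeroT) ⟹ φ)
  let step := ∀' (φ ⟹
    ∀' ((vT (Fin.last (k + 1)) =' succT (vT (Fin.castSucc (Fin.last k)))) ⟹ φ.liftAt 1 k))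
  ((base ⊓ step) ⟹ ∀' φ).alls

/-- The axioms of Peano arithmetic `PA`: the basic axioms for `0`, `S`, `+`, `·`, `≤`,
together with the full induction scheme. -/
def PAAx : Thy :=
  {∀' ∼(succT (vT 0) =' zeroT),
   ∀' ∀' ((succT (vT 0) =' succT (vT 1)) ⟹ (vT 0 =' vT 1)),
   ∀' (addT (vT 0) zeroT =' vT 0),
   ∀' ∀' (addT (vT 0) (succT (vT 1)) =' succT (addT (vT 0) (vT 1))),
   ∀' (mulT (vT 0) zeroT =' zeroT),
   ∀' ∀' (mulT (vT 0) (succT (vT 1)) =' addT (mulT (vT 0) (vT 1)) (vT 0)),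
   ∀' ∀' (leF (vT 0) (vT 1) ⇔ ∃' (addT (vT 2) (vT 0) =' vT 1))} ∪
  {φ | ∃ (k : ℕ) (ψ : LA.BoundedFormula Empty (k + 1)), φ = indAxiom ψ}

/-- `Prv T φ`: the sentence `φ` is provable from the theory `T` (equivalently, by the
Gödel completeness theorem, `φ` holds in every model of `T`). -/
def Prv (T : Thy) (φ : Snt) : Prop := T ⊨ᵇ φ

/-- `Th T`: the set of sentences provable from `T`. -/
def Th (T : Thy) : Set Snt := {φ | Prv T φ}

/-- `Con T`: the theory `T` is consistent. -/
def Con (T : Thy) : Prop := ¬ Prv T ⊥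

/-- The theory `T + φ`. -/
def add (T : Thy) (φ : Snt) : Thy := insert φ T

/-- `T` is an extension of `PA`. -/
def ExtPA (T : Thy) : Prop := ∀ φ ∈ PAAx, Prv T φ

/-- `V` is a subtheory of `T` (containing `PA`, as assumed throughout the paper). -/
def SubThy (V T : Thy) : Prop := ExtPA V ∧ ∀ φ, Prv V φ → Prv T φ

/-- Δ₀ (bounded) formulas. -/
inductive IsDelta0 : ∀ {m : ℕ}, LA.BoundedFormula Empty m → Prop
  | falsum {m : ℕ} : IsDelta0 (⊥ : LA.BoundedFormula Empty m)
  | equal {m : ℕ} (t u : LA.Term (Empty ⊕ Fin m)) : IsDelta0 (t =' u)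
  | le {m : ℕ} (t u : LA.Term (Empty ⊕ Fin m)) : IsDelta0 (leF t u)
  | imp {m : ℕ} {φ ψ : LA.BoundedFormula Empty m} :
      IsDelta0 φ → IsDelta0 ψ → IsDelta0 (φ ⟹ ψ)
  | ball {m : ℕ} (t : LA.Term (Empty ⊕ Fin m)) {φ : LA.BoundedFormula Empty (m + 1)} :
      IsDelta0 φ →
      IsDelta0 (∀' (leF (vT (Fin.last m)) (t.relabel (Sum.map id Fin.castSucc)) ⟹ φ))
  | bex {m : ℕ} (t : LA.Term (Empty ⊕ Fin m)) {φ : LA.BoundedFormula Empty (m + 1)} :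
      IsDelta0 φ →
      IsDelta0 (∃' (leF (vT (Fin.last m)) (t.relabel (Sum.map id Fin.castSucc)) ⊓ φ))

mutual
  /-- `Σ_k` formulas (cumulatively: every `Π_k` formula is `Σ_{k+1}`). -/
  inductive IsSigmaFml : ℕ → ∀ {m : ℕ}, LA.BoundedFormula Empty m → Prop
    | ofDelta0 {m : ℕ} {φ : LA.BoundedFormula Empty m} : IsDelta0 φ → IsSigmaFml 0 φ
    | ofPi {k : ℕ} {m : ℕ} {φ : LA.BoundedFormula Empty m} :
        IsPiFml k φ → IsSigmaFml (k + 1) φ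
    | ex {k : ℕ} {m : ℕ} {φ : LA.BoundedFormula Empty (m + 1)} :
        IsSigmaFml (k + 1) φ → IsSigmaFml (k + 1) (∃' φ)
  /-- `Π_k` formulas (cumulatively: every `Σ_k` formula is `Π_{k+1}`). -/
  inductive IsPiFml : ℕ → ∀ {m : ℕ}, LA.BoundedFormula Empty m → Prop
    | ofDelta0 {m : ℕ} {φ : LA.BoundedFormula Empty m} : IsDelta0 φ → IsPiFml 0 φ
    | ofSigma {k : ℕ} {m : ℕ} {φ : LA.BoundedFormula Empty m} :
        IsSigmaFml k φ → IsPiFml (k + 1) φ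
    | all {k : ℕ} {m : ℕ} {φ : LA.BoundedFormula Empty (m + 1)} :
        IsPiFml (k + 1) φ → IsPiFml (k + 1) (∀' φ)
end

/-- The set of `Σ_k` sentences. -/
def SigmaS (k : ℕ) : Set Snt := {φ | IsSigmaFml k φ}

/-- The set of `Π_k` sentences. -/
def PiS (k : ℕ) : Set Snt := {φ | IsPiFml k φ}

/-- The set of `Σ_k ∧ Π_k` sentences, i.e. sentences of the form `σ ∧ π` with
`σ` a `Σ_k` sentence and `π` a `Π_k` sentence. -/
def SigAndPiS (k : ℕ) : Set Snt :=
  {φ | ∃ σ ∈ SigmaS k, ∃ π ∈ PiS k, φ = σ ⊓ π}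

/-- `B(Σ_k)` sentences: Boolean combinations of `Σ_k` sentences. -/
inductive IsBoolSigma (k : ℕ) : Snt → Prop
  | base {φ : Snt} : φ ∈ SigmaS k → IsBoolSigma k φ
  | not {φ : Snt} : IsBoolSigma k φ → IsBoolSigma k (∼φ)
  | imp {φ ψ : Snt} : IsBoolSigma k φ → IsBoolSigma k ψ → IsBoolSigma k (φ ⟹ ψ)
  | inf {φ ψ : Snt} : IsBoolSigma k φ → IsBoolSigma k ψ → IsBoolSigma k (φ ⊓ ψ)
  | sup {φ ψ : Snt} : IsBoolSigma k φ → IsBoolSigma k ψ → IsBoolSigma k (φ ⊔ ψ)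

/-- The set of `B(Σ_k)` sentences. -/
def BSigmaS (k : ℕ) : Set Snt := {φ | IsBoolSigma k φ}

/-- The set of `Γ` sentences provable in `T`, `Th_Γ(T)`. -/
def ThIn (Γ : Set Snt) (T : Thy) : Set Snt := Γ ∩ Th T

instance (i : ℕ) : Encodable (LA.Functions i) :=
  match i with
  | 0 => inferInstanceAs (Encodable Unit)
  | 1 => inferInstanceAs (Encodable Unit)
  | 2 => inferInstanceAs (Encodable Bool)
  | (_ + 3) => inferInstanceAs (Encodable Empty)

instance (i : ℕ) : Encodable (LA.Relations i) :=
  match i with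
  | 0 => inferInstanceAs (Encodable Empty)
  | 1 => inferInstanceAs (Encodable Empty)
  | 2 => inferInstanceAs (Encodable Unit)
  | (_ + 3) => inferInstanceAs (Encodable Empty)

/-- A Gödel numbering of sentences, via Mathlib's encoding of bounded formulas. -/
def gnum (φ : Snt) : ℕ :=
  Encodable.encode
    (show List ((Σ k, LA.Term (Empty ⊕ Fin k)) ⊕ ((Σ n, LA.Relations n) ⊕ ℕ)) from
      BoundedFormula.encoding.encode (⟨0, φ⟩ : Σ n, LA.BoundedFormula Empty n))

/-- The (axiom set of the) theory `T` is computable. -/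
def CompThy (T : Thy) : Prop :=
  ComputablePred (fun m : ℕ => ∃ φ ∈ T, gnum φ = m)

/-- `T` is a computable consistent extension of `PA`. -/
def GoodThy (T : Thy) : Prop := CompThy T ∧ Con T ∧ ExtPA T

/-- `φ` is `Γ`-conservative over `T` for a class of sentences `Γ`:
every `Γ` sentence provable in `T + φ` is provable in `T`. -/
def ConsIn (Γ : Set Snt) (T : Thy) (φ : Snt) : Prop :=
  ∀ γ ∈ Γ, Prv (add T φ) γ → Prv T γ

/-- `φ` is hereditarily `Γ`-conservative over `T`: `Γ`-conservative over every
subtheory of `T` (containing `PA`). -/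
def HConsIn (Γ : Set Snt) (T : Thy) (φ : Snt) : Prop :=
  ∀ V : Thy, SubThy V T → ConsIn Γ V φ

/-- `φ` is `Σ_k↓Π_k`-conservative over `V`. -/
def SPCons (k : ℕ) (V : Thy) (φ : Snt) : Prop :=
  ∀ σ ∈ SigmaS k, ∀ π ∈ PiS k, Prv (add V φ) (σ ⊓ π) → Prv V (σ ⊔ π)

/-- `φ` is hereditarily `Σ_k↓Π_k`-conservative over `T`. -/
def HSPCons (k : ℕ) (T : Thy) (φ : Snt) : Prop :=
  ∀ V : Thy, SubThy V T → SPCons k V φ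

/-- The theory `S` is `Σ_k↓Π_k`-conservative over `PA`. -/
def ThySPConsPA (k : ℕ) (S : Thy) : Prop :=
  ∀ σ ∈ SigmaS k, ∀ π ∈ PiS k, Prv S (σ ⊓ π) → Prv PAAx (σ ⊔ π)

/-- `δ` is a `Δ_k(S)` sentence: `S`-provably equivalent to both a `Σ_k` sentence
and a `Π_k` sentence. -/
def IsDeltaIn (k : ℕ) (S : Thy) (δ : Snt) : Prop :=
  (∃ σ ∈ SigmaS k, Prv S (δ ⇔ σ)) ∧ ∃ π ∈ PiS k, Prv S (δ ⇔ π)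

/-- `φ` is `Δ_k(S)`-conservative over `V`. -/
def DeltaConsRel (k : ℕ) (S V : Thy) (φ : Snt) : Prop :=
  ∀ δ : Snt, IsDeltaIn k S δ → Prv (add V φ) δ → Prv V δ

/-- `φ` is `Δ_k`-conservative over `T`, i.e. `Δ_k(Th(T))`-conservative over `T`. -/
def DeltaCons (k : ℕ) (T : Thy) (φ : Snt) : Prop := DeltaConsRel k (Th T) T φ

/-- `φ` is hereditarily `Δ_k`-conservative over `T`. -/
def HDeltaCons (k : ℕ) (T : Thy) (φ : Snt) : Prop :=
  ∀ V : Thy, SubThy V T → DeltaConsRel k (Th V) V φ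

/-- `φ` is doubly `Π_k`-conservative over `T`: `φ` is `Π_k`-conservative and `¬φ` is
`Σ_k`-conservative over `T`. -/
def DCons (k : ℕ) (T : Thy) (φ : Snt) : Prop :=
  ConsIn (PiS k) T φ ∧ ConsIn (SigmaS k) T (∼φ)

/-- `φ` is hereditarily doubly `Π_k`-conservative over `T`. -/
def HDCons (k : ℕ) (T : Thy) (φ : Snt) : Prop :=
  ∀ V : Thy, SubThy V T → DCons k V φ

/-- `(T,U)` is a `B_n`-pair. -/
def Bpair (n : ℕ) (T U : Thy) : Prop :=
  (¬ ThIn (PiS n) T ⊆ Th U ∨ Con (T ∪ ThIn (PiS n) U)) ∧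
  (¬ ThIn (PiS n) U ⊆ Th T ∨ Con (U ∪ ThIn (PiS n) T))

/-- `(T,U)` is a `C_n`-pair. -/
def Cpair (n : ℕ) (T U : Thy) : Prop :=
  Con (T ∪ ThIn (PiS n) U) ∧ Con (U ∪ ThIn (PiS n) T)

/-- `(T,U)` is a `C⁻_n`-pair. -/
def Cmpair (n : ℕ) (T U : Thy) : Prop :=
  Con (T ∪ ThIn (PiS n) U) ∨ Con (U ∪ ThIn (PiS n) T)

/-- `(T,U)` is a `C^∧_n`-pair. -/
def Capair (n : ℕ) (T U : Thy) : Prop :=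
  Con (T ∪ ThIn (SigAndPiS n) U) ∧ Con (U ∪ ThIn (SigAndPiS n) T)

/-- `(T,U)` is a `C^B_n`-pair. -/
def CBpair (n : ℕ) (T U : Thy) : Prop :=
  Con (T ∪ ThIn (BSigmaS n) U)


set_option linter.unusedVariables false
set_option linter.unusedSimpArgs false
set_option linter.unusedSectionVars false

/-! ### Layer 1: models of PA as ordered semirings -/

abbrev fZero : LA.Functions 0 := Unit.unit
abbrev fSucc : LA.Functions 1 := Unit.unit
abbrev fAdd : LA.Functions 2 := false
abbrev fMul : LA.Functions 2 := true
abbrev rLe : LA.Relations 2 := Unit.unit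

/-- compatibility of the arithmetic operations with the `LA`-structure -/
class Cmp (M : Type) [Zero M] [One M] [Add M] [Mul M] [LE M] [LA.Structure M] : Prop where
  c_zero : ∀ v, Structure.funMap (M := M) fZero v = 0
  c_succ : ∀ v, Structure.funMap (M := M) fSucc v = v 0 + 1
  c_add : ∀ v, Structure.funMap (M := M) fAdd v = v 0 + v 1
  c_mul : ∀ v, Structure.funMap (M := M) fMul v = v 0 * v 1
  c_le : ∀ v, Structure.RelMap (M := M) rLe v ↔ v 0 ≤ v 1

section
variable {M : Type} [Zero M] [One M] [Add M] [Mul M] [LE M] [LA.Structure M] [Cmp M]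
variable {α : Type} {n : ℕ} (v : α → M) (xs : Fin n → M)

@[simp] theorem real_zeroT : (zeroT : LA.Term (α ⊕ Fin n)).realize (Sum.elim v xs) = 0 := by
  simp only [zeroT, Constants.term, Term.realize]; exact Cmp.c_zero _
@[simp] theorem real_succT (t : LA.Term (α ⊕ Fin n)) :
    (succT t).realize (Sum.elim v xs) = t.realize (Sum.elim v xs) + 1 := by
  simp only [succT, Functions.apply₁, Term.realize]; exact Cmp.c_succ _
@[simp] theorem real_addT (t u : LA.Term (α ⊕ Fin n)) :
    (addT t u).realize (Sum.elim v xs) = t.realize (Sum.elim v xs) + u.realize (Sum.elim v xs) := by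
  simp only [addT, Functions.apply₂, Term.realize]; exact Cmp.c_add _
@[simp] theorem real_mulT (t u : LA.Term (α ⊕ Fin n)) :
    (mulT t u).realize (Sum.elim v xs) = t.realize (Sum.elim v xs) * u.realize (Sum.elim v xs) := by
  simp only [mulT, Functions.apply₂, Term.realize]; exact Cmp.c_mul _
@[simp] theorem real_leF (t u : LA.Term (α ⊕ Fin n)) :
    (leF t u).Realize v xs ↔ t.realize (Sum.elim v xs) ≤ u.realize (Sum.elim v xs) := by
  simp only [leF, Relations.boundedFormula₂, BoundedFormula.Realize, Relations.boundedFormula]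
  exact Cmp.c_le _
@[simp] theorem real_vT (w : Empty → M) (i : Fin n) :
    (vT i).realize (Sum.elim w xs) = xs i := rfl

end

/-- truncation of a context -/
def ini {M : Type} {k : ℕ} (v : Fin (k+1) → M) : Fin k → M := fun j => v j.castSucc

@[simp] theorem ini_snoc {M : Type} {k : ℕ} (v : Fin k → M) (a : M) :
    ini (Fin.snoc v a : Fin (k+1) → M) = v := by
  funext j; simp [ini]

theorem snoc_ini {M : Type} {k : ℕ} (v : Fin (k+1) → M) :
    (Fin.snoc (ini v) (v (Fin.last k)) : Fin (k+1) → M) = v := by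
  funext j; refine Fin.lastCases ?_ (fun j => ?_) j <;> simp [ini]

/-- variable projections -/
def Vr {M : Type} {m k : ℕ} (g : (Fin m → M) → (Fin k → M)) : Prop :=
  ∃ ρ : Fin k → Fin m, ∀ v, g v = fun j => v (ρ j)

theorem Vr.id {M : Type} {m : ℕ} : Vr (fun v : Fin m → M => v) := ⟨fun j => j, fun _ => rfl⟩
theorem Vr.ini {M : Type} {m k : ℕ} {g : (Fin m → M) → (Fin (k+1) → M)} (h : Vr g) :
    Vr (fun v => ini (g v)) := by
  obtain ⟨ρ, h⟩ := h
  exact ⟨fun j => ρ j.castSucc, fun v => by funext j; simp [Guaspari.ini, h]⟩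


/-- lifting of a renaming -/
def lft {m k : ℕ} (ρ : Fin m → Fin k) : Fin (m+1) → Fin (k+1) :=
  Fin.snoc (α := fun _ => Fin (k+1)) (fun j => (ρ j).castSucc) (Fin.last k)

/-- renaming of bound variables -/
def ren {α : Type} : ∀ {m : ℕ}, LA.BoundedFormula α m → ∀ {k : ℕ}, (Fin m → Fin k) →
    LA.BoundedFormula α k
  | _, .falsum, _, _ => .falsum
  | _, .equal t u, _, ρ => .equal (t.relabel (Sum.map id ρ)) (u.relabel (Sum.map id ρ))
  | _, .rel R ts, _, ρ => .rel R (fun i => (ts i).relabel (Sum.map id ρ))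
  | _, .imp φ ψ, _, ρ => .imp (ren φ ρ) (ren ψ ρ)
  | _, .all φ, _, ρ => .all (ren φ (lft ρ))

theorem snoc_lft {M : Type} {m k : ℕ} (ρ : Fin m → Fin k) (xs : Fin k → M) (a : M) :
    (fun j => (Fin.snoc xs a : Fin (k+1) → M) (lft ρ j)) = Fin.snoc (fun j => xs (ρ j)) a := by
  funext j; refine Fin.lastCases ?_ (fun j => ?_) j <;> simp [lft]

theorem real_rlb {M α : Type} [LA.Structure M] {m k : ℕ} (t : LA.Term (α ⊕ Fin m))
    (ρ : Fin m → Fin k) (v : α → M) (xs : Fin k → M) :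
    (t.relabel (Sum.map id ρ)).realize (Sum.elim v xs) =
      t.realize (Sum.elim v (fun j => xs (ρ j))) := by
  rw [Term.realize_relabel]; congr 1; funext x; cases x <;> rfl

theorem real_ren {M α : Type} [LA.Structure M] {m : ℕ} (φ : LA.BoundedFormula α m) (v : α → M) :
    ∀ {k : ℕ} (ρ : Fin m → Fin k) (xs : Fin k → M),
    (ren φ ρ).Realize v xs ↔ φ.Realize v (fun j => xs (ρ j)) := by
  induction φ with
  | falsum => intros; rfl
  | equal t u => intro k ρ xs; simp only [ren, BoundedFormula.Realize, real_rlb]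
  | rel R ts => intro k ρ xs; simp only [ren, BoundedFormula.Realize, real_rlb]
  | imp φ ψ h1 h2 => intro k ρ xs; simp only [ren, BoundedFormula.Realize, h1, h2]
  | all φ h => intro k ρ xs; simp only [ren, BoundedFormula.Realize, h, snoc_lft]

/-- generic composition lemma -/
theorem comp_gen {ι : Type*} {𝓜 : ι → Type}
    (D : ∀ {k : ℕ}, (∀ i, (Fin k → 𝓜 i) → Prop) → Prop)
    (F : ∀ {k : ℕ}, (∀ i, (Fin k → 𝓜 i) → 𝓜 i) → Prop)
    (dr : ∀ {m k : ℕ} (P : ∀ i, (Fin m → 𝓜 i) → Prop) (ρ : Fin m → Fin k), D P →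
      D (fun i (v : Fin k → 𝓜 i) => P i (fun j => v (ρ j))))
    (fr : ∀ {m k : ℕ} (P : ∀ i, (Fin m → 𝓜 i) → 𝓜 i) (ρ : Fin m → Fin k), F P →
      F (fun i (v : Fin k → 𝓜 i) => P i (fun j => v (ρ j))))
    (c1 : ∀ {k : ℕ} (P : ∀ i, (Fin (k+1) → 𝓜 i) → Prop) (f : ∀ i, (Fin k → 𝓜 i) → 𝓜 i),
      D P → F f → D (fun i v => P i (Fin.snoc v (f i v))))
    {m k : ℕ} (P : ∀ i, (Fin m → 𝓜 i) → Prop) (hP : D P)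
    (f : Fin m → ∀ i, (Fin k → 𝓜 i) → 𝓜 i) (hf : ∀ j, F (f j)) :
    D (fun i v => P i (fun j => f j i v)) := by
  have key : ∀ (m : ℕ) (Q : ∀ i, (Fin (k+m) → 𝓜 i) → Prop) (_ : D Q)
      (f : Fin m → ∀ i, (Fin k → 𝓜 i) → 𝓜 i) (_ : ∀ j, F (f j)),
      D (fun i v => Q i (Fin.append v (fun j => f j i v))) := by
    intro m
    induction m with
    | zero =>
      intro Q hQ f hf
      have := dr (k := k) Q (fun j => j) hQ
      convert this using 4 with i v
      funext j
      rw [show j = Fin.castAdd 0 j from rfl, Fin.append_left]; rfl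
    | succ m ih =>
      intro Q hQ f hf
      have h1 := c1 (k := k + m) Q (fun i v => f (Fin.last m) i (fun j => v (Fin.castAdd m j))) hQ
        (fr _ _ (hf _))
      have h2 := ih _ h1 (fun j => f j.castSucc) (fun j => hf _)
      convert h2 using 4 with i v
      funext j
      refine Fin.lastCases ?_ (fun j => ?_) j
      · refine Eq.trans ?_ (Fin.snoc_last (α := fun _ => 𝓜 i) (n := k + m) _ _).symm
        rw [show Fin.last (k.add m) = Fin.natAdd k (Fin.last m) from rfl]
        refine (Fin.append_right _ _ _).trans ?_
        congr 1; funext j; simp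
      · refine Eq.trans ?_ (Fin.snoc_castSucc (α := fun _ => 𝓜 i) (n := k + m) _ _ j).symm
        refine Fin.addCases (fun j => ?_) (fun j => ?_) j
        · rw [Fin.append_left]; exact Fin.append_left v (fun j => f j i v) j
        · rw [Fin.append_right]; exact Fin.append_right v (fun j => f j i v) j.castSucc
  have h := key m (fun i v => P i (fun j => v (Fin.natAdd k j))) (dr _ _ hP) f hf
  convert h using 4 with i v
  funext j
  simp

section dp
variable {M : Type} [Zero M] [One M] [Add M] [Mul M] [LE M] [LA.Structure M] [Cmp M]
variable {k m : ℕ}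

/-- term functions with parameters -/
def Tp (f : (Fin k → M) → M) : Prop :=
  ∃ t : LA.Term (M ⊕ Fin k), ∀ v, t.realize (Sum.elim (fun x : M => x) v) = f v

/-- definable with parameters -/
def Dp (P : (Fin k → M) → Prop) : Prop :=
  ∃ φ : LA.BoundedFormula M k, ∀ v, φ.Realize (fun x : M => x) v ↔ P v

theorem Tp.const (c : M) : Tp (fun _ : Fin k → M => c) := ⟨Term.var (Sum.inl c), fun _ => rfl⟩
theorem Tp.var {g : (Fin m → M) → (Fin k → M)} (h : Vr g) (j : Fin k) : Tp (fun v => g v j) := by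
  obtain ⟨ρ, h⟩ := h
  exact ⟨Term.var (Sum.inr (ρ j)), fun v => by simp [h]⟩
theorem Tp.add {f g : (Fin k → M) → M} (hf : Tp f) (hg : Tp g) : Tp (fun v => f v + g v) := by
  obtain ⟨t, ht⟩ := hf
  obtain ⟨u, hu⟩ := hg
  exact ⟨addT t u, fun v => by simp [ht, hu]⟩
theorem Tp.mul {f g : (Fin k → M) → M} (hf : Tp f) (hg : Tp g) : Tp (fun v => f v * g v) := by
  obtain ⟨t, ht⟩ := hf
  obtain ⟨u, hu⟩ := hg
  exact ⟨mulT t u, fun v => by simp [ht, hu]⟩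


theorem Tp.one : Tp (fun _ : Fin k → M => (1 : M)) := Tp.const _

theorem Dp.of_iff {P Q : (Fin k → M) → Prop} (h : Dp P) (e : ∀ v, Q v ↔ P v) : Dp Q := by
  obtain ⟨φ, h⟩ := h
  exact ⟨φ, fun v => (h v).trans (e v).symm⟩

theorem Dp.eq {f g : (Fin k → M) → M} (hf : Tp f) (hg : Tp g) : Dp (fun v => f v = g v) := by
  obtain ⟨t, ht⟩ := hf
  obtain ⟨u, hu⟩ := hg
  exact ⟨t.bdEqual u, fun v => by simp [ht, hu]⟩
theorem Dp.le {f g : (Fin k → M) → M} (hf : Tp f) (hg : Tp g) : Dp (fun v => f v ≤ g v) := by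
  obtain ⟨t, ht⟩ := hf
  obtain ⟨u, hu⟩ := hg
  exact ⟨leF t u, fun v => by simp [ht, hu]⟩
theorem Dp.imp {P Q : (Fin k → M) → Prop} (hf : Dp P) (hg : Dp Q) : Dp (fun v => P v → Q v) := by
  obtain ⟨t, ht⟩ := hf
  obtain ⟨u, hu⟩ := hg
  exact ⟨t.imp u, fun v => by simp [ht, hu]⟩
theorem Dp.and {P Q : (Fin k → M) → Prop} (hf : Dp P) (hg : Dp Q) : Dp (fun v => P v ∧ Q v) := by
  obtain ⟨t, ht⟩ := hf
  obtain ⟨u, hu⟩ := hg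
  exact ⟨t ⊓ u, fun v => by simp [ht, hu]⟩
theorem Dp.or {P Q : (Fin k → M) → Prop} (hf : Dp P) (hg : Dp Q) : Dp (fun v => P v ∨ Q v) := by
  obtain ⟨t, ht⟩ := hf
  obtain ⟨u, hu⟩ := hg
  exact ⟨t ⊔ u, fun v => by simp [ht, hu]⟩
theorem Dp.not {P : (Fin k → M) → Prop} (hf : Dp P) : Dp (fun v => ¬ P v) := by
  obtain ⟨t, ht⟩ := hf
  exact ⟨t.not, fun v => by simp [ht]⟩
theorem Dp.iff {P Q : (Fin k → M) → Prop} (hf : Dp P) (hg : Dp Q) : Dp (fun v => P v ↔ Q v) :=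
  ((hf.imp hg).and (hg.imp hf)).of_iff fun _ => iff_def
theorem Dp.all {P : (Fin k → M) → M → Prop}
    (h : Dp (fun v : Fin (k+1) → M => P (ini v) (v (Fin.last k)))) : Dp (fun v => ∀ y, P v y) := by
  obtain ⟨t, ht⟩ := h
  exact ⟨t.all, fun v => by simp [ht]⟩
theorem Dp.ex {P : (Fin k → M) → M → Prop}
    (h : Dp (fun v : Fin (k+1) → M => P (ini v) (v (Fin.last k)))) : Dp (fun v => ∃ y, P v y) := by
  obtain ⟨t, ht⟩ := h
  exact ⟨t.ex, fun v => by simp [ht]⟩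
theorem Dp.prop (p : Prop) : Dp (fun _ : Fin k → M => p) := by
  by_cases h : p
  · exact ⟨⊤, fun v => by simp [h]⟩
  · exact ⟨⊥, fun v => by simp [h]⟩
theorem Dp.ren {P : (Fin m → M) → Prop} (ρ : Fin m → Fin k) (h : Dp P) :
    Dp (fun v : Fin k → M => P (fun j => v (ρ j))) := by
  obtain ⟨t, ht⟩ := h
  exact ⟨Guaspari.ren t ρ, fun v => by rw [real_ren, ht]⟩
theorem Dp.vr {P : (Fin m → M) → Prop} {g : (Fin k → M) → (Fin m → M)} (hg : Vr g) (h : Dp P) :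
    Dp (fun v : Fin k → M => P (g v)) := by
  obtain ⟨ρ, hρ⟩ := hg
  simpa only [hρ] using h.ren ρ

/-- functions with definable graph -/
def Fp (f : (Fin k → M) → M) : Prop := Dp (fun v : Fin (k+1) → M => v (Fin.last k) = f (ini v))

theorem Tp.ren {P : (Fin m → M) → M} (ρ : Fin m → Fin k) (h : Tp P) :
    Tp (fun v : Fin k → M => P (fun j => v (ρ j))) := by
  obtain ⟨t, ht⟩ := h
  exact ⟨t.relabel (Sum.map id ρ), fun v => by rw [real_rlb, ht]⟩

theorem Tp.fp {f : (Fin k → M) → M} (h : Tp f) : Fp f := by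
  refine Dp.eq (Tp.var Vr.id _) (Tp.ren (fun j => j.castSucc) h)

theorem Dp.comp {P : (Fin m → M) → Prop} (hP : Dp P)
    (f : Fin m → (Fin k → M) → M) (hf : ∀ j, Fp (f j)) : Dp (fun v => P (fun j => f j v)) := by
  refine comp_gen (ι := Unit) (𝓜 := fun _ => M) (fun P => Dp (P ())) (fun P => Fp (P ()))
    (fun P ρ h => h.ren ρ) (fun {m k} P ρ h => ?_) (fun {k} P f hP hf => ?_) (fun _ => P) hP
    (fun j _ => f j) hf
  · have := Dp.ren (k := k+1) (lft ρ) h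
    refine this.of_iff fun v => ?_
    conv_rhs => rw [← snoc_ini v, snoc_lft]
    simp
  · refine (Dp.ex (P := fun v y => y = f () v ∧ P () (Fin.snoc v y)) (hf.and ?_)).of_iff ?_
    · simpa only [snoc_ini] using hP
    · intro v; simp

theorem Dp.comp1 {P : M → Prop} (hP : Dp (fun v : Fin 1 → M => P (v 0)))
    {f : (Fin k → M) → M} (hf : Fp f) : Dp (fun v => P (f v)) :=
  hP.comp ![f] (by intro j; fin_cases j; exact hf)
theorem Dp.comp2 {P : M → M → Prop} (hP : Dp (fun v : Fin 2 → M => P (v 0) (v 1)))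
    {f g : (Fin k → M) → M} (hf : Fp f) (hg : Fp g) : Dp (fun v => P (f v) (g v)) :=
  hP.comp ![f, g] (by intro j; fin_cases j; exacts [hf, hg])
theorem Dp.comp3 {P : M → M → M → Prop} (hP : Dp (fun v : Fin 3 → M => P (v 0) (v 1) (v 2)))
    {f g h : (Fin k → M) → M} (hf : Fp f) (hg : Fp g) (hh : Fp h) :
    Dp (fun v => P (f v) (g v) (h v)) :=
  hP.comp ![f, g, h] (by intro j; fin_cases j; exacts [hf, hg, hh])

theorem Dp.eqF {f g : (Fin k → M) → M} (hf : Fp f) (hg : Fp g) : Dp (fun v => f v = g v) :=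
  Dp.comp2 (P := fun x y => x = y) (Dp.eq (Tp.var Vr.id _) (Tp.var Vr.id _)) hf hg
theorem Dp.leF {f g : (Fin k → M) → M} (hf : Fp f) (hg : Fp g) : Dp (fun v => f v ≤ g v) :=
  Dp.comp2 (P := fun x y => x ≤ y) (Dp.le (Tp.var Vr.id _) (Tp.var Vr.id _)) hf hg

end dp

theorem vrt {p : Prop} (h : p := by repeat' (first | exact Vr.id | apply Vr.ini)) : p := h
theorem tpt {p : Prop} (h : p := by
  repeat' (first | apply Tp.add | apply Tp.mul | (refine Tp.var ?_ _; exact vrt) | exact Tp.const _)) : p := h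
theorem dpt {p : Prop} (h : p := by
  repeat' (first
    | exact Dp.prop _
    | apply Dp.iff | apply Dp.and | apply Dp.or | apply Dp.not | apply Dp.ex
    | (refine Dp.eq ?_ ?_; exact tpt; exact tpt) | (refine Dp.le ?_ ?_; exact tpt; exact tpt)
    | apply Dp.all | apply Dp.imp)) : p := h

example {M : Type} [Zero M] [One M] [Add M] [Mul M] [LE M] [LA.Structure M] [Cmp M] (c d : M) :
  Dp (fun v : Fin 2 → M => ∀ x, x ≤ v 0 → (∃ y, y * c + d = x ∧ ¬ y = v 1) ∨ ∀ z, z ≤ x) := dpt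


/-- induction for parameter free formulas with variables -/
class Ind (M : Type) [Zero M] [One M] [Add M] [LA.Structure M] : Prop where
  ind : ∀ {k : ℕ} (φ : LA.BoundedFormula Empty (k+1)) (xs : Fin k → M),
    φ.Realize default (Fin.snoc xs 0) →
    (∀ a, φ.Realize default (Fin.snoc xs a) → φ.Realize default (Fin.snoc xs (a+1))) →
    ∀ a, φ.Realize default (Fin.snoc xs a)

theorem ind_dp {M : Type} [Zero M] [One M] [Add M] [LA.Structure M] [Ind M]
    {P : M → Prop} (h : Dp (fun v : Fin 1 → M => P (v 0)))
    (h0 : P 0) (hs : ∀ a, P a → P (a+1)) (a : M) : P a := by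
  classical
  obtain ⟨φ, hφ⟩ := h
  set S := φ.freeVarFinset
  let e := S.equivFin
  let φ1 : LA.BoundedFormula (Fin S.card) 1 := φ.restrictFreeVar (fun x => e x)
  let φ2 : LA.BoundedFormula Empty (S.card + 1) := φ1.relabel (fun j => Sum.inr j)
  have key : ∀ y : M, φ2.Realize default (Fin.snoc (fun j => ((e.symm j : S) : M)) y) ↔ P y := by
    intro y
    rw [BoundedFormula.realize_relabel]
    have h2 := hφ (fun _ => y)
    refine Iff.trans ?_ h2
    have := BoundedFormula.realize_restrictFreeVar (L := LA) (M := M) (φ := φ) (f := fun x => e x)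
      (v' := fun x : M => x) (v := fun j => ((e.symm j : S) : M)) (xs := fun _ : Fin 1 => y) (by simp)
    rw [← this]
    apply iff_of_eq
    congr 1
    · funext j
      change (Fin.snoc (fun j => ((e.symm j : S) : M)) y : Fin (S.card+1) → M) (Fin.castAdd 1 j) = _
      exact Fin.snoc_castSucc (α := fun _ => M) _ _ _
    · funext j
      change (Fin.snoc (fun j => ((e.symm j : S) : M)) y : Fin (S.card+1) → M) (Fin.natAdd _ j) = _
      have : Fin.natAdd S.card j = Fin.last S.card := by ext; simp
      rw [this]
      exact Fin.snoc_last (α := fun _ => M) _ _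
  rw [← key]
  exact Ind.ind φ2 _ ((key 0).2 h0) (fun b hb => (key _).2 (hs b ((key b).1 hb))) a

/-- Models of PA, as ordered semirings. -/
class PAM (M : Type) [CommSemiring M] [LinearOrder M] [IsStrictOrderedRing M]
    [CanonicallyOrderedAdd M] [LA.Structure M] : Prop extends Cmp M, Ind M where
  ltS : ∀ {a b : M}, a < b → a + 1 ≤ b


/-- the ordered semiring structure of a model of PA -/
structure PMI (M : Type) [LA.Structure M] where
  i1 : CommSemiring M
  i2 : LinearOrder M
  i3 : IsStrictOrderedRing M
  i4 : CanonicallyOrderedAdd M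
  i5 : PAM M

theorem mk_PAM2 {M : Type} [CommSemiring M] [LinearOrder M]
    (canc : ∀ a b c : M, a + c = b + c → a = b) (a7 : ∀ a b : M, a ≤ b ↔ ∃ c, c + a = b)
    (zs : ∀ a : M, a = 0 ∨ ∃ b, a = b + 1) (a1 : ∀ a : M, a + 1 ≠ 0) :
    IsStrictOrderedRing M ∧ CanonicallyOrderedAdd M ∧ ∀ a b : M, a < b → a + 1 ≤ b := by
  have lt_iff : ∀ a b : M, a < b ↔ ∃ c, b = a + c + 1 := by
    intro a b
    constructor
    · intro h
      obtain ⟨d, rfl⟩ := (a7 _ _).1 h.le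
      rcases zs d with rfl | ⟨e, rfl⟩
      · rw [zero_add] at h; exact absurd h (lt_irrefl _)
      · exact ⟨e, by ring⟩
    · rintro ⟨c, rfl⟩
      refine lt_of_le_of_ne ((a7 _ _).2 ⟨c + 1, by ring⟩) ?_
      intro h
      rw [add_assoc] at h
      have h2 : c + 1 = 0 := canc _ _ a ((add_comm _ _).trans (h.symm.trans (zero_add a).symm))
      exact a1 _ h2
  have le_add : ∀ a b c : M, a ≤ b → a + c ≤ b + c := by
    intro a b c h
    obtain ⟨d, rfl⟩ := (a7 _ _).1 h
    exact (a7 _ _).2 ⟨d, by ring⟩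
  have lm : ∀ a b c : M, a < b → 0 < c → c * a < c * b := by
    intro a b c h hc
    obtain ⟨d, rfl⟩ := (lt_iff _ _).1 h
    obtain ⟨e, rfl⟩ := (lt_iff _ _).1 hc
    exact (lt_iff _ _).2 ⟨e * d + e + d, by ring⟩
  refine ⟨?_, ?_, ?_⟩
  · exact
      { add_le_add_left := fun a b h c => le_add a b c h
        le_of_add_le_add_left := fun a b c h => by
          obtain ⟨d, hd⟩ := (a7 _ _).1 h
          exact (a7 _ _).2 ⟨d, canc _ _ a (by rw [← add_comm a c, ← hd]; ring)⟩
        zero_le_one := (a7 _ _).2 ⟨1, by ring⟩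
        exists_pair_ne := ⟨1, 0, by simpa using a1 0⟩
        mul_lt_mul_of_pos_left := fun c hc a b h => lm a b c h hc
        mul_lt_mul_of_pos_right := fun c hc a b h => by
          simpa [mul_comm] using lm a b c h hc }
  · exact
      { exists_add_of_le := fun {a b} h => by
          obtain ⟨d, hd⟩ := (a7 _ _).1 h
          exact ⟨d, by rw [← hd, add_comm]⟩
        le_add_self := fun a b => (a7 _ _).2 ⟨b, rfl⟩
        le_self_add := fun a b => (a7 _ _).2 ⟨b, add_comm _ _⟩ }
  · intro a b h
    obtain ⟨c, rfl⟩ := (lt_iff _ _).1 h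
    exact (a7 _ _).2 ⟨c, by ring⟩

theorem mk_PAM {M : Type} [iz : Zero M] [io : One M] [ia : Add M] [im : Mul M] [il : LE M]
    [LA.Structure M] [cm : Cmp M] [ii : Ind M] (a1 : ∀ a : M, a + 1 ≠ 0)
    (a2 : ∀ a b : M, a + 1 = b + 1 → a = b) (a3 : ∀ a : M, a + 0 = a)
    (a4 : ∀ a b : M, a + (b + 1) = (a + b) + 1) (a5 : ∀ a : M, a * 0 = 0)
    (a6 : ∀ a b : M, a * (b + 1) = a * b + a) (a7 : ∀ a b : M, a ≤ b ↔ ∃ c, c + a = b) :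
    Nonempty (PMI M) := by
  have zadd : ∀ a : M, 0 + a = a := by
    intro a
    refine ind_dp (P := fun a : M => 0 + a = a) dpt (a3 0) (fun a h => ?_) a
    rw [a4, h]
  have assoc : ∀ a b c : M, a + b + c = a + (b + c) := by
    intro a b c
    refine ind_dp (P := fun c : M => a + b + c = a + (b + c)) dpt ?_ (fun c h => ?_) c
    · simp only [a3]
    · simp only [a4, h]
  have sadd : ∀ a b : M, (a + 1) + b = (a + b) + 1 := by
    intro a b
    refine ind_dp (P := fun b : M => (a + 1) + b = (a + b) + 1) dpt ?_ (fun c h => ?_) b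
    · simp only [a3]
    · simp only [a4, h]
  have comm : ∀ a b : M, a + b = b + a := by
    intro a b
    refine ind_dp (P := fun b : M => a + b = b + a) dpt ?_ (fun c h => ?_) b
    · simp only [a3, zadd]
    · simp only [a4, h, sadd]
  have canc : ∀ a b c : M, a + c = b + c → a = b := by
    intro a b c
    refine ind_dp (P := fun c : M => a + c = b + c → a = b) dpt ?_ (fun c h => ?_) c
    · simp only [a3]; exact fun h => h
    · simp only [a4]; exact fun h' => h (a2 _ _ h')
  have zmul : ∀ a : M, 0 * a = 0 := by
    intro a
    refine ind_dp (P := fun a : M => 0 * a = 0) dpt (a5 0) (fun a h => ?_) a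
    rw [a6, h, a3]
  have smul : ∀ a b : M, (a + 1) * b = a * b + b := by
    intro a b
    refine ind_dp (P := fun b : M => (a + 1) * b = a * b + b) dpt ?_ (fun c h => ?_) b
    · simp only [a5, a3]
    · simp only [a6, h, a4]
      rw [← a4, ← a4, assoc, assoc (a * c), ← assoc c a 1, comm c a, assoc]
  have mcomm : ∀ a b : M, a * b = b * a := by
    intro a b
    refine ind_dp (P := fun b : M => a * b = b * a) dpt ?_ (fun c h => ?_) b
    · simp only [a5, zmul]
    · simp only [a6, h, smul]
  have ldist : ∀ a b c : M, a * (b + c) = a * b + a * c := by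
    intro a b c
    refine ind_dp (P := fun c : M => a * (b + c) = a * b + a * c) dpt ?_ (fun c h => ?_) c
    · simp only [a5, a3]
    · rw [a4, a6, h, a6, assoc]
  have massoc : ∀ a b c : M, a * b * c = a * (b * c) := by
    intro a b c
    refine ind_dp (P := fun c : M => a * b * c = a * (b * c)) dpt ?_ (fun c h => ?_) c
    · simp only [a5]
    · simp only [a6, h, ldist]
  have onem : ∀ a : M, 1 * a = a := by
    intro a
    have := smul 0 a
    rwa [zadd, zmul, zadd] at this
  have zs : ∀ a : M, a = 0 ∨ ∃ b, a = b + 1 := by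
    intro a
    refine ind_dp (P := fun a : M => a = 0 ∨ ∃ b, a = b + 1) dpt (Or.inl rfl) (fun c _ => ?_) a
    exact Or.inr ⟨c, rfl⟩
  have add0 : ∀ a b : M, a + b = 0 → b = 0 := by
    intro a b h
    rcases zs b with h' | ⟨c, rfl⟩
    · exact h'
    · rw [a4] at h; exact absurd h (a1 _)
  have refl : ∀ a : M, a ≤ a := fun a => (a7 a a).2 ⟨0, zadd a⟩
  have trans : ∀ a b c : M, a ≤ b → b ≤ c → a ≤ c := by
    intro a b c h1 h2
    obtain ⟨d, rfl⟩ := (a7 _ _).1 h1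
    obtain ⟨e, rfl⟩ := (a7 _ _).1 h2
    exact (a7 _ _).2 ⟨e + d, assoc _ _ _⟩
  have anti : ∀ a b : M, a ≤ b → b ≤ a → a = b := by
    intro a b h1 h2
    obtain ⟨d, rfl⟩ := (a7 _ _).1 h1
    obtain ⟨e, he⟩ := (a7 _ _).1 h2
    rw [← assoc] at he
    have : e + d = 0 := canc _ _ a (he.trans (zadd a).symm)
    rw [add0 _ _ this, zadd]
  have total : ∀ a b : M, a ≤ b ∨ b ≤ a := by
    intro a b
    refine ind_dp (P := fun b : M => a ≤ b ∨ b ≤ a) dpt ?_ (fun c h => ?_) b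
    · exact Or.inr ((a7 _ _).2 ⟨a, a3 a⟩)
    · rcases h with h | h
      · exact Or.inl (trans _ _ _ h ((a7 _ _).2 ⟨1, comm _ _⟩))
      · obtain ⟨d, rfl⟩ := (a7 _ _).1 h
        rcases zs d with rfl | ⟨e, rfl⟩
        · rw [zadd]; exact Or.inl ((a7 _ _).2 ⟨1, comm _ _⟩)
        · refine Or.inr ((a7 _ _).2 ⟨e, ?_⟩)
          rw [sadd, a4]
  classical
  let i1 : CommSemiring M :=
    { zero := 0, one := 1, add := (· + ·), mul := (· * ·), add_assoc := assoc, zero_add := zadd,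
      add_zero := a3, add_comm := comm, mul_assoc := massoc, one_mul := onem,
      mul_one := fun a => (mcomm a 1).trans (onem a), left_distrib := ldist,
      right_distrib := fun a b c => by
        change (a + b) * c = a * c + b * c
        rw [mcomm, ldist, mcomm c a, mcomm c b],
      zero_mul := zmul, mul_zero := a5, mul_comm := mcomm, nsmul := nsmulRec }
  let i2 : LinearOrder M :=
    { le := (· ≤ ·), le_refl := refl, le_trans := trans, le_antisymm := anti, le_total := total,
      toDecidableLE := Classical.decRel _ }
  obtain ⟨i3, i4, i5⟩ := mk_PAM2 (M := M) canc (fun a b => a7 a b) zs (fun a => a1 a)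
  exact ⟨⟨i1, i2, i3, i4, { cm, ii with ltS := fun {a b} => i5 a b }⟩⟩

section raw
variable {M : Type} [S : LA.Structure M]

theorem alls_ind {k : ℕ} (φ : LA.BoundedFormula Empty k) (h : M ⊨ φ.alls) (xs : Fin k → M) :
    φ.Realize default xs := (BoundedFormula.realize_alls).1 h xs

theorem exists_PAM (h : M ⊨ PAAx) : Nonempty (PMI M) := by
  let iz : Zero M := ⟨Structure.funMap fZero Fin.elim0⟩
  let io : One M := ⟨Structure.funMap fSucc (fun _ => 0)⟩
  let ia : Add M := ⟨fun a b => Structure.funMap fAdd ![a, b]⟩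
  let im : Mul M := ⟨fun a b => Structure.funMap fMul ![a, b]⟩
  let il : LE M := ⟨fun a b => Structure.RelMap rLe ![a, b]⟩
  let sc : M → M := fun a => Structure.funMap fSucc (fun _ => a)
  have f0 : ∀ v, Structure.funMap (M := M) fZero v = 0 := by
    intro v; rw [Subsingleton.elim v Fin.elim0]; rfl
  have f1 : ∀ v, Structure.funMap (M := M) fSucc v = sc (v 0) := by
    intro v; congr 1; funext j; rw [Subsingleton.elim j 0]
  have f2 : ∀ v, Structure.funMap (M := M) fAdd v = v 0 + v 1 := by
    intro v; change _ = Structure.funMap fAdd ![v 0, v 1]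
    congr 1; funext j; fin_cases j <;> rfl
  have f3 : ∀ v, Structure.funMap (M := M) fMul v = v 0 * v 1 := by
    intro v; change _ = Structure.funMap fMul ![v 0, v 1]
    congr 1; funext j; fin_cases j <;> rfl
  have f4 : ∀ v, Structure.RelMap (M := M) rLe v ↔ v 0 ≤ v 1 := by
    intro v; change _ ↔ Structure.RelMap rLe ![v 0, v 1]
    apply iff_of_eq
    congr 1; funext j; fin_cases j <;> rfl
  have rz : ∀ {n : ℕ} (v : Empty → M) (xs : Fin n → M),
      (zeroT : LA.Term (Empty ⊕ Fin n)).realize (Sum.elim v xs) = 0 := by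
    intros; simp only [zeroT, Constants.term, Term.realize]; exact f0 _
  have rs : ∀ {n : ℕ} (v : Empty → M) (xs : Fin n → M) (t : LA.Term (Empty ⊕ Fin n)),
      (succT t).realize (Sum.elim v xs) = sc (t.realize (Sum.elim v xs)) := by
    intros; simp only [succT, Functions.apply₁, Term.realize]; exact f1 _
  have ra : ∀ {n : ℕ} (v : Empty → M) (xs : Fin n → M) (t u : LA.Term (Empty ⊕ Fin n)),
      (addT t u).realize (Sum.elim v xs) =
        t.realize (Sum.elim v xs) + u.realize (Sum.elim v xs) := by
    intros; simp only [addT, Functions.apply₂, Term.realize]; exact f2 _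
  have rm : ∀ {n : ℕ} (v : Empty → M) (xs : Fin n → M) (t u : LA.Term (Empty ⊕ Fin n)),
      (mulT t u).realize (Sum.elim v xs) =
        t.realize (Sum.elim v xs) * u.realize (Sum.elim v xs) := by
    intros; simp only [mulT, Functions.apply₂, Term.realize]; exact f3 _
  have rl : ∀ {n : ℕ} (v : Empty → M) (xs : Fin n → M) (t u : LA.Term (Empty ⊕ Fin n)),
      (leF t u).Realize v xs ↔
        t.realize (Sum.elim v xs) ≤ u.realize (Sum.elim v xs) := by
    intros; simp only [leF, Relations.boundedFormula₂, BoundedFormula.Realize,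
      Relations.boundedFormula]; exact f4 _
  have mem : ∀ φ ∈ PAAx, M ⊨ φ := fun φ hφ => h.realize_of_mem φ hφ
  have s2 : ∀ a b : M, (Fin.snoc (Fin.snoc (default : Fin 0 → M) a) b : Fin 2 → M) = ![a, b] := by
    intro a b; funext j; fin_cases j <;> rfl
  have s1 : ∀ a : M, (Fin.snoc (default : Fin 0 → M) a : Fin 1 → M) = ![a] := by
    intro a; funext j; fin_cases j; rfl
  have s3 : ∀ a b c : M, (Fin.snoc ![a, b] c : Fin 3 → M) = ![a, b, c] := by
    intro a b c; funext j; fin_cases j <;> rfl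
  have s2' : ∀ a b : M, (Fin.snoc ![a] b : Fin 2 → M) = ![a, b] := by
    intro a b; funext j; fin_cases j <;> rfl
  have a1 : ∀ a : M, sc a ≠ 0 := by
    have := mem _ (Or.inl (Or.inl rfl))
    simpa [Sentence.Realize, Formula.Realize, rz, rs, ra, rm, rl, s1, s2', s3, vT] using this
  have a2 : ∀ a b : M, sc a = sc b → a = b := by
    have := mem _ (Or.inl (Or.inr (Or.inl rfl)))
    simpa [Sentence.Realize, Formula.Realize, rz, rs, ra, rm, rl, s1, s2', s3, vT] using this
  have a3 : ∀ a : M, a + 0 = a := by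
    have := mem _ (Or.inl (Or.inr (Or.inr (Or.inl rfl))))
    simpa [Sentence.Realize, Formula.Realize, rz, rs, ra, rm, rl, s1, s2', s3, vT] using this
  have a4 : ∀ a b : M, a + sc b = sc (a + b) := by
    have := mem _ (Or.inl (Or.inr (Or.inr (Or.inr (Or.inl rfl)))))
    simpa [Sentence.Realize, Formula.Realize, rz, rs, ra, rm, rl, s1, s2', s3, vT] using this
  have a5 : ∀ a : M, a * 0 = 0 := by
    have := mem _ (Or.inl (Or.inr (Or.inr (Or.inr (Or.inr (Or.inl rfl))))))
    simpa [Sentence.Realize, Formula.Realize, rz, rs, ra, rm, rl, s1, s2', s3, vT] using this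
  have a6 : ∀ a b : M, a * sc b = a * b + a := by
    have := mem _ (Or.inl (Or.inr (Or.inr (Or.inr (Or.inr (Or.inr (Or.inl rfl)))))))
    simpa [Sentence.Realize, Formula.Realize, rz, rs, ra, rm, rl, s1, s2', s3, vT] using this
  have a7 : ∀ a b : M, a ≤ b ↔ ∃ c, c + a = b := by
    have := mem _ (Or.inl (Or.inr (Or.inr (Or.inr (Or.inr (Or.inr (Or.inr rfl)))))))
    simpa [Sentence.Realize, Formula.Realize, rz, rs, ra, rm, rl, s1, s2', s3, vT] using this
  have hsc : ∀ a, sc a = a + 1 := fun a => by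
    change _ = a + sc 0; rw [a4, a3]
  have cm : Cmp M := ⟨f0, fun v => (f1 v).trans (hsc _), f2, f3, f4⟩
  simp only [hsc] at a1 a2 a4 a6
  have ii : Ind M := by
    refine ⟨fun {k} φ xs h0 hs a => ?_⟩
    have hh := alls_ind _ (mem _ (Or.inr ⟨k, φ, rfl⟩)) xs
    simp only [BoundedFormula.realize_imp, BoundedFormula.realize_inf, BoundedFormula.realize_all]
      at hh
    refine hh ⟨?_, ?_⟩ a
    · intro b hb
      simp only [BoundedFormula.realize_bdEqual, rz, vT, Term.realize, Sum.elim_inr,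
        Fin.snoc_last] at hb
      rw [hb]; exact h0
    · intro b hb c hc
      simp only [BoundedFormula.realize_bdEqual, rs, vT, Term.realize, Sum.elim_inr,
        Fin.snoc_last, Fin.snoc_castSucc, hsc] at hc
      rw [BoundedFormula.realize_liftAt_one (Nat.le_succ k), hc]
      convert hs b hb using 1
      funext j
      refine Fin.lastCases ?_ (fun j => ?_) j
      · simp
      · simp
  exact mk_PAM a1 a2 a3 a4 a5 a6 a7
end raw



/-! ### Layer 2: coding in models of PA -/

instance natStr : LA.Structure ℕ where
  funMap := fun {n} f v =>
    match n, f, v with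
    | 0, _, _ => 0
    | 1, _, v => v 0 + 1
    | 2, false, v => v 0 + v 1
    | 2, true, v => v 0 * v 1
    | (_ + 3), f, _ => nomatch (show Empty from f)
  RelMap := fun {n} r v =>
    match n, r, v with
    | 2, _, v => v 0 ≤ v 1
    | 0, r, _ => nomatch (show Empty from r)
    | 1, r, _ => nomatch (show Empty from r)
    | (_ + 3), r, _ => nomatch (show Empty from r)

instance natPAM : PAM ℕ where
  c_zero := fun _ => rfl
  c_succ := fun _ => rfl
  c_add := fun _ => rfl
  c_mul := fun _ => rfl
  c_le := fun _ => Iff.rfl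
  ind := fun φ xs h0 hs a => by
    induction a with
    | zero => exact h0
    | succ a ih => exact hs a ih
  ltS := fun h => h

section pam
variable {M : Type} [CommSemiring M] [LinearOrder M] [IsStrictOrderedRing M]
    [CanonicallyOrderedAdd M] [LA.Structure M] [PAM M] {k m : ℕ}

theorem lt_iff_S {a b : M} : a < b ↔ a + 1 ≤ b :=
  ⟨PAM.ltS, fun h => lt_of_lt_of_le (lt_add_one a) h⟩
theorem lt_S_iff {a b : M} : a < b + 1 ↔ a ≤ b := by
  rw [lt_iff_S]; exact add_le_add_iff_right 1
theorem zero_or_S (a : M) : a = 0 ∨ ∃ b, a = b + 1 := by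
  rcases eq_or_ne a 0 with h | h
  · exact Or.inl h
  · right
    have : 0 < a := pos_iff_ne_zero.2 h
    rw [lt_iff_S] at this
    obtain ⟨c, hc⟩ := exists_add_of_le this
    exact ⟨c, by rw [hc]; ring⟩
theorem le_mul_self' (a : M) : a ≤ a * a := by
  rcases zero_or_S a with rfl | ⟨b, rfl⟩
  · simp
  · have : (b + 1) * (b + 1) = (b + 1) + (b * b + b) := by ring
    rw [this]; exact le_self_add
theorem le_S_iff {a b : M} : a ≤ b + 1 ↔ a ≤ b ∨ a = b + 1 := by
  rw [le_iff_lt_or_eq, lt_S_iff]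
theorem le_zero' {a : M} : a ≤ 0 ↔ a = 0 := nonpos_iff_eq_zero

theorem le_natCast {a : M} : ∀ {n : ℕ}, a ≤ (n : M) → ∃ m ≤ n, a = (m : M) := by
  intro n
  induction n with
  | zero => intro h; exact ⟨0, le_rfl, by simpa using h⟩
  | succ n ih =>
    intro h
    rw [Nat.cast_succ, le_S_iff] at h
    rcases h with h | h
    · obtain ⟨m, h1, h2⟩ := ih h
      exact ⟨m, by omega, h2⟩
    · exact ⟨n + 1, le_rfl, by rw [h]; simp⟩

theorem Dp.lt {f g : (Fin k → M) → M} (hf : Tp f) (hg : Tp g) : Dp (fun v => f v < g v) :=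
  (Dp.not (Dp.le hg hf)).of_iff fun _ => not_le.symm
theorem Dp.dvd {f g : (Fin k → M) → M} (hf : Fp f) (hg : Fp g) : Dp (fun v => f v ∣ g v) :=
  Dp.comp2 (P := fun a b : M => a ∣ b) ((dpt : Dp (fun v : Fin 2 → M => ∃ q, v 1 = v 0 * q)).of_iff
    fun _ => Iff.rfl) hf hg

theorem dpl {p : Prop} (h : p := by
  repeat' (first
    | exact Dp.prop _
    | apply Dp.iff | apply Dp.and | apply Dp.or | apply Dp.not | apply Dp.ex
    | (refine Dp.eq ?_ ?_; exact tpt; exact tpt) | (refine Dp.le ?_ ?_; exact tpt; exact tpt)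
    | (refine Dp.lt ?_ ?_; exact tpt; exact tpt)
    | (refine Dp.dvd (Tp.fp ?_) (Tp.fp ?_); exact tpt; exact tpt)
    | apply Dp.all | apply Dp.imp)) : p := h

/-- least element principle -/
theorem least_dp {P : M → Prop} (h : Dp (fun v : Fin 1 → M => P (v 0))) {a : M} (ha : P a) :
    ∃ b, P b ∧ ∀ c, P c → b ≤ c := by
  by_contra hc
  push Not at hc
  have : ∀ b : M, ∀ c, c ≤ b → ¬ P c := by
    intro b
    refine ind_dp (P := fun b : M => ∀ c, c ≤ b → ¬ P c) ?_ ?_ ?_ b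
    · apply Dp.all; apply Dp.imp
      · exact dpl
      · exact Dp.not (h.comp1 (Tp.fp tpt))
    · intro c h0 hP
      rw [le_zero'] at h0; subst h0
      obtain ⟨c, h1, h2⟩ := hc _ hP
      exact not_lt_zero h2
    · intro b ih c hcb hP
      obtain ⟨c', h1, h2⟩ := hc _ hP
      exact ih c' (lt_S_iff.1 (lt_of_lt_of_le h2 hcb)) h1
  exact this a a le_rfl ha

/-! pairing -/

/-- pairing polynomial -/
def prm {M : Type} [CommSemiring M] (x y : M) : M := (x + y) * (x + y) + x

@[simp] theorem cast_prm (a b : ℕ) : ((prm a b : ℕ) : M) = prm (a : M) (b : M) := by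
  simp [prm]

theorem le_prm_left (x y : M) : x ≤ prm x y := le_add_self
theorem le_prm_right (x y : M) : y ≤ prm x y :=
  (le_add_self.trans (le_mul_self' (x + y))).trans le_self_add

theorem prm_aux {x y x' y' : M} (h : x + y < x' + y') : prm x y < prm x' y' := by
  rw [lt_iff_S] at h
  have h1 : (x + y + 1) * (x + y + 1) ≤ (x' + y') * (x' + y') := mul_le_mul' h h
  have h2 : prm x y + (x + y + y + 1) = (x + y + 1) * (x + y + 1) := by simp only [prm]; ring
  have h3 : prm x y < prm x y + (x + y + y + 1) :=
    lt_add_of_pos_right _ (lt_of_lt_of_le zero_lt_one le_add_self)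
  exact lt_of_lt_of_le h3 (h2.le.trans (h1.trans le_self_add))

theorem prm_inj {x y x' y' : M} : prm x y = prm x' y' ↔ x = x' ∧ y = y' := by
  constructor
  · intro h
    rcases lt_trichotomy (x + y) (x' + y') with h1 | h1 | h1
    · exact absurd h (prm_aux h1).ne
    · simp only [prm, h1] at h
      have h2 : x = x' := add_left_cancel h
      subst h2
      exact ⟨rfl, add_left_cancel h1⟩
    · exact absurd h.symm (prm_aux h1).ne
  · rintro ⟨rfl, rfl⟩; rfl

open Classical in
/-- first projection -/
noncomputable def p1 (z : M) : M := if h : ∃ x y : M, z = prm x y then h.choose else 0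
open Classical in
/-- second projection -/
noncomputable def p2 (z : M) : M := if h : ∃ x y : M, z = prm x y then h.choose_spec.choose else 0

@[simp] theorem p1_prm (x y : M) : p1 (prm x y) = x := by
  have h : ∃ a b : M, prm x y = prm a b := ⟨x, y, rfl⟩
  rw [p1, dif_pos h]
  exact (prm_inj.1 h.choose_spec.choose_spec).1.symm
@[simp] theorem p2_prm (x y : M) : p2 (prm x y) = y := by
  have h : ∃ a b : M, prm x y = prm a b := ⟨x, y, rfl⟩
  rw [p2, dif_pos h]
  exact (prm_inj.1 h.choose_spec.choose_spec).2.symm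

theorem p1_iff {y z : M} : y = p1 z ↔
    (∃ w, w ≤ z ∧ z = prm y w) ∨ (y = 0 ∧ ∀ x, x ≤ z → ∀ w, w ≤ z → ¬ z = prm x w) := by
  by_cases h : ∃ x w : M, z = prm x w
  · obtain ⟨x, w, rfl⟩ := h
    rw [p1_prm]
    constructor
    · rintro rfl; exact Or.inl ⟨w, le_prm_right _ _, rfl⟩
    · rintro (⟨w', _, h⟩ | ⟨_, h⟩)
      · exact (prm_inj.1 h).1.symm
      · exact absurd rfl (h x (le_prm_left _ _) w (le_prm_right _ _))
  · rw [p1, dif_neg h]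
    push Not at h
    constructor
    · intro h'; exact Or.inr ⟨h', fun x _ w _ => h x w⟩
    · rintro (⟨w, _, h'⟩ | ⟨h', _⟩)
      · exact absurd h' (h _ _)
      · exact h'
theorem p2_iff {y z : M} : y = p2 z ↔
    (∃ w, w ≤ z ∧ z = prm w y) ∨ (y = 0 ∧ ∀ x, x ≤ z → ∀ w, w ≤ z → ¬ z = prm x w) := by
  by_cases h : ∃ x w : M, z = prm x w
  · obtain ⟨x, w, rfl⟩ := h
    rw [p2_prm]
    constructor
    · rintro rfl; exact Or.inl ⟨x, le_prm_left _ _, rfl⟩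
    · rintro (⟨w', _, h⟩ | ⟨_, h⟩)
      · exact (prm_inj.1 h).2.symm
      · exact absurd rfl (h x (le_prm_left _ _) w (le_prm_right _ _))
  · rw [p2, dif_neg h]
    push Not at h
    constructor
    · intro h'; exact Or.inr ⟨h', fun x _ w _ => h x w⟩
    · rintro (⟨w, _, h'⟩ | ⟨h', _⟩)
      · exact absurd h' (h _ _)
      · exact h'

theorem p1_le (z : M) : p1 z ≤ z := by
  rcases p1_iff.1 (rfl : p1 z = p1 z) with ⟨w, _, h⟩ | ⟨h, _⟩
  · conv_rhs => rw [h]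
    exact le_prm_left _ _
  · rw [h]; exact zero_le
theorem p2_le (z : M) : p2 z ≤ z := by
  rcases p2_iff.1 (rfl : p2 z = p2 z) with ⟨w, _, h⟩ | ⟨h, _⟩
  · conv_rhs => rw [h]
    exact le_prm_right _ _
  · rw [h]; exact zero_le

/-! finite sets -/

/-- membership in coded finite sets -/
def Mem (x s : M) : Prop := ∃ b, b ≤ s ∧ ∃ c, c ≤ s ∧ ∃ d, d ≤ s ∧ s = prm b (prm c d) ∧ x < b ∧
  ∃ q, q ≤ s ∧ c = (1 + (x + 1) * d) * q

theorem mem_prm {x b c d : M} : Mem x (prm b (prm c d)) ↔ x < b ∧ (1 + (x + 1) * d) ∣ c := by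
  constructor
  · rintro ⟨b', _, c', _, d', _, h, h1, q, _, h2⟩
    rw [prm_inj, prm_inj] at h
    obtain ⟨rfl, rfl, rfl⟩ := h
    exact ⟨h1, q, h2⟩
  · rintro ⟨h, q, h2⟩
    have hc : c ≤ prm b (prm c d) := (le_prm_left c d).trans (le_prm_right _ _)
    refine ⟨b, le_prm_left _ _, c, hc, d, (le_prm_right c d).trans (le_prm_right _ _), rfl, h, q,
      ?_, h2⟩
    refine le_trans ?_ hc
    rw [h2, add_mul, one_mul]; exact le_self_add

theorem Mem.lt {x s : M} (h : Mem x s) : x < s := by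
  obtain ⟨b, hb, c, _, d, _, _, h, _⟩ := h
  exact lt_of_lt_of_le h hb

theorem dvd_cancel {a x y : M} (h1 : a ∣ x) (h2 : a ∣ x + y) : a ∣ y := by
  obtain ⟨u, rfl⟩ := h1
  obtain ⟨q, hq⟩ := h2
  rcases eq_or_ne a 0 with rfl | ha
  · simp at hq; simp [hq]
  have ha : 0 < a := pos_iff_ne_zero.2 ha
  have : u ≤ q := by
    by_contra hc
    have := mul_lt_mul_of_pos_left (not_le.1 hc) ha
    rw [← hq] at this
    exact absurd this (not_lt.2 le_self_add)
  obtain ⟨r, rfl⟩ := exists_add_of_le this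
  rw [mul_add] at hq
  exact ⟨r, add_left_cancel hq⟩

theorem exists_mult (b : M) : ∃ d : M, 0 < d ∧ ∀ i, 0 < i → i ≤ b → i ∣ d := by
  refine ind_dp (P := fun b : M => ∃ d : M, 0 < d ∧ ∀ i, 0 < i → i ≤ b → i ∣ d) dpl ?_ ?_ b
  · exact ⟨1, zero_lt_one, fun i h1 h2 => absurd h1 (not_lt.2 h2)⟩
  · rintro b ⟨d, hd, h⟩
    refine ⟨d * (b + 1), mul_pos hd (lt_of_lt_of_le zero_lt_one le_add_self), fun i h1 h2 => ?_⟩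
    rcases le_S_iff.1 h2 with h2 | rfl
    · exact (h i h1 h2).mul_right _
    · exact dvd_mul_left _ _

theorem cop_aux {b d : M} (hd : ∀ i, 0 < i → i ≤ b → i ∣ d) {i j : M} (hi : i < b) (hj : j < b)
    (hij : i ≠ j) {z : M} (h : (1 + (i + 1) * d) ∣ (1 + (j + 1) * d) * z) :
    (1 + (i + 1) * d) ∣ z := by
  have c1 : ∀ w : M, (1 + (i + 1) * d) ∣ d * w → (1 + (i + 1) * d) ∣ w := by
    intro w hw
    refine dvd_cancel (hw.mul_left (i + 1)) ⟨w, by ring⟩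
  have c2 : ∀ e : M, 0 < e → e ≤ b → (1 + (i + 1) * d) ∣ e * (d * z) → (1 + (i + 1) * d) ∣ z := by
    intro e he heb h
    obtain ⟨f, hf⟩ := hd e he heb
    apply c1; apply c1
    have h3 : d * (d * z) = f * (e * (d * z)) := by
      calc d * (d * z) = (e * f) * (d * z) := by rw [← hf]
        _ = _ := by ring
    rw [h3]
    exact h.mul_left f
  rcases lt_or_gt_of_ne hij with hlt | hlt
  · obtain ⟨e, rfl⟩ := exists_add_of_le (lt_iff_S.1 hlt)
    refine c2 (1 + e) (lt_of_lt_of_le zero_lt_one le_self_add)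
      (le_trans (le_trans (le_add_self (b := i)) (le_of_eq (by ring))) hj.le) ?_
    refine dvd_cancel (Dvd.intro z rfl) ?_
    convert h using 1
    ring
  · obtain ⟨e, rfl⟩ := exists_add_of_le (lt_iff_S.1 hlt)
    refine c2 (1 + e) (lt_of_lt_of_le zero_lt_one le_self_add)
      (le_trans (le_trans (le_add_self (b := j)) (le_of_eq (by ring))) hi.le) ?_
    refine dvd_cancel h ⟨z, by ring⟩

/-- comprehension -/
theorem compr {P : M → Prop} (hP : Dp (fun v : Fin 1 → M => P (v 0))) (b : M) :
    ∃ s, b ≤ s ∧ ∀ x, Mem x s ↔ x < b ∧ P x := by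
  obtain ⟨d, hd0, hd⟩ := exists_mult b
  have key : ∀ t : M, t ≤ b → ∃ c : M, ∀ x, x < b → ((1 + (x + 1) * d) ∣ c ↔ x < t ∧ P x) := by
    intro t
    refine ind_dp
      (P := fun t : M => t ≤ b → ∃ c : M, ∀ x, x < b → ((1 + (x + 1) * d) ∣ c ↔ x < t ∧ P x))
      ?_ ?_ ?_ t
    · refine Dp.imp dpl (Dp.ex (Dp.all (Dp.imp dpl (Dp.iff dpl (Dp.and dpl ?_)))))
      exact hP.comp1 (Tp.fp tpt)
    · intro _
      refine ⟨1, fun x _ => ⟨fun h => ?_, fun h => absurd h.1 not_lt_zero⟩⟩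
      exfalso
      obtain ⟨q, hq⟩ := h
      rcases zero_or_S q with rfl | ⟨r, rfl⟩
      · simp at hq
      · have h1 : (1 + (x + 1) * d) * (r + 1) = 1 + (d + (x * d + (1 + (x + 1) * d) * r)) := by ring
        have h2 : (1:M) < 1 + (d + (x * d + (1 + (x + 1) * d) * r)) :=
          lt_add_of_pos_right _ (lt_of_lt_of_le hd0 le_self_add)
        rw [← h1, ← hq] at h2
        exact lt_irrefl _ h2
    · intro t ih ht
      have htb : t < b := lt_iff_S.2 ht
      obtain ⟨c, hc⟩ := ih htb.le
      by_cases hPt : P t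
      · refine ⟨(1 + (t + 1) * d) * c, fun x hx => ?_⟩
        by_cases hxt : x = t
        · subst hxt
          exact ⟨fun _ => ⟨lt_add_one x, hPt⟩, fun _ => dvd_mul_right _ _⟩
        · constructor
          · intro h
            have := (hc x hx).1 (cop_aux hd hx htb hxt h)
            exact ⟨this.1.trans (lt_add_one t), this.2⟩
          · intro h
            exact ((hc x hx).2 ⟨lt_of_le_of_ne (lt_S_iff.1 h.1) hxt, h.2⟩).mul_left _
      · refine ⟨c, fun x hx => (hc x hx).trans ?_⟩
        constructor
        · intro h; exact ⟨h.1.trans (lt_add_one t), h.2⟩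
        · intro h
          refine ⟨lt_of_le_of_ne (lt_S_iff.1 h.1) ?_, h.2⟩
          rintro rfl; exact hPt h.2
  obtain ⟨c, hc⟩ := key b le_rfl
  refine ⟨prm b (prm c d), le_prm_left _ _, fun x => ?_⟩
  rw [mem_prm]
  constructor
  · rintro ⟨h1, h2⟩; exact (hc x h1).1 h2
  · intro h; exact ⟨h.1, (hc x h.1).2 h⟩

end pam


/-! ### Layer 3: uniform definability over families of models -/

section fam
variable {ι : Type*} {𝓜 : ι → Type}

/-- variable projections, uniformly -/
def FVr {m k : ℕ} (g : ∀ i, (Fin m → 𝓜 i) → (Fin k → 𝓜 i)) : Prop :=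
  ∃ ρ : Fin k → Fin m, ∀ i v, g i v = fun j => v (ρ j)

theorem FVr.id {m : ℕ} : FVr (𝓜 := 𝓜) (fun _ (v : Fin m → _) => v) := ⟨fun j => j, fun _ _ => rfl⟩
theorem FVr.ini {m k : ℕ} {g : ∀ i, (Fin m → 𝓜 i) → (Fin (k+1) → 𝓜 i)} (h : FVr g) :
    FVr (fun i v => ini (g i v)) := by
  obtain ⟨ρ, h⟩ := h
  exact ⟨fun j => ρ j.castSucc, fun i v => by funext j; simp [Guaspari.ini, h]⟩
theorem FVr.snoc {m k l : ℕ} {g : ∀ i, (Fin m → 𝓜 i) → (Fin k → 𝓜 i)} (h : FVr g)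
    {g' : ∀ i, (Fin m → 𝓜 i) → (Fin l → 𝓜 i)} (h' : FVr g') (j : Fin l) :
    FVr (k := k+1) (fun i v => (Fin.snoc (g i v) (g' i v j) : Fin (k+1) → 𝓜 i)) := by
  obtain ⟨ρ, h⟩ := h
  obtain ⟨ρ', h'⟩ := h'
  refine ⟨Fin.snoc (α := fun _ => Fin m) ρ (ρ' j), fun i v => ?_⟩
  funext j'
  refine Fin.lastCases ?_ (fun j => ?_) j' <;> simp [h, h']

variable [∀ i, CommSemiring (𝓜 i)] [∀ i, LinearOrder (𝓜 i)] [∀ i, IsStrictOrderedRing (𝓜 i)]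
    [∀ i, CanonicallyOrderedAdd (𝓜 i)] [∀ i, LA.Structure (𝓜 i)] [∀ i, PAM (𝓜 i)] {k m n : ℕ}

/-- term functions, uniformly -/
def FTm (f : ∀ i, (Fin k → 𝓜 i) → 𝓜 i) : Prop :=
  ∃ t : LA.Term (Empty ⊕ Fin k), ∀ i v, t.realize (Sum.elim default v) = f i v

/-- uniformly Δ₀ predicates -/
def Del0 (P : ∀ i, (Fin k → 𝓜 i) → Prop) : Prop :=
  ∃ φ : LA.BoundedFormula Empty k, IsDelta0 φ ∧ ∀ i v, φ.Realize default v ↔ P i v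

theorem FTm.var {g : ∀ i, (Fin m → 𝓜 i) → (Fin k → 𝓜 i)} (h : FVr g) (j : Fin k) :
    FTm (fun i v => g i v j) := by
  obtain ⟨ρ, h⟩ := h
  exact ⟨Term.var (Sum.inr (ρ j)), fun i v => by simp [h]⟩
theorem FTm.add {f g : ∀ i, (Fin k → 𝓜 i) → 𝓜 i} (hf : FTm f) (hg : FTm g) :
    FTm (fun i v => f i v + g i v) := by
  obtain ⟨t, ht⟩ := hf
  obtain ⟨u, hu⟩ := hg
  exact ⟨addT t u, fun i v => by simp [ht, hu]⟩
theorem FTm.mul {f g : ∀ i, (Fin k → 𝓜 i) → 𝓜 i} (hf : FTm f) (hg : FTm g) :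
    FTm (fun i v => f i v * g i v) := by
  obtain ⟨t, ht⟩ := hf
  obtain ⟨u, hu⟩ := hg
  exact ⟨mulT t u, fun i v => by simp [ht, hu]⟩
theorem FTm.zero : FTm (fun i (_ : Fin k → 𝓜 i) => (0 : 𝓜 i)) := ⟨zeroT, fun i v => by simp⟩
theorem FTm.one : FTm (fun i (_ : Fin k → 𝓜 i) => (1 : 𝓜 i)) := ⟨succT zeroT, fun i v => by simp⟩
theorem FTm.cast (n : ℕ) : FTm (fun i (_ : Fin k → 𝓜 i) => (n : 𝓜 i)) := by
  induction n with
  | zero => simpa using FTm.zero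
  | succ n ih => simpa using ih.add FTm.one
theorem FTm.ren {P : ∀ i, (Fin m → 𝓜 i) → 𝓜 i} (ρ : Fin m → Fin k) (h : FTm P) :
    FTm (fun i (v : Fin k → 𝓜 i) => P i (fun j => v (ρ j))) := by
  obtain ⟨t, ht⟩ := h
  exact ⟨t.relabel (Sum.map id ρ), fun i v => by rw [real_rlb, ht]⟩
theorem FTm.vr {P : ∀ i, (Fin m → 𝓜 i) → 𝓜 i} {g : ∀ i, (Fin k → 𝓜 i) → (Fin m → 𝓜 i)}
    (hg : FVr g) (h : FTm P) : FTm (fun i v => P i (g i v)) := by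
  obtain ⟨ρ, hρ⟩ := hg
  simpa only [hρ] using h.ren ρ

theorem Del0.of_iff {P Q : ∀ i, (Fin k → 𝓜 i) → Prop} (h : Del0 P) (e : ∀ i v, Q i v ↔ P i v) :
    Del0 Q := by
  obtain ⟨φ, h0, h⟩ := h
  exact ⟨φ, h0, fun i v => (h i v).trans (e i v).symm⟩
theorem Del0.eqT {f g : ∀ i, (Fin k → 𝓜 i) → 𝓜 i} (hf : FTm f) (hg : FTm g) :
    Del0 (fun i v => f i v = g i v) := by
  obtain ⟨t, ht⟩ := hf
  obtain ⟨u, hu⟩ := hg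
  exact ⟨t.bdEqual u, .equal _ _, fun i v => by simp [ht, hu]⟩
theorem Del0.leT {f g : ∀ i, (Fin k → 𝓜 i) → 𝓜 i} (hf : FTm f) (hg : FTm g) :
    Del0 (fun i v => f i v ≤ g i v) := by
  obtain ⟨t, ht⟩ := hf
  obtain ⟨u, hu⟩ := hg
  exact ⟨leF t u, .le _ _, fun i v => by simp [ht, hu]⟩
theorem Del0.imp {P Q : ∀ i, (Fin k → 𝓜 i) → Prop} (hf : Del0 P) (hg : Del0 Q) :
    Del0 (fun i v => P i v → Q i v) := by
  obtain ⟨t, h1, ht⟩ := hf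
  obtain ⟨u, h2, hu⟩ := hg
  exact ⟨t.imp u, .imp h1 h2, fun i v => by simp [ht, hu]⟩
theorem Del0.fls : Del0 (fun i (_ : Fin k → 𝓜 i) => False) := ⟨⊥, .falsum, fun i v => by simp⟩
theorem Del0.not {P : ∀ i, (Fin k → 𝓜 i) → Prop} (hf : Del0 P) : Del0 (fun i v => ¬ P i v) :=
  hf.imp Del0.fls
theorem Del0.tru : Del0 (fun i (_ : Fin k → 𝓜 i) => True) := Del0.fls.not.of_iff fun _ _ => by simp
theorem Del0.and {P Q : ∀ i, (Fin k → 𝓜 i) → Prop} (hf : Del0 P) (hg : Del0 Q) :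
    Del0 (fun i v => P i v ∧ Q i v) :=
  (hf.imp hg.not).not.of_iff fun i v => by tauto
theorem Del0.or {P Q : ∀ i, (Fin k → 𝓜 i) → Prop} (hf : Del0 P) (hg : Del0 Q) :
    Del0 (fun i v => P i v ∨ Q i v) :=
  (hf.not.imp hg).of_iff fun i v => by tauto
theorem Del0.iff {P Q : ∀ i, (Fin k → 𝓜 i) → Prop} (hf : Del0 P) (hg : Del0 Q) :
    Del0 (fun i v => P i v ↔ Q i v) :=
  ((hf.imp hg).and (hg.imp hf)).of_iff fun i v => by tauto
theorem Del0.ballT {f : ∀ i, (Fin k → 𝓜 i) → 𝓜 i} (hf : FTm f)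
    {P : ∀ i, (Fin k → 𝓜 i) → 𝓜 i → Prop}
    (h : Del0 (fun i (v : Fin (k+1) → 𝓜 i) => P i (ini v) (v (Fin.last k)))) :
    Del0 (fun i v => ∀ y, y ≤ f i v → P i v y) := by
  obtain ⟨t, ht⟩ := hf
  obtain ⟨φ, h0, h⟩ := h
  refine ⟨_, .ball t h0, fun i v => ?_⟩
  simp [real_rlb, h, ht, -Term.realize_relabel]
theorem Del0.bexT {f : ∀ i, (Fin k → 𝓜 i) → 𝓜 i} (hf : FTm f)
    {P : ∀ i, (Fin k → 𝓜 i) → 𝓜 i → Prop}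
    (h : Del0 (fun i (v : Fin (k+1) → 𝓜 i) => P i (ini v) (v (Fin.last k)))) :
    Del0 (fun i v => ∃ y, y ≤ f i v ∧ P i v y) := by
  obtain ⟨t, ht⟩ := hf
  obtain ⟨φ, h0, h⟩ := h
  refine ⟨_, .bex t h0, fun i v => ?_⟩
  simp [real_rlb, h, ht, -Term.realize_relabel]

theorem relab_comp {α : Type} {a b c : ℕ} (t : LA.Term (α ⊕ Fin a)) (f : Fin a → Fin b)
    (g : Fin b → Fin c) : (t.relabel (Sum.map id f)).relabel (Sum.map id g) =
      t.relabel (Sum.map id (fun j => g (f j))) := by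
  rw [Term.relabel_relabel]; congr 1; funext x; cases x <;> rfl

theorem ren_leF {a b : ℕ} (t u : LA.Term (Empty ⊕ Fin a)) (ρ : Fin a → Fin b) :
    ren (leF t u) ρ = leF (t.relabel (Sum.map id ρ)) (u.relabel (Sum.map id ρ)) := by
  simp only [leF, Relations.boundedFormula₂, Relations.boundedFormula, ren]
  congr 1; funext j; fin_cases j <;> rfl

theorem IsDelta0.ren {φ : LA.BoundedFormula Empty m} (h : IsDelta0 φ) :
    ∀ {k : ℕ} (ρ : Fin m → Fin k), IsDelta0 (ren φ ρ) := by
  induction h with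
  | falsum => intros; exact .falsum
  | equal t u => intros; exact .equal _ _
  | le t u => intros; rw [ren_leF]; exact .le _ _
  | imp _ _ h1 h2 => intro k ρ; exact .imp (h1 ρ) (h2 ρ)
  | @ball a t φ _ h1 =>
    intro k ρ
    have := IsDelta0.ball (t.relabel (Sum.map id ρ)) (h1 (lft ρ))
    convert this using 1
    simp only [Guaspari.ren, ren_leF, relab_comp]
    congr 3
    · simp [vT, lft]
    · congr 2; funext j; simp [lft]
  | @bex a t φ _ h1 =>
    intro k ρ
    have := IsDelta0.bex (t.relabel (Sum.map id ρ)) (h1 (lft ρ))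
    convert this using 1
    change Guaspari.ren (((leF _ _ ⟹ (φ ⟹ ⊥)) ⟹ ⊥) ⟹ ⊥).all.not _ = (((leF _ _ ⟹ (_ ⟹ ⊥)) ⟹ ⊥) ⟹ ⊥).all.not
    simp only [BoundedFormula.not]
    change ((Guaspari.ren (((leF _ _ ⟹ (φ ⟹ ⊥)) ⟹ ⊥) ⟹ ⊥) (lft ρ)).all ⟹ ⊥) = _
    congr 2
    change (((Guaspari.ren (leF _ _) (lft ρ) ⟹ (Guaspari.ren φ (lft ρ) ⟹ ⊥)) ⟹ ⊥) ⟹ ⊥) = _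
    congr 3
    simp only [ren_leF, relab_comp]
    congr 1
    · simp [vT, lft]
    · congr 2; funext j; simp [lft]

theorem Del0.ren {P : ∀ i, (Fin m → 𝓜 i) → Prop} (ρ : Fin m → Fin k) (h : Del0 P) :
    Del0 (fun i (v : Fin k → 𝓜 i) => P i (fun j => v (ρ j))) := by
  obtain ⟨t, h0, ht⟩ := h
  exact ⟨Guaspari.ren t ρ, h0.ren ρ, fun i v => by rw [real_ren, ht]⟩


theorem Del0.vr {P : ∀ i, (Fin m → 𝓜 i) → Prop} {g : ∀ i, (Fin k → 𝓜 i) → (Fin m → 𝓜 i)}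
    (hg : FVr g) (h : Del0 P) : Del0 (fun i v => P i (g i v)) := by
  obtain ⟨ρ, hρ⟩ := hg
  simpa only [hρ] using h.ren ρ

/-- Δ₀ functions bounded by a term -/
def Fd (f : ∀ i, (Fin k → 𝓜 i) → 𝓜 i) : Prop :=
  ∃ t : ∀ i, (Fin k → 𝓜 i) → 𝓜 i, FTm t ∧ (∀ i v, f i v ≤ t i v) ∧
    Del0 (fun i (v : Fin (k+1) → 𝓜 i) => v (Fin.last k) = f i (ini v))

theorem FTm.fd {f : ∀ i, (Fin k → 𝓜 i) → 𝓜 i} (h : FTm f) : Fd f :=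
  ⟨f, h, fun _ _ => le_rfl, Del0.eqT (FTm.var FVr.id _) (FTm.vr (FVr.ini FVr.id) h)⟩

theorem Fd.ren {P : ∀ i, (Fin m → 𝓜 i) → 𝓜 i} (ρ : Fin m → Fin k) (h : Fd P) :
    Fd (fun i (v : Fin k → 𝓜 i) => P i (fun j => v (ρ j))) := by
  obtain ⟨t, h1, h2, h3⟩ := h
  refine ⟨_, h1.ren ρ, fun i v => h2 _ _, ?_⟩
  have := Del0.ren (k := k+1) (lft ρ) h3
  refine this.of_iff fun i v => ?_
  conv_rhs => rw [← snoc_ini v, snoc_lft]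
  simp

theorem Fd.vr {P : ∀ i, (Fin m → 𝓜 i) → 𝓜 i} {g : ∀ i, (Fin k → 𝓜 i) → (Fin m → 𝓜 i)}
    (hg : FVr g) (h : Fd P) : Fd (fun i v => P i (g i v)) := by
  obtain ⟨ρ, hρ⟩ := hg
  simpa only [hρ] using h.ren ρ

theorem Del0.comp {P : ∀ i, (Fin m → 𝓜 i) → Prop} (hP : Del0 P)
    (f : Fin m → ∀ i, (Fin k → 𝓜 i) → 𝓜 i) (hf : ∀ j, Fd (f j)) :
    Del0 (fun i v => P i (fun j => f j i v)) := by
  refine comp_gen (𝓜 := 𝓜) (fun P => Del0 P) (fun P => Fd P)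
    (fun P ρ h => h.ren ρ) (fun {m k} P ρ h => h.ren ρ) (fun {k} P f hP hf => ?_) P hP f hf
  obtain ⟨t, h1, h2, h3⟩ := hf
  refine (Del0.bexT h1 (P := fun i v y => y = f i v ∧ P i (Fin.snoc v y)) (h3.and ?_)).of_iff ?_
  · simpa only [snoc_ini] using hP
  · intro i v
    constructor
    · intro h; exact ⟨_, h2 _ _, rfl, h⟩
    · rintro ⟨_, _, rfl, h⟩; exact h

theorem Del0.comp1 {P : ∀ i, 𝓜 i → Prop} (hP : Del0 (fun i (v : Fin 1 → 𝓜 i) => P i (v 0)))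
    {f : ∀ i, (Fin k → 𝓜 i) → 𝓜 i} (hf : Fd f) : Del0 (fun i v => P i (f i v)) :=
  hP.comp ![f] (by intro j; fin_cases j; exact hf)
theorem Del0.comp2 {P : ∀ i, 𝓜 i → 𝓜 i → Prop}
    (hP : Del0 (fun i (v : Fin 2 → 𝓜 i) => P i (v 0) (v 1)))
    {f g : ∀ i, (Fin k → 𝓜 i) → 𝓜 i} (hf : Fd f) (hg : Fd g) :
    Del0 (fun i v => P i (f i v) (g i v)) :=
  hP.comp ![f, g] (by intro j; fin_cases j; exacts [hf, hg])
theorem Del0.comp3 {P : ∀ i, 𝓜 i → 𝓜 i → 𝓜 i → Prop}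
    (hP : Del0 (fun i (v : Fin 3 → 𝓜 i) => P i (v 0) (v 1) (v 2)))
    {f g h : ∀ i, (Fin k → 𝓜 i) → 𝓜 i} (hf : Fd f) (hg : Fd g) (hh : Fd h) :
    Del0 (fun i v => P i (f i v) (g i v) (h i v)) :=
  hP.comp ![f, g, h] (by intro j; fin_cases j; exacts [hf, hg, hh])

theorem Del0.eq {f g : ∀ i, (Fin k → 𝓜 i) → 𝓜 i} (hf : Fd f) (hg : Fd g) :
    Del0 (fun i v => f i v = g i v) :=
  Del0.comp2 (P := fun i x y => x = y) (Del0.eqT (FTm.var FVr.id _) (FTm.var FVr.id _)) hf hg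
theorem Del0.le {f g : ∀ i, (Fin k → 𝓜 i) → 𝓜 i} (hf : Fd f) (hg : Fd g) :
    Del0 (fun i v => f i v ≤ g i v) :=
  Del0.comp2 (P := fun i x y => x ≤ y) (Del0.leT (FTm.var FVr.id _) (FTm.var FVr.id _)) hf hg
theorem Del0.lt {f g : ∀ i, (Fin k → 𝓜 i) → 𝓜 i} (hf : Fd f) (hg : Fd g) :
    Del0 (fun i v => f i v < g i v) :=
  (Del0.le hg hf).not.of_iff fun i v => by simp
theorem Del0.ball {f : ∀ i, (Fin k → 𝓜 i) → 𝓜 i} (hf : Fd f)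
    {P : ∀ i, (Fin k → 𝓜 i) → 𝓜 i → Prop}
    (h : Del0 (fun i (v : Fin (k+1) → 𝓜 i) => P i (ini v) (v (Fin.last k)))) :
    Del0 (fun i v => ∀ y, y ≤ f i v → P i v y) := by
  have := hf
  obtain ⟨t, h1, h2, h3⟩ := this
  refine (Del0.ballT h1 (P := fun i v y => y ≤ f i v → P i v y)
    (Del0.imp (Del0.le (FTm.var FVr.id _).fd (hf.vr (FVr.ini FVr.id))) h)).of_iff fun i v => ?_
  exact ⟨fun h y _ hy => h y hy, fun h y hy => h y (hy.trans (h2 _ _)) hy⟩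
theorem Del0.bex {f : ∀ i, (Fin k → 𝓜 i) → 𝓜 i} (hf : Fd f)
    {P : ∀ i, (Fin k → 𝓜 i) → 𝓜 i → Prop}
    (h : Del0 (fun i (v : Fin (k+1) → 𝓜 i) => P i (ini v) (v (Fin.last k)))) :
    Del0 (fun i v => ∃ y, y ≤ f i v ∧ P i v y) :=
  (Del0.ball hf (P := fun i v y => ¬ P i v y) h.not).not.of_iff fun i v => by simp

theorem Fd.var {g : ∀ i, (Fin m → 𝓜 i) → (Fin k → 𝓜 i)} (h : FVr g) (j : Fin k) :
    Fd (fun i v => g i v j) := (FTm.var h j).fd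
theorem Fd.add {f g : ∀ i, (Fin k → 𝓜 i) → 𝓜 i} (hf : Fd f) (hg : Fd g) :
    Fd (fun i v => f i v + g i v) := by
  refine ⟨_, hf.choose_spec.1.add hg.choose_spec.1,
    fun i v => add_le_add (hf.choose_spec.2.1 i v) (hg.choose_spec.2.1 i v), ?_⟩
  exact Del0.comp3 (P := fun i x y z => x = y + z) (Del0.eqT (FTm.var FVr.id _)
    ((FTm.var FVr.id _).add (FTm.var FVr.id _))) (Fd.var FVr.id _) (hf.vr (FVr.ini FVr.id))
      (hg.vr (FVr.ini FVr.id))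
theorem Fd.mul {f g : ∀ i, (Fin k → 𝓜 i) → 𝓜 i} (hf : Fd f) (hg : Fd g) :
    Fd (fun i v => f i v * g i v) := by
  refine ⟨_, hf.choose_spec.1.mul hg.choose_spec.1,
    fun i v => mul_le_mul' (hf.choose_spec.2.1 i v) (hg.choose_spec.2.1 i v), ?_⟩
  exact Del0.comp3 (P := fun i x y z => x = y * z) (Del0.eqT (FTm.var FVr.id _)
    ((FTm.var FVr.id _).mul (FTm.var FVr.id _))) (Fd.var FVr.id _) (hf.vr (FVr.ini FVr.id))
      (hg.vr (FVr.ini FVr.id))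
theorem Fd.prm {f g : ∀ i, (Fin k → 𝓜 i) → 𝓜 i} (hf : Fd f) (hg : Fd g) :
    Fd (fun i v => prm (f i v) (g i v)) := ((hf.add hg).mul (hf.add hg)).add hf
theorem Fd.zero : Fd (fun i (_ : Fin k → 𝓜 i) => (0 : 𝓜 i)) := FTm.zero.fd
theorem Fd.one : Fd (fun i (_ : Fin k → 𝓜 i) => (1 : 𝓜 i)) := FTm.one.fd
theorem Fd.cast (n : ℕ) : Fd (fun i (_ : Fin k → 𝓜 i) => (n : 𝓜 i)) := (FTm.cast n).fd

/-- values of Δ₀ graphs -/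
theorem Fd.comp1 {F : ∀ i, 𝓜 i → 𝓜 i} (hF : Fd (fun i (v : Fin 1 → 𝓜 i) => F i (v 0)))
    (hb : ∀ i x, F i x ≤ x)
    {f : ∀ i, (Fin k → 𝓜 i) → 𝓜 i} (hf : Fd f) : Fd (fun i v => F i (f i v)) := by
  refine ⟨_, hf.choose_spec.1, fun i v => (hb _ _).trans (hf.choose_spec.2.1 i v), ?_⟩
  exact Del0.comp2 (P := fun i x y => x = F i y) (Del0.eq (Fd.var FVr.id _)
    (hF.vr (g := fun i (v : Fin 2 → 𝓜 i) => fun _ => v 1) ⟨fun _ => 1, fun _ _ => rfl⟩))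
    (Fd.var FVr.id _) (hf.vr (FVr.ini FVr.id))

end fam

theorem fvt {p : Prop} (h : p := by repeat' (first | exact FVr.id | apply FVr.ini | apply FVr.snoc)) : p := h
theorem fdt0 {p : Prop} (h : p := by
  repeat' (first
    | apply Fd.prm | apply Fd.add | apply Fd.mul | (refine Fd.var ?_ _; exact fvt) | exact Fd.zero
    | exact Fd.one | exact Fd.cast _)) : p := h
theorem d0t0 {p : Prop} (h : p := by
  repeat' (first
    | exact Del0.tru | exact Del0.fls
    | apply Del0.iff | apply Del0.and | apply Del0.or | apply Del0.not
    | (refine Del0.eq ?_ ?_; exact fdt0; exact fdt0) | (refine Del0.le ?_ ?_; exact fdt0; exact fdt0)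
    | (refine Del0.lt ?_ ?_; exact fdt0; exact fdt0)
    | (refine Del0.ball ?_ ?_; exact fdt0) | (refine Del0.bex ?_ ?_; exact fdt0)
    | apply Del0.imp)) : p := h

section fam
variable {ι : Type*} {𝓜 : ι → Type}
variable [∀ i, CommSemiring (𝓜 i)] [∀ i, LinearOrder (𝓜 i)] [∀ i, IsStrictOrderedRing (𝓜 i)]
    [∀ i, CanonicallyOrderedAdd (𝓜 i)] [∀ i, LA.Structure (𝓜 i)] [∀ i, PAM (𝓜 i)] {k m n : ℕ}

theorem Fd.p1 {f : ∀ i, (Fin k → 𝓜 i) → 𝓜 i} (hf : Fd f) : Fd (fun i v => p1 (f i v)) := by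
  refine Fd.comp1 (F := fun i x => Guaspari.p1 x) ⟨fun i v => v 0, FTm.var FVr.id _, fun _ _ => p1_le _, ?_⟩
    (fun _ _ => p1_le _) hf
  refine Del0.of_iff ?_ fun i v => p1_iff
  exact d0t0
theorem Fd.p2 {f : ∀ i, (Fin k → 𝓜 i) → 𝓜 i} (hf : Fd f) : Fd (fun i v => p2 (f i v)) := by
  refine Fd.comp1 (F := fun i x => Guaspari.p2 x) ⟨fun i v => v 0, FTm.var FVr.id _, fun _ _ => p2_le _, ?_⟩
    (fun _ _ => p2_le _) hf
  refine Del0.of_iff ?_ fun i v => p2_iff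
  exact d0t0
theorem Del0.mem {f g : ∀ i, (Fin k → 𝓜 i) → 𝓜 i} (hf : Fd f) (hg : Fd g) :
    Del0 (fun i v => Mem (f i v) (g i v)) := by
  refine Del0.comp2 (P := fun i x y => Mem x y) ?_ hf hg
  unfold Mem
  exact d0t0
end fam

theorem fdt {p : Prop} (h : p := by
  repeat' (first
    | apply Fd.prm | apply Fd.p1 | apply Fd.p2 | apply Fd.add | apply Fd.mul | (refine Fd.var ?_ _; exact fvt) | exact Fd.zero
    | exact Fd.one | exact Fd.cast _)) : p := h
theorem d0t {p : Prop} (h : p := by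
  repeat' (first
    | exact Del0.tru | exact Del0.fls
    | apply Del0.iff | apply Del0.and | apply Del0.or | apply Del0.not
    | (refine Del0.eq ?_ ?_; exact fdt; exact fdt) | (refine Del0.le ?_ ?_; exact fdt; exact fdt)
    | (refine Del0.lt ?_ ?_; exact fdt; exact fdt) | (refine Del0.mem ?_ ?_; exact fdt; exact fdt)
    | (refine Del0.ball ?_ ?_; exact fdt) | (refine Del0.bex ?_ ?_; exact fdt)
    | apply Del0.imp)) : p := h


/-! ### the arithmetical hierarchy, uniformly over families -/

section pam
variable {M : Type} [CommSemiring M] [LinearOrder M] [IsStrictOrderedRing M]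
    [CanonicallyOrderedAdd M] [LA.Structure M] [PAM M] {k m : ℕ}

theorem coll {R : M → M → Prop} (hR : Dp (fun v : Fin 2 → M => R (v 0) (v 1))) (b : M)
    (h : ∀ y, y ≤ b → ∃ z, R y z) : ∃ w, ∀ y, y ≤ b → ∃ z, z ≤ w ∧ R y z := by
  have : ∀ c : M, c ≤ b → ∃ w, ∀ y, y ≤ c → ∃ z, z ≤ w ∧ R y z := by
    intro c
    refine ind_dp (P := fun c : M => c ≤ b → ∃ w, ∀ y, y ≤ c → ∃ z, z ≤ w ∧ R y z) ?_ ?_ ?_ c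
    · apply Dp.imp dpl
      apply Dp.ex; apply Dp.all; apply Dp.imp dpl; apply Dp.ex; apply Dp.and dpl
      exact hR.comp2 (Tp.fp tpt) (Tp.fp tpt)
    · intro h0
      obtain ⟨z, hz⟩ := h 0 h0
      refine ⟨z, fun y hy => ⟨z, le_rfl, ?_⟩⟩
      rw [le_zero'] at hy; rwa [hy]
    · intro c ih hc
      obtain ⟨w, hw⟩ := ih (le_trans le_self_add hc)
      obtain ⟨z, hz⟩ := h _ hc
      refine ⟨w + z, fun y hy => ?_⟩
      rcases le_S_iff.1 hy with hy | rfl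
      · obtain ⟨z', h1, h2⟩ := hw y hy
        exact ⟨z', h1.trans le_self_add, h2⟩
      · exact ⟨z, le_add_self, hz⟩
  exact this b le_rfl
end pam

section fam
variable {ι : Type*} {𝓜 : ι → Type}
variable [∀ i, CommSemiring (𝓜 i)] [∀ i, LinearOrder (𝓜 i)] [∀ i, IsStrictOrderedRing (𝓜 i)]
    [∀ i, CanonicallyOrderedAdd (𝓜 i)] [∀ i, LA.Structure (𝓜 i)] [∀ i, PAM (𝓜 i)] {k m n : ℕ}

theorem Del0.dp {P : ∀ i, (Fin k → 𝓜 i) → Prop} (h : Del0 P) (i : ι) : Dp (P i) := by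
  obtain ⟨φ, _, h⟩ := h
  refine ⟨φ.subst (fun x : Empty => x.elim), fun v => ?_⟩
  rw [BoundedFormula.realize_subst, ← h i]
  apply iff_of_eq
  congr 1
  funext x; exact x.elim

/-- uniformly Σ_n predicates -/
def SigF : ℕ → ∀ {k : ℕ}, (∀ i, (Fin k → 𝓜 i) → Prop) → Prop
  | 0, _, P => Del0 P
  | n+1, k, P => ∃ G : ∀ i, (Fin (k+1) → 𝓜 i) → Prop, SigF n G ∧
      ∀ i v, P i v ↔ ∃ y, ¬ G i (Fin.snoc v y)

theorem SigF.of_iff {P Q : ∀ i, (Fin k → 𝓜 i) → Prop} (h : SigF n P) (e : ∀ i v, Q i v ↔ P i v) :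
    SigF n Q := by
  cases n with
  | zero => exact Del0.of_iff h e
  | succ n =>
    obtain ⟨G, h1, h2⟩ := h
    exact ⟨G, h1, fun i v => (e i v).trans (h2 i v)⟩

theorem SigF.dp {P : ∀ i, (Fin k → 𝓜 i) → Prop} (h : SigF n P) (i : ι) : Dp (P i) := by
  induction n generalizing k with
  | zero => exact Del0.dp h i
  | succ n ih =>
    obtain ⟨G, h1, h2⟩ := h
    refine (Dp.ex (P := fun v y => ¬ G i (Fin.snoc v y)) ?_).of_iff fun v => h2 i v
    simp only [snoc_ini]
    exact (ih h1).not

theorem SigF.mkEx {P : ∀ i, (Fin k → 𝓜 i) → 𝓜 i → Prop}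
    (h : SigF n (fun i (v : Fin (k+1) → 𝓜 i) => P i (ini v) (v (Fin.last k)))) :
    SigF (n+1) (fun i v => ∃ y, ¬ P i v y) :=
  ⟨_, h, fun i v => by simp⟩

theorem SigF.ren {P : ∀ i, (Fin m → 𝓜 i) → Prop} (ρ : Fin m → Fin k) (h : SigF n P) :
    SigF n (fun i (v : Fin k → 𝓜 i) => P i (fun j => v (ρ j))) := by
  induction n generalizing m k with
  | zero => exact Del0.ren ρ h
  | succ n ih =>
    obtain ⟨G, h1, h2⟩ := h
    refine ⟨_, ih (lft ρ) h1, fun i v => ?_⟩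
    simp only [h2, snoc_lft]
theorem SigF.vr {P : ∀ i, (Fin m → 𝓜 i) → Prop} {g : ∀ i, (Fin k → 𝓜 i) → (Fin m → 𝓜 i)}
    (hg : FVr g) (h : SigF n P) : SigF n (fun i v => P i (g i v)) := by
  obtain ⟨ρ, hρ⟩ := hg
  simpa only [hρ] using h.ren ρ

theorem Dp.snoc2 {M : Type} [CommSemiring M] [LinearOrder M] [IsStrictOrderedRing M]
    [CanonicallyOrderedAdd M] [LA.Structure M] [PAM M] {G : (Fin (k+2) → M) → Prop} (h : Dp G)
    (v : Fin k → M) : Dp (fun w : Fin 2 → M =>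
      G (Fin.snoc (Fin.snoc v (w 0) : Fin (k+1) → M) (w 1) : Fin (k+2) → M)) := by
  refine h.comp (fun j w => (Fin.snoc (Fin.snoc v (w 0) : Fin (k+1) → M) (w 1) : Fin (k+2) → M) j) ?_
  intro j
  refine Fin.lastCases ?_ (fun j => ?_) j
  · simp only [Fin.snoc_last]; exact Tp.fp tpt
  · simp only [Fin.snoc_castSucc]
    refine Fin.lastCases ?_ (fun j => ?_) j
    · simp only [Fin.snoc_last]; exact Tp.fp tpt
    · simp only [Fin.snoc_castSucc]; exact Tp.fp (Tp.const _)

/-- simultaneous closure properties -/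
theorem SigF.cl (n : ℕ) : 
    (∀ {k : ℕ} {P Q : ∀ i, (Fin k → 𝓜 i) → Prop}, SigF n P → SigF n Q →
      SigF n (fun i v => P i v ∧ Q i v)) ∧
    (∀ {k : ℕ} {P Q : ∀ i, (Fin k → 𝓜 i) → Prop}, SigF n P → SigF n Q →
      SigF n (fun i v => P i v ∨ Q i v)) ∧
    (∀ {k : ℕ} {f : ∀ i, (Fin k → 𝓜 i) → 𝓜 i} {P : ∀ i, (Fin k → 𝓜 i) → 𝓜 i → Prop}, Fd f →
      SigF n (fun i (v : Fin (k+1) → 𝓜 i) => P i (ini v) (v (Fin.last k))) →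
      SigF n (fun i v => ∀ y, y ≤ f i v → P i v y)) ∧
    (∀ {k : ℕ} {f : ∀ i, (Fin k → 𝓜 i) → 𝓜 i} {P : ∀ i, (Fin k → 𝓜 i) → 𝓜 i → Prop}, Fd f →
      SigF n (fun i (v : Fin (k+1) → 𝓜 i) => P i (ini v) (v (Fin.last k))) →
      SigF n (fun i v => ∃ y, y ≤ f i v ∧ P i v y)) := by
  induction n with
  | zero => exact ⟨Del0.and, Del0.or, fun hf h => Del0.ball hf h, fun hf h => Del0.bex hf h⟩
  | succ n ih =>
    obtain ⟨iand, ior, iball, ibex⟩ := ih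
    refine ⟨?_, ?_, ?_, ?_⟩
    · rintro k P Q ⟨G, hG, h1⟩ ⟨H, hH, h2⟩
      refine (SigF.mkEx (P := fun i v w => ∀ y, y ≤ w → ∀ z, z ≤ w →
        (G i (Fin.snoc v y) ∨ H i (Fin.snoc v z))) ?_).of_iff ?_
      · refine iball fdt (iball fdt (ior ?_ ?_))
        · exact hG.vr (g := fun i v => (Fin.snoc (ini (ini (ini v))) (ini v (Fin.last _)) : Fin (k+1) → 𝓜 i)) fvt
        · exact hH.vr (g := fun i v => (Fin.snoc (ini (ini (ini v))) (v (Fin.last _)) : Fin (k+1) → 𝓜 i)) fvt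
      · intro i v
        simp only [h1, h2]
        constructor
        · rintro ⟨⟨y, hy⟩, ⟨z, hz⟩⟩
          refine ⟨y + z, fun h => ?_⟩
          rcases h y le_self_add z le_add_self with h | h
          exacts [hy h, hz h]
        · rintro ⟨w, h⟩
          push Not at h
          obtain ⟨y, _, z, _, h1, h2⟩ := h
          exact ⟨⟨y, h1⟩, ⟨z, h2⟩⟩
    · rintro k P Q ⟨G, hG, h1⟩ ⟨H, hH, h2⟩
      refine ⟨_, iand hG hH, fun i v => ?_⟩
      simp only [h1, h2, not_and_or, exists_or]
    · rintro k f P hf ⟨G, hG, h1⟩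
      refine (SigF.mkEx (P := fun i v w => ∃ y, y ≤ f i v ∧ ∀ z, z ≤ w →
        G i (Fin.snoc (Fin.snoc v y : Fin (k+1) → 𝓜 i) z)) ?_).of_iff ?_
      · refine ibex (hf.vr (FVr.ini FVr.id)) (iball fdt ?_)
        exact hG.vr (g := fun i v => (Fin.snoc (Fin.snoc (ini (ini (ini v))) (ini v (Fin.last _))
          : Fin (k+1) → 𝓜 i) (v (Fin.last _)) : Fin (k+2) → 𝓜 i)) fvt
      · intro i v
        have h1' : ∀ y, P i v y ↔ ∃ z, ¬ G i (Fin.snoc (Fin.snoc v y : Fin (k+1) → 𝓜 i) z) := by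
          intro y; simpa using h1 i (Fin.snoc v y)
        simp only [h1']
        constructor
        · intro h
          obtain ⟨w, hw⟩ := coll (R := fun y z => ¬ G i (Fin.snoc (Fin.snoc v y : Fin (k+1) → 𝓜 i) z))
            ((hG.dp i).snoc2 v).not (f i v) h
          refine ⟨w, ?_⟩
          push Not
          exact hw
        · rintro ⟨w, h⟩ y hy
          push Not at h
          obtain ⟨z, _, h⟩ := h y hy
          exact ⟨z, h⟩
    · rintro k f P hf ⟨G, hG, h1⟩
      refine (SigF.mkEx (P := fun i v w => ∀ y, y ≤ f i v → ∀ z, z ≤ w →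
        G i (Fin.snoc (Fin.snoc v y : Fin (k+1) → 𝓜 i) z)) ?_).of_iff ?_
      · refine iball (hf.vr (FVr.ini FVr.id)) (iball fdt ?_)
        exact hG.vr (g := fun i v => (Fin.snoc (Fin.snoc (ini (ini (ini v))) (ini v (Fin.last _))
          : Fin (k+1) → 𝓜 i) (v (Fin.last _)) : Fin (k+2) → 𝓜 i)) fvt
      · intro i v
        have h1' : ∀ y, P i v y ↔ ∃ z, ¬ G i (Fin.snoc (Fin.snoc v y : Fin (k+1) → 𝓜 i) z) := by
          intro y; simpa using h1 i (Fin.snoc v y)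
        simp only [h1']
        push Not
        constructor
        · rintro ⟨y, hy, z, h⟩
          exact ⟨z, y, hy, z, le_rfl, h⟩
        · rintro ⟨w, y, hy, z, _, h⟩
          exact ⟨y, hy, z, h⟩

theorem SigF.and {P Q : ∀ i, (Fin k → 𝓜 i) → Prop} (h : SigF n P) (h' : SigF n Q) :
      SigF n (fun i v => P i v ∧ Q i v) := (SigF.cl n).1 h h'
theorem SigF.or {P Q : ∀ i, (Fin k → 𝓜 i) → Prop} (h : SigF n P) (h' : SigF n Q) :
      SigF n (fun i v => P i v ∨ Q i v) := (SigF.cl n).2.1 h h'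
theorem SigF.ball {f : ∀ i, (Fin k → 𝓜 i) → 𝓜 i} {P : ∀ i, (Fin k → 𝓜 i) → 𝓜 i → Prop}
      (hf : Fd f) (h : SigF n (fun i (v : Fin (k+1) → 𝓜 i) => P i (ini v) (v (Fin.last k)))) :
      SigF n (fun i v => ∀ y, y ≤ f i v → P i v y) := (SigF.cl n).2.2.1 hf h
theorem SigF.bex {f : ∀ i, (Fin k → 𝓜 i) → 𝓜 i} {P : ∀ i, (Fin k → 𝓜 i) → 𝓜 i → Prop}
      (hf : Fd f) (h : SigF n (fun i (v : Fin (k+1) → 𝓜 i) => P i (ini v) (v (Fin.last k)))) :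
      SigF n (fun i v => ∃ y, y ≤ f i v ∧ P i v y) := (SigF.cl n).2.2.2 hf h

theorem SigF.neg {P : ∀ i, (Fin k → 𝓜 i) → Prop} (h : SigF n P) :
    SigF (n+1) (fun i v => ¬ P i v) :=
  (SigF.mkEx (P := fun i v _ => P i v) (h.vr (FVr.ini FVr.id))).of_iff fun i v => by simp

theorem Del0.sig {P : ∀ i, (Fin k → 𝓜 i) → Prop} (h : Del0 P) : SigF n P := by
  induction n generalizing P with
  | zero => exact h
  | succ n ih => exact (ih h.not).neg.of_iff fun i v => by simp

theorem SigF.succ {P : ∀ i, (Fin k → 𝓜 i) → Prop} (h : SigF n P) : SigF (n+1) P := by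
  induction n generalizing k with
  | zero => exact Del0.sig h
  | succ n ih =>
    obtain ⟨G, h1, h2⟩ := h
    exact ⟨G, ih h1, h2⟩

theorem SigF.mono {n' : ℕ} (hn : n ≤ n') {P : ∀ i, (Fin k → 𝓜 i) → Prop} (h : SigF n P) : SigF n' P := by
  induction hn with
  | refl => exact h
  | step _ ih => exact ih.succ

theorem SigF.ex {P : ∀ i, (Fin k → 𝓜 i) → 𝓜 i → Prop}
    (h : SigF (n+1) (fun i (v : Fin (k+1) → 𝓜 i) => P i (ini v) (v (Fin.last k)))) :
    SigF (n+1) (fun i v => ∃ y, P i v y) := by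
  obtain ⟨G, hG, h1⟩ := h
  refine (SigF.mkEx (P := fun i v w => ∀ y, y ≤ w → ∀ z, z ≤ w →
    G i (Fin.snoc (Fin.snoc v y : Fin (k+1) → 𝓜 i) z)) ?_).of_iff ?_
  · refine SigF.ball fdt (SigF.ball fdt ?_)
    exact hG.vr (g := fun i v => (Fin.snoc (Fin.snoc (ini (ini (ini v))) (ini v (Fin.last _))
      : Fin (k+1) → 𝓜 i) (v (Fin.last _)) : Fin (k+2) → 𝓜 i)) fvt
  · intro i v
    have h1' : ∀ y, P i v y ↔ ∃ z, ¬ G i (Fin.snoc (Fin.snoc v y : Fin (k+1) → 𝓜 i) z) := by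
      intro y; simpa using h1 i (Fin.snoc v y)
    simp only [h1']
    push Not
    constructor
    · rintro ⟨y, z, h⟩
      exact ⟨y + z, y, le_self_add, z, le_add_self, h⟩
    · rintro ⟨w, y, hy, z, _, h⟩
      exact ⟨y, z, h⟩

theorem SigF.comp {P : ∀ i, (Fin m → 𝓜 i) → Prop} (hP : SigF n P)
    (f : Fin m → ∀ i, (Fin k → 𝓜 i) → 𝓜 i) (hf : ∀ j, Fd (f j)) :
    SigF n (fun i v => P i (fun j => f j i v)) := by
  refine comp_gen (𝓜 := 𝓜) (fun P => SigF n P) (fun P => Fd P)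
    (fun P ρ h => h.ren ρ) (fun {m k} P ρ h => h.ren ρ) (fun {k} P f hP hf => ?_) P hP f hf
  obtain ⟨t, h1, h2, h3⟩ := hf
  refine (SigF.bex h1.fd (P := fun i v y => y = f i v ∧ P i (Fin.snoc v y)) (SigF.and h3.sig ?_)).of_iff ?_
  · simpa only [snoc_ini] using hP
  · intro i v
    constructor
    · intro h; exact ⟨_, h2 _ _, rfl, h⟩
    · rintro ⟨_, _, rfl, h⟩; exact h

theorem SigF.comp1 {P : ∀ i, 𝓜 i → Prop} (hP : SigF n (fun i (v : Fin 1 → 𝓜 i) => P i (v 0)))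
    {f : ∀ i, (Fin k → 𝓜 i) → 𝓜 i} (hf : Fd f) : SigF n (fun i v => P i (f i v)) :=
  hP.comp ![f] (by intro j; fin_cases j; exact hf)
theorem SigF.comp2 {P : ∀ i, 𝓜 i → 𝓜 i → Prop}
    (hP : SigF n (fun i (v : Fin 2 → 𝓜 i) => P i (v 0) (v 1)))
    {f g : ∀ i, (Fin k → 𝓜 i) → 𝓜 i} (hf : Fd f) (hg : Fd g) :
    SigF n (fun i v => P i (f i v) (g i v)) :=
  hP.comp ![f, g] (by intro j; fin_cases j; exacts [hf, hg])

/-- extraction of formulas -/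
theorem SigF.fml {P : ∀ i, (Fin k → 𝓜 i) → Prop} (h : SigF n P) :
    (∃ φ : LA.BoundedFormula Empty k, IsSigmaFml n φ ∧ ∀ i v, φ.Realize default v ↔ P i v) ∧
    (∃ φ : LA.BoundedFormula Empty k, IsPiFml n φ ∧ ∀ i v, φ.Realize default v ↔ ¬ P i v) := by
  induction n generalizing k with
  | zero =>
    obtain ⟨φ, h0, h1⟩ := h
    exact ⟨⟨φ, .ofDelta0 h0, h1⟩, ⟨φ.imp ⊥, .ofDelta0 (.imp h0 .falsum), fun i v => by simp [h1]⟩⟩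
  | succ n ih =>
    obtain ⟨G, h1, h2⟩ := h
    obtain ⟨⟨φ, a1, a2⟩, ⟨ψ, b1, b2⟩⟩ := ih h1
    exact ⟨⟨∃' ψ, .ex (.ofPi b1), fun i v => by simp [b2, h2]⟩,
      ⟨∀' φ, .all (.ofSigma a1), fun i v => by simp [a2, h2]⟩⟩
end fam



/-! ### programs and universal predicates -/

/-- programs -/
inductive Pg : Type
  | id | p1 | p2 | zero | one | add | mul | eq | le
  | pair (f g : Pg) | comp (f g : Pg) | ball (f : Pg)

/-- codes of programs -/
def Pg.code : Pg → ℕ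
  | .id => prm 0 0
  | .p1 => prm 0 1
  | .p2 => prm 0 2
  | .zero => prm 0 3
  | .one => prm 0 4
  | .add => prm 0 5
  | .mul => prm 0 6
  | .eq => prm 0 7
  | .le => prm 0 8
  | .pair f g => prm 1 (prm f.code g.code)
  | .comp f g => prm 2 (prm f.code g.code)
  | .ball f => prm 3 f.code

section pam
variable {M : Type} [CommSemiring M] [LinearOrder M] [IsStrictOrderedRing M]
    [CanonicallyOrderedAdd M] [LA.Structure M] [PAM M] {k m : ℕ}

open Classical in
/-- semantics of programs -/
noncomputable def pev : Pg → M → M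
  | .id, x => x
  | .p1, x => p1 x
  | .p2, x => p2 x
  | .zero, x => 0
  | .one, x => 1
  | .add, x => p1 x + p2 x
  | .mul, x => p1 x * p2 x
  | .eq, x => if p1 x = p2 x then 1 else 0
  | .le, x => if p1 x ≤ p2 x then 1 else 0
  | .pair f g, x => prm (pev f x) (pev g x)
  | .comp f g, x => pev f (pev g x)
  | .ball f, x => if ∀ u, u ≤ p2 x → pev f (prm (p1 x) u) = 1 then 1 else 0

/-- graph of the basic operations -/
def Bas (j x y : M) : Prop :=
  (j = ((0:ℕ):M) ∧ y = x) ∨ (j = ((1:ℕ):M) ∧ y = p1 x) ∨ (j = ((2:ℕ):M) ∧ y = p2 x) ∨ (j = ((3:ℕ):M) ∧ y = 0) ∨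
  (j = ((4:ℕ):M) ∧ y = 1) ∨ (j = ((5:ℕ):M) ∧ y = p1 x + p2 x) ∨ (j = ((6:ℕ):M) ∧ y = p1 x * p2 x) ∨
  (j = ((7:ℕ):M) ∧ ((p1 x = p2 x ∧ y = 1) ∨ (¬ p1 x = p2 x ∧ y = 0))) ∨
  (j = ((8:ℕ):M) ∧ ((p1 x ≤ p2 x ∧ y = 1) ∨ (¬ p1 x ≤ p2 x ∧ y = 0)))

/-- local correctness of computation tables -/
def Stp (A : M → Prop) (c x y : M) : Prop :=
  (∃ j, c = prm ((0:ℕ):M) j ∧ Bas j x y) ∨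
  (∃ f g, c = prm ((1:ℕ):M) (prm f g) ∧ ∃ a b, A (prm f (prm x a)) ∧ A (prm g (prm x b)) ∧ y = prm a b) ∨
  (∃ f g, c = prm ((2:ℕ):M) (prm f g) ∧ ∃ b, A (prm g (prm x b)) ∧ A (prm f (prm b y))) ∨
  (∃ f, c = prm ((3:ℕ):M) f ∧ (((∀ u, u ≤ p2 x → A (prm f (prm (prm (p1 x) u) 1))) ∧ y = 1) ∨
    ((∃ u, u ≤ p2 x ∧ ∃ a, ¬ a = 1 ∧ A (prm f (prm (prm (p1 x) u) a))) ∧ y = 0)))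

theorem Stp.mono {A B : M → Prop} (h : ∀ x, A x → B x) {c x y : M} (hs : Stp A c x y) :
    Stp B c x y := by
  rcases hs with h1 | ⟨f, g, h1, a, b, h2, h3, h4⟩ | ⟨f, g, h1, b, h2, h3⟩ | ⟨f, h1, h2⟩
  · exact Or.inl h1
  · exact Or.inr (Or.inl ⟨f, g, h1, a, b, h _ h2, h _ h3, h4⟩)
  · exact Or.inr (Or.inr (Or.inl ⟨f, g, h1, b, h _ h2, h _ h3⟩))
  · refine Or.inr (Or.inr (Or.inr ⟨f, h1, ?_⟩))
    rcases h2 with ⟨h2, h3⟩ | ⟨⟨u, hu, a, ha, h2⟩, h3⟩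
    · exact Or.inl ⟨fun u hu => h _ (h2 u hu), h3⟩
    · exact Or.inr ⟨⟨u, hu, a, ha, h _ h2⟩, h3⟩

/-- correct tables -/
def LC (s : M) : Prop := ∀ c, c ≤ s → ∀ x, x ≤ s → ∀ y, y ≤ s → Mem (prm c (prm x y)) s →
  ((∃ j, j ≤ s ∧ c = prm ((0:ℕ):M) j ∧ Bas j x y) ∨
  (∃ f, f ≤ s ∧ ∃ g, g ≤ s ∧ c = prm ((1:ℕ):M) (prm f g) ∧ ∃ a, a ≤ s ∧ ∃ b, b ≤ s ∧
    Mem (prm f (prm x a)) s ∧ Mem (prm g (prm x b)) s ∧ y = prm a b) ∨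
  (∃ f, f ≤ s ∧ ∃ g, g ≤ s ∧ c = prm ((2:ℕ):M) (prm f g) ∧ ∃ b, b ≤ s ∧
    Mem (prm g (prm x b)) s ∧ Mem (prm f (prm b y)) s) ∨
  (∃ f, f ≤ s ∧ c = prm ((3:ℕ):M) f ∧ (((∀ u, u ≤ p2 x → Mem (prm f (prm (prm (p1 x) u) 1)) s) ∧ y = 1) ∨
    ((∃ u, u ≤ p2 x ∧ ∃ a, a ≤ s ∧ ¬ a = 1 ∧ Mem (prm f (prm (prm (p1 x) u) a)) s) ∧ y = 0))))

theorem mem3_le {c x y s : M} (h : Mem (prm c (prm x y)) s) : c ≤ s ∧ x ≤ s ∧ y ≤ s := by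
  have := h.lt.le
  exact ⟨(le_prm_left _ _).trans this, ((le_prm_left _ _).trans (le_prm_right _ _)).trans this,
    ((le_prm_right _ _).trans (le_prm_right _ _)).trans this⟩

theorem LC_iff {s : M} : LC s ↔ ∀ c x y, Mem (prm c (prm x y)) s → Stp (fun t => Mem t s) c x y := by
  constructor
  · intro h c x y hm
    obtain ⟨h1, h2, h3⟩ := mem3_le hm
    rcases h c h1 x h2 y h3 hm with ⟨j, _, h⟩ | ⟨f, _, g, _, h, a, _, b, _, h'⟩ | ⟨f, _, g, _, h, b, _, h'⟩ | ⟨f, _, h1, h2⟩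
    · exact Or.inl ⟨j, h⟩
    · exact Or.inr (Or.inl ⟨f, g, h, a, b, h'⟩)
    · exact Or.inr (Or.inr (Or.inl ⟨f, g, h, b, h'⟩))
    · refine Or.inr (Or.inr (Or.inr ⟨f, h1, ?_⟩))
      rcases h2 with h2 | ⟨⟨u, hu, a, _, h2⟩, h3⟩
      · exact Or.inl h2
      · exact Or.inr ⟨⟨u, hu, a, h2⟩, h3⟩
  · intro h c hc x hx y hy hm
    rcases h c x y hm with ⟨j, h1, h2⟩ | ⟨f, g, h1, a, b, h2, h3, h4⟩ | ⟨f, g, h1, b, h2, h3⟩ | ⟨f, h1, h2⟩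
    · exact Or.inl ⟨j, (h1 ▸ le_prm_right _ _ : j ≤ c).trans hc, h1, h2⟩
    · exact Or.inr (Or.inl ⟨f, (mem3_le h2).1, g, (mem3_le h3).1, h1, a, (mem3_le h2).2.2, b,
        (mem3_le h3).2.2, h2, h3, h4⟩)
    · exact Or.inr (Or.inr (Or.inl ⟨f, (mem3_le h3).1, g, (mem3_le h2).1, h1, b, (mem3_le h2).2.2,
        h2, h3⟩))
    · refine Or.inr (Or.inr (Or.inr ⟨f, (h1 ▸ le_prm_right _ _ : f ≤ c).trans hc, h1, ?_⟩))
      rcases h2 with h2 | ⟨⟨u, hu, a, ha, h2⟩, h3⟩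
      · exact Or.inl h2
      · exact Or.inr ⟨⟨u, hu, a, (mem3_le h2).2.2, ha, h2⟩, h3⟩

theorem LC_union {s s' : M} (h : LC s) (h' : LC s') (A : M → Prop) (hA : ∃ b, ∀ x, A x → x < b)
    (hAd : Dp (fun v : Fin 1 → M => A (v 0)))
    (hAs : ∀ c x y, A (prm c (prm x y)) → Stp (fun t => Mem t s ∨ Mem t s' ∨ A t) c x y) :
    ∃ s'', LC s'' ∧ ∀ x, (Mem x s ∨ Mem x s' ∨ A x) → Mem x s'' := by
  obtain ⟨b, hb⟩ := hA
  have hd : Dp (fun v : Fin 1 → M => Mem (v 0) s ∨ Mem (v 0) s' ∨ A (v 0)) := by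
    have : Dp (fun v : Fin 2 → M => Mem (v 0) (v 1)) :=
      Del0.dp (ι := Unit) (𝓜 := fun _ => M) (P := fun _ v => Mem (v 0) (v 1)) d0t ()
    exact Dp.or (this.comp2 (Tp.fp tpt) (Tp.fp tpt)) (Dp.or (this.comp2 (Tp.fp tpt) (Tp.fp tpt)) hAd)
  obtain ⟨t, ht, hm⟩ := compr (P := fun x : M => Mem x s ∨ Mem x s' ∨ A x) hd (s + s' + b)
  have key : ∀ x, (Mem x s ∨ Mem x s' ∨ A x) → Mem x t := by
    intro x hx
    refine (hm x).2 ⟨?_, hx⟩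
    rcases hx with hx | hx | hx
    · exact hx.lt.trans_le (le_trans le_self_add le_self_add)
    · exact hx.lt.trans_le (le_trans le_add_self le_self_add)
    · exact (hb _ hx).trans_le le_add_self
  refine ⟨t, LC_iff.2 fun c x y hx => ?_, key⟩
  rcases ((hm _).1 hx).2 with hx | hx | hx
  · exact (LC_iff.1 h _ _ _ hx).mono fun x hx => key x (Or.inl hx)
  · exact (LC_iff.1 h' _ _ _ hx).mono fun x hx => key x (Or.inr (Or.inl hx))
  · exact (hAs _ _ _ hx).mono key

theorem LC_add {s s' : M} (h : LC s) (h' : LC s') {c x y : M}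
    (hs : Stp (fun t => Mem t s ∨ Mem t s') c x y) :
    ∃ t, LC t ∧ (∀ x, (Mem x s ∨ Mem x s') → Mem x t) ∧ Mem (prm c (prm x y)) t := by
  obtain ⟨t, h1, h2⟩ := LC_union h h' (fun z => z = prm c (prm x y)) ⟨prm c (prm x y) + 1, fun z hz => by
    rw [hz]; exact lt_add_one _⟩ (Dp.eq tpt (Tp.const _)) (fun c' x' y' hz => by
      rw [prm_inj, prm_inj] at hz
      obtain ⟨rfl, rfl, rfl⟩ := hz
      exact hs.mono fun x hx => hx.elim Or.inl fun h => Or.inr (Or.inl h))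
  exact ⟨t, h1, fun x hx => h2 x (hx.elim Or.inl fun h => Or.inr (Or.inl h)), h2 _ (Or.inr (Or.inr rfl))⟩

theorem LC_join {s s' : M} (h : LC s) (h' : LC s') :
    ∃ t, LC t ∧ (∀ x, (Mem x s ∨ Mem x s') → Mem x t) := by
  obtain ⟨t, h1, h2⟩ := LC_union h h' (fun z => False) ⟨0, fun z hz => hz.elim⟩ (Dp.prop _) (fun c' x' y' hz => hz.elim)
  exact ⟨t, h1, fun x hx => h2 x (hx.elim Or.inl fun h => Or.inr (Or.inl h))⟩

theorem LC_empty : ∃ s : M, LC s := by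
  obtain ⟨t, ht, hm⟩ := compr (P := fun x : M => False) (Dp.prop _) 0
  exact ⟨t, LC_iff.2 fun c x y hx => ((hm _).1 hx).2.elim⟩

theorem LC_dp : Dp (fun v : Fin 1 → M => LC (v 0)) := by
  refine Del0.dp (ι := Unit) (𝓜 := fun _ => M) (P := fun _ v => LC (v 0)) ?_ ()
  unfold LC Bas
  exact d0t

/-- evaluation of coded programs -/
def Ev (e x y : M) : Prop := ∃ s, LC s ∧ Mem (prm e (prm x y)) s

theorem natne {a b : ℕ} (h : a ≠ b) : ((a : M) = (b : M)) = False := by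
  simpa using h

theorem Ev.bas {j : ℕ} {x y : M} (h : Bas (j : M) x y) : Ev ((prm 0 j : ℕ) : M) x y := by
  obtain ⟨s, hs⟩ := LC_empty (M := M)
  obtain ⟨t, h1, _, h2⟩ := LC_add hs hs (c := ((prm 0 j : ℕ) : M)) (x := x) (y := y)
    (Or.inl ⟨j, by rw [cast_prm], h⟩)
  exact ⟨t, h1, h2⟩

theorem ev_ex (pg : Pg) : ∀ x : M, Ev (pg.code : M) x (pev pg x) := by
  induction pg with
  | id => intro x; exact Ev.bas (by simp [Bas, pev])
  | p1 => intro x; exact Ev.bas (by simp [Bas, pev])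
  | p2 => intro x; exact Ev.bas (by simp [Bas, pev])
  | zero => intro x; exact Ev.bas (by simp [Bas, pev])
  | one => intro x; exact Ev.bas (by simp [Bas, pev])
  | add => intro x; exact Ev.bas (by simp [Bas, pev])
  | mul => intro x; exact Ev.bas (by simp [Bas, pev])
  | eq => intro x; exact Ev.bas (by by_cases h : p1 x = p2 x <;> simp [Bas, pev, h])
  | le => intro x; exact Ev.bas (by by_cases h : p1 x ≤ p2 x <;> simp [Bas, pev, h])
  | pair f g hf hg =>
    intro x
    obtain ⟨s, h1, h2⟩ := hf x
    obtain ⟨s', h1', h2'⟩ := hg x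
    obtain ⟨t, a, _, b⟩ := LC_add h1 h1' (c := ((Pg.pair f g).code : M)) (x := x) (y := pev (.pair f g) x)
      (Or.inr (Or.inl ⟨f.code, g.code, by simp [Pg.code], _, _, Or.inl h2, Or.inr h2', by simp [pev]⟩))
    exact ⟨t, a, b⟩
  | comp f g hf hg =>
    intro x
    obtain ⟨s, h1, h2⟩ := hf (pev g x)
    obtain ⟨s', h1', h2'⟩ := hg x
    obtain ⟨t, a, _, b⟩ := LC_add h1 h1' (c := ((Pg.comp f g).code : M)) (x := x) (y := pev (.comp f g) x)
      (Or.inr (Or.inr (Or.inl ⟨f.code, g.code, by simp [Pg.code], _, Or.inr h2', by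
        simp only [pev]; exact Or.inl h2⟩)))
    exact ⟨t, a, b⟩
  | ball f hf =>
    intro x
    by_cases hx : ∀ u, u ≤ p2 x → pev f (prm (p1 x) u) = 1
    · have : ∀ b : M, b ≤ p2 x → ∃ s, LC s ∧ ∀ u, u ≤ b → Mem (prm (f.code : M) (prm (prm (p1 x) u) 1)) s := by
        intro b
        refine ind_dp (P := fun b : M => b ≤ p2 x → ∃ s, LC s ∧ ∀ u, u ≤ b → Mem (prm (f.code : M) (prm (prm (p1 x) u) 1)) s) ?_ ?_ ?_ b
        · apply Dp.imp dpl
          apply Dp.ex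
          apply Dp.and (LC_dp.comp1 (Tp.fp tpt))
          apply Dp.all; apply Dp.imp dpl
          have hm : Dp (fun v : Fin 2 → M => Mem (v 0) (v 1)) :=
            Del0.dp (ι := Unit) (𝓜 := fun _ => M) (P := fun _ v => Mem (v 0) (v 1)) d0t ()
          refine hm.comp2 (Tp.fp ?_) (Tp.fp tpt)
          unfold prm
          exact tpt
        · intro h0
          obtain ⟨s, h1, h2⟩ := hf (prm (p1 x) 0)
          rw [hx 0 h0] at h2
          refine ⟨s, h1, fun u hu => ?_⟩
          rw [le_zero'] at hu; rwa [hu]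
        · intro b ih hb
          obtain ⟨s, h1, h2⟩ := ih (le_trans le_self_add hb)
          obtain ⟨s', h1', h2'⟩ := hf (prm (p1 x) (b+1))
          rw [hx _ hb] at h2'
          obtain ⟨t, a, c⟩ := LC_join h1 h1'
          refine ⟨t, a, fun u hu => ?_⟩
          rcases le_S_iff.1 hu with hu | rfl
          · exact c _ (Or.inl (h2 u hu))
          · exact c _ (Or.inr h2')
      obtain ⟨s, h1, h2⟩ := this _ le_rfl
      obtain ⟨t, a, _, b⟩ := LC_add h1 h1 (c := ((Pg.ball f).code : M)) (x := x) (y := pev (.ball f) x)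
        (Or.inr (Or.inr (Or.inr ⟨f.code, by simp [Pg.code], Or.inl ⟨fun u hu => Or.inl (h2 u hu), by
          rw [pev, if_pos hx]⟩⟩)))
      exact ⟨t, a, b⟩
    · have hx' := hx
      push Not at hx
      obtain ⟨u, hu, hne⟩ := hx
      obtain ⟨s, h1, h2⟩ := hf (prm (p1 x) u)
      obtain ⟨t, a, _, b⟩ := LC_add h1 h1 (c := ((Pg.ball f).code : M)) (x := x) (y := pev (.ball f) x)
        (Or.inr (Or.inr (Or.inr ⟨f.code, by simp [Pg.code], Or.inr ⟨⟨u, hu, _, hne, Or.inl h2⟩, by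
          rw [pev, if_neg hx']⟩⟩)))
      exact ⟨t, a, b⟩

theorem bas_un {j : ℕ} {x y : M} {s : M} (h : LC s) (hm : Mem (prm ((prm 0 j : ℕ) : M) (prm x y)) s) :
    Bas (j : M) x y := by
  rcases LC_iff.1 h _ _ _ hm with ⟨j', h1, h2⟩ | ⟨f, g, h1, _⟩ | ⟨f, g, h1, _⟩ | ⟨f, h1, _⟩
  · rw [cast_prm, prm_inj] at h1; rw [h1.2]; exact h2
  all_goals
    rw [cast_prm, prm_inj, natne (by simp)] at h1
    exact h1.1.elim

theorem ev_un (pg : Pg) : ∀ {x y s : M}, LC s → Mem (prm (pg.code : M) (prm x y)) s → y = pev pg x := by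
  induction pg with
  | id => intro x y s h hm; simpa [Bas, natne, pev] using bas_un h hm
  | p1 => intro x y s h hm; simpa [Bas, natne, pev] using bas_un h hm
  | p2 => intro x y s h hm; simpa [Bas, natne, pev] using bas_un h hm
  | zero => intro x y s h hm; simpa [Bas, natne, pev] using bas_un h hm
  | one => intro x y s h hm; simpa [Bas, natne, pev] using bas_un h hm
  | add => intro x y s h hm; simpa [Bas, natne, pev] using bas_un h hm
  | mul => intro x y s h hm; simpa [Bas, natne, pev] using bas_un h hm
  | eq => intro x y s h hm; have := bas_un h hm; by_cases h : p1 x = p2 x <;> simpa [Bas, natne, pev, h] using this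
  | le => intro x y s h hm; have := bas_un h hm; by_cases h : p1 x ≤ p2 x <;> simpa [Bas, natne, pev, h] using this
  | pair f g hf hg =>
    intro x y s h hm
    simp only [Pg.code, cast_prm] at hm
    rcases LC_iff.1 h _ _ _ hm with ⟨j', h1, h2⟩ | ⟨f, g, h1, a, b, h2, h3, h4⟩ | ⟨f, g, h1, _⟩ | ⟨f, h1, _⟩
    · rw [prm_inj, natne (by simp)] at h1; exact h1.1.elim
    · rw [prm_inj, prm_inj] at h1
      rw [← h1.2.1] at h2
      rw [← h1.2.2] at h3
      rw [h4, hf h h2, hg h h3, pev]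
    · rw [prm_inj, natne (by simp)] at h1; exact h1.1.elim
    · rw [prm_inj, natne (by simp)] at h1; exact h1.1.elim
  | comp f g hf hg =>
    intro x y s h hm
    simp only [Pg.code, cast_prm] at hm
    rcases LC_iff.1 h _ _ _ hm with ⟨j', h1, h2⟩ | ⟨f, g, h1, a, b, h2, h3, h4⟩ | ⟨f, g, h1, b, h2, h3⟩ | ⟨f, h1, _⟩
    · rw [prm_inj, natne (by simp)] at h1; exact h1.1.elim
    · rw [prm_inj, natne (by simp)] at h1; exact h1.1.elim
    · rw [prm_inj, prm_inj] at h1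
      rw [← h1.2.2] at h2
      rw [← h1.2.1] at h3
      rw [hf h h3, hg h h2, pev]
    · rw [prm_inj, natne (by simp)] at h1; exact h1.1.elim
  | ball f hf =>
    intro x y s h hm
    simp only [Pg.code, cast_prm] at hm
    rcases LC_iff.1 h _ _ _ hm with ⟨j', h1, h2⟩ | ⟨f, g, h1, a, b, h2, h3, h4⟩ | ⟨f, g, h1, b, h2, h3⟩ | ⟨f, h1, h2⟩
    · rw [prm_inj, natne (by simp)] at h1; exact h1.1.elim
    · rw [prm_inj, natne (by simp)] at h1; exact h1.1.elim
    · rw [prm_inj, natne (by simp)] at h1; exact h1.1.elim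
    · rw [prm_inj] at h1
      rw [← h1.2] at h2
      rcases h2 with ⟨h2, rfl⟩ | ⟨⟨u, hu, a, ha, h2⟩, rfl⟩
      · rw [pev, if_pos fun u hu => (hf h (h2 u hu)).symm]
      · rw [pev, if_neg]
        intro h3
        exact ha ((hf h h2).trans (h3 u hu))

theorem ev_iff {pg : Pg} {x y : M} : Ev (pg.code : M) x y ↔ y = pev pg x := by
  constructor
  · rintro ⟨s, h1, h2⟩; exact ev_un pg h1 h2
  · rintro rfl; exact ev_ex pg x

end pam


section pam
variable {M : Type} [CommSemiring M] [LinearOrder M] [IsStrictOrderedRing M]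
    [CanonicallyOrderedAdd M] [LA.Structure M] [PAM M] {k m : ℕ}

/-- the matrix of the universal Σ₁ predicate -/
def HH (e x z : M) : Prop := ∃ y, y ≤ z ∧ ∃ w, w ≤ z ∧ ∃ s, s ≤ z ∧ ¬ w = 1 ∧ LC s ∧
  Mem (prm e (prm (prm x y) w)) s

/-- truth predicates -/
def Tr : ℕ → M → M → Prop
  | 0, e, x => ∃ z, HH e x z
  | k+1, e, x => ∃ y, ¬ Tr k e (prm x y)

/-- semantic version -/
def Sem : ℕ → Pg → M → Prop
  | 0, pg, x => pev pg x = 1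
  | k+1, pg, x => ∃ y, ¬ Sem k pg (prm x y)

theorem tr_sem (k : ℕ) (pg : Pg) (x : M) : Tr k (pg.code : M) x ↔ Sem (k+1) pg x := by
  induction k generalizing x with
  | zero =>
    simp only [Tr, Sem, HH]
    constructor
    · rintro ⟨z, y, _, w, _, s, _, h1, h2, h3⟩
      rw [ev_un pg h2 h3] at h1
      exact ⟨y, h1⟩
    · rintro ⟨y, hy⟩
      obtain ⟨s, h1, h2⟩ := ev_ex pg (prm x y)
      exact ⟨y + pev pg (prm x y) + s, y, le_trans le_self_add le_self_add, _,
        le_trans le_add_self le_self_add, s, le_add_self, hy, h1, h2⟩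
  | succ k ih => simp only [Tr, ih]; rfl

/-- tuples -/
def tup : ∀ {k : ℕ}, (Fin k → M) → M
  | 0, _ => 0
  | _+1, v => prm (tup (ini v)) (v (Fin.last _))

@[simp] theorem tup_snoc (v : Fin k → M) (a : M) : tup (Fin.snoc v a : Fin (k+1) → M) = prm (tup v) a := by
  simp [tup]

end pam

section fam
variable {ι : Type*} {𝓜 : ι → Type}
variable [∀ i, CommSemiring (𝓜 i)] [∀ i, LinearOrder (𝓜 i)] [∀ i, IsStrictOrderedRing (𝓜 i)]
    [∀ i, CanonicallyOrderedAdd (𝓜 i)] [∀ i, LA.Structure (𝓜 i)] [∀ i, PAM (𝓜 i)] {k m n : ℕ}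

theorem Del0.lc {f : ∀ i, (Fin k → 𝓜 i) → 𝓜 i} (hf : Fd f) :
    Del0 (fun i v => LC (f i v)) := by
  refine Del0.comp1 (P := fun i x => LC x) ?_ hf
  unfold LC Bas
  exact d0t
theorem Del0.hh {f g h : ∀ i, (Fin k → 𝓜 i) → 𝓜 i} (hf : Fd f) (hg : Fd g) (hh : Fd h) :
    Del0 (fun i v => HH (f i v) (g i v) (h i v)) := by
  refine Del0.comp3 (P := fun i x y z => HH x y z) ?_ hf hg hh
  unfold HH
  refine Del0.bex fdt (Del0.bex fdt (Del0.bex fdt (Del0.and d0t (Del0.and (Del0.lc fdt) d0t))))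
theorem SigF.tr {f g : ∀ i, (Fin k → 𝓜 i) → 𝓜 i} (hf : Fd f) (hg : Fd g) (l : ℕ) :
    SigF (l+1) (fun i v => Tr l (f i v) (g i v)) := by
  induction l generalizing k with
  | zero =>
    simp only [Tr]
    exact SigF.ex (Del0.hh (hf.vr fvt) (hg.vr fvt) fdt).sig
  | succ l ih =>
    simp only [Tr]
    exact SigF.mkEx (P := fun i v y => Tr l (f i v) (prm (g i v) y)) (ih (hf.vr fvt) (Fd.prm (hg.vr fvt) fdt))

end fam

/-- the class of all models of PA -/
structure Mdl where
  /-- carrier -/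
  C : Type
  str : LA.Structure C
  pmi : PMI C

instance (i : Mdl) : LA.Structure i.C := i.str
instance (i : Mdl) : CommSemiring i.C := i.pmi.i1
instance (i : Mdl) : LinearOrder i.C := i.pmi.i2
instance (i : Mdl) : IsStrictOrderedRing i.C := i.pmi.i3
instance (i : Mdl) : CanonicallyOrderedAdd i.C := i.pmi.i4
instance (i : Mdl) : PAM i.C := i.pmi.i5

/-- the standard model -/
def Mdl.N : Mdl := ⟨ℕ, natStr, ⟨inferInstance, inferInstance, inferInstance, inferInstance, natPAM⟩⟩

/-! representation of formulas by programs -/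

/-- Boolean operations on programs -/
def Pg.b (f : Pg) : Pg := .comp .eq (.pair f .one)
/-- negation -/
def Pg.n (f : Pg) : Pg := .comp .eq (.pair f.b .zero)
/-- implication -/
def Pg.i (f g : Pg) : Pg := .comp .le (.pair f.b g.b)

section pam
variable {M : Type} [CommSemiring M] [LinearOrder M] [IsStrictOrderedRing M]
    [CanonicallyOrderedAdd M] [LA.Structure M] [PAM M] {k m : ℕ}
theorem pev_n (f : Pg) (x : M) : pev f.n x = 1 ↔ ¬ pev f x = 1 := by
  by_cases h : pev f x = 1 <;> simp [Pg.n, Pg.b, pev, h]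
theorem pev_i (f g : Pg) (x : M) : pev (f.i g) x = 1 ↔ (pev f x = 1 → pev g x = 1) := by
  by_cases h : pev f x = 1 <;> by_cases h' : pev g x = 1 <;> simp [Pg.i, Pg.b, pev, h, h']
theorem pev_ball (f : Pg) (x : M) : pev (.ball f) x = 1 ↔ ∀ u ≤ p2 x, pev f (prm (p1 x) u) = 1 := by
  simp only [pev]; split_ifs with h
  · exact ⟨fun _ => h, fun _ => rfl⟩
  · exact ⟨fun h' => absurd h' zero_ne_one, fun h' => absurd h' h⟩
theorem pev_cp (f g h : Pg) (x : M) : pev (.comp f (.pair g h)) x = pev f (prm (pev g x) (pev h x)) := by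
  simp only [pev]
theorem pev_id (x : M) : pev .id x = x := by simp only [pev]
end pam

theorem rep_term {k : ℕ} (t : LA.Term (Empty ⊕ Fin k)) :
    ∃ pg : Pg, ∀ (i : Mdl) (v : Fin k → i.C), t.realize (Sum.elim default v) = pev pg (tup v) := by
  induction t with
  | var x =>
    rcases x with x | j
    · exact x.elim
    · simp only [Term.realize, Sum.elim_inr]
      induction k with
      | zero => exact j.elim0
      | succ k ih =>
        refine Fin.lastCases ?_ (fun j => ?_) j
        · exact ⟨.p2, fun i v => by simp [pev, tup]⟩
        · obtain ⟨pg, h⟩ := ih j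
          exact ⟨.comp pg .p1, fun i v => by simp only [pev, tup, p1_prm]; rw [← h]; rfl⟩
  | @func l f ts ih =>
    match l, f with
    | 0, f => exact ⟨.zero, fun i v => by simp only [pev, Term.realize]; exact Cmp.c_zero _⟩
    | 1, f =>
      obtain ⟨p, hp⟩ := ih 0
      exact ⟨.comp .add (.pair p .one), fun i v => by
        simp only [pev, Term.realize, p1_prm, p2_prm, ← hp]; exact Cmp.c_succ _⟩
    | 2, false =>
      obtain ⟨p, hp⟩ := ih 0
      obtain ⟨q, hq⟩ := ih 1
      exact ⟨.comp .add (.pair p q), fun i v => by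
        simp only [pev, Term.realize, p1_prm, p2_prm, ← hp, ← hq]; exact Cmp.c_add _⟩
    | 2, true =>
      obtain ⟨p, hp⟩ := ih 0
      obtain ⟨q, hq⟩ := ih 1
      exact ⟨.comp .mul (.pair p q), fun i v => by
        simp only [pev, Term.realize, p1_prm, p2_prm, ← hp, ← hq]; exact Cmp.c_mul _⟩
    | l+3, f => exact (show Empty from f).elim

theorem rep_d0 {k : ℕ} {φ : LA.BoundedFormula Empty k} (h : IsDelta0 φ) :
    ∃ pg : Pg, ∀ (i : Mdl) (v : Fin k → i.C), φ.Realize default v ↔ pev pg (tup v) = 1 := by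
  induction h with
  | falsum => exact ⟨.zero, fun i v => by simp [pev]⟩
  | equal t u =>
    obtain ⟨p, hp⟩ := rep_term t
    obtain ⟨q, hq⟩ := rep_term u
    refine ⟨.comp .eq (.pair p q), fun i v => ?_⟩
    simp [pev, hp, hq]
  | le t u =>
    obtain ⟨p, hp⟩ := rep_term t
    obtain ⟨q, hq⟩ := rep_term u
    refine ⟨.comp .le (.pair p q), fun i v => ?_⟩
    simp [pev, hp, hq]
  | imp _ _ h1 h2 =>
    obtain ⟨p, hp⟩ := h1
    obtain ⟨q, hq⟩ := h2
    exact ⟨p.i q, fun i v => by rw [pev_i, ← hp, ← hq]; rfl⟩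
  | ball t _ h =>
    obtain ⟨p, hp⟩ := rep_term t
    obtain ⟨q, hq⟩ := h
    refine ⟨.comp (.ball q) (.pair .id p), fun i v => ?_⟩
    rw [pev_cp, pev_ball]
    simp [pev_id, real_rlb, hp, hq, -Term.realize_relabel]
  | bex t _ h =>
    obtain ⟨p, hp⟩ := rep_term t
    obtain ⟨q, hq⟩ := h
    refine ⟨(Pg.comp (.ball q.n) (.pair .id p)).n, fun i v => ?_⟩
    rw [pev_n, pev_cp, pev_ball]
    simp [pev_id, real_rlb, hp, hq, pev_n, -Term.realize_relabel]

theorem reidx (k : ℕ) (pg f : Pg) : ∃ pg' : Pg, ∀ (i : Mdl) (x : i.C),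
    Sem k pg' x ↔ Sem k pg (pev f x) := by
  induction k generalizing f with
  | zero => exact ⟨.comp pg f, fun i x => Iff.rfl⟩
  | succ k ih =>
    obtain ⟨pg', h⟩ := ih (.pair (.comp f .p1) .p2)
    refine ⟨pg', fun i x => ?_⟩
    simp only [Sem, h, pev, p1_prm, p2_prm]

mutual
theorem rep_sig : ∀ {k m : ℕ} {φ : LA.BoundedFormula Empty m}, IsSigmaFml k φ →
    ∃ pg : Pg, ∀ (i : Mdl) (v : Fin m → i.C), φ.Realize default v ↔ Sem k pg (tup v)
  | _, _, _, .ofDelta0 h => rep_d0 h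
  | _, _, _, .ofPi (k := k) h => by
    obtain ⟨p, hp⟩ := rep_pi h
    obtain ⟨q, hq⟩ := reidx k p .p1
    refine ⟨q, fun i v => ?_⟩
    simp [Sem, hq, pev, hp]
  | _, _, _, .ex (k := k) h => by
    obtain ⟨p, hp⟩ := rep_sig h
    obtain ⟨q, hq⟩ := reidx k p (.pair (.pair .p1 (.comp .p1 .p2)) (.comp .p2 .p2))
    refine ⟨q, fun i v => ?_⟩
    simp only [BoundedFormula.realize_ex, hp, Sem, hq, pev, tup_snoc]
    constructor
    · rintro ⟨a, y, h⟩
      exact ⟨prm a y, by simpa using h⟩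
    · rintro ⟨z, h⟩
      exact ⟨p1 z, p2 z, by simpa using h⟩
theorem rep_pi : ∀ {k m : ℕ} {φ : LA.BoundedFormula Empty m}, IsPiFml k φ →
    ∃ pg : Pg, ∀ (i : Mdl) (v : Fin m → i.C), φ.Realize default v ↔ ¬ Sem k pg (tup v)
  | _, _, _, .ofDelta0 h => by
    obtain ⟨p, hp⟩ := rep_d0 h
    refine ⟨p.n, fun i v => ?_⟩
    simp [Sem, hp, pev_n]
  | _, _, _, .ofSigma (k := k) h => by
    obtain ⟨p, hp⟩ := rep_sig h
    obtain ⟨q, hq⟩ := reidx k p .p1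
    refine ⟨q, fun i v => ?_⟩
    simp [Sem, hq, pev, hp]
  | _, _, _, .all (k := k) h => by
    obtain ⟨p, hp⟩ := rep_pi h
    obtain ⟨q, hq⟩ := reidx k p (.pair (.pair .p1 (.comp .p1 .p2)) (.comp .p2 .p2))
    refine ⟨q, fun i v => ?_⟩
    simp only [BoundedFormula.realize_all, hp, Sem, hq, pev, tup_snoc]
    push Not
    constructor
    · intro h z
      simpa using h (p1 z) (p2 z)
    · intro h a y
      simpa using h (prm a y)
end

/-- numerals in tuples -/
theorem abs_term {k : ℕ} (t : LA.Term (Empty ⊕ Fin k)) (i : Mdl) (v : Fin k → ℕ) :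
    t.realize (Sum.elim default (fun j => (v j : i.C))) = ((t.realize (Sum.elim default v) : ℕ) : i.C) := by
  induction t with
  | var x =>
    rcases x with x | j
    · exact x.elim
    · rfl
  | @func l f ts ih =>
    match l, f with
    | 0, f =>
      simp only [Term.realize]
      exact (Cmp.c_zero (M := i.C) _).trans (Nat.cast_zero.symm.trans (congrArg _ (Cmp.c_zero (M := ℕ) _).symm))
    | 1, f =>
      simp only [Term.realize, ih]
      refine (Cmp.c_succ (M := i.C) _).trans (Eq.trans ?_ (congrArg _ (Cmp.c_succ (M := ℕ) _).symm))
      simp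
    | 2, false =>
      simp only [Term.realize, ih]
      refine (Cmp.c_add (M := i.C) _).trans (Eq.trans ?_ (congrArg _ (Cmp.c_add (M := ℕ) _).symm))
      simp
    | 2, true =>
      simp only [Term.realize, ih]
      refine (Cmp.c_mul (M := i.C) _).trans (Eq.trans ?_ (congrArg _ (Cmp.c_mul (M := ℕ) _).symm))
      simp
    | l+3, f => exact (show Empty from f).elim

theorem cast_snoc {k : ℕ} (i : Mdl) (v : Fin k → ℕ) (a : ℕ) :
    (Fin.snoc (fun j => (v j : i.C)) (a : i.C) : Fin (k+1) → i.C) =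
      fun j => (((Fin.snoc v a : Fin (k+1) → ℕ) j : ℕ) : i.C) := by
  funext j; refine Fin.lastCases ?_ (fun j => ?_) j <;> simp

theorem abs_d0 {k : ℕ} {φ : LA.BoundedFormula Empty k} (h : IsDelta0 φ) (i : Mdl) (v : Fin k → ℕ) :
    φ.Realize default (fun j => (v j : i.C)) ↔ φ.Realize default v := by
  induction h with
  | falsum => simp
  | equal t u => simp [abs_term]
  | le t u => simp [abs_term]
  | imp _ _ h1 h2 => simp [h1, h2]
  | ball t _ h =>
    simp only [BoundedFormula.realize_all, BoundedFormula.realize_imp, real_leF, real_vT, real_rlb,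
      Fin.snoc_last, Fin.snoc_castSucc, abs_term]
    constructor
    · intro H a ha
      have := H (a : i.C) (by exact_mod_cast ha)
      rwa [cast_snoc, h] at this
    · intro H a ha
      obtain ⟨a, h1, rfl⟩ := le_natCast ha
      rw [cast_snoc, h]
      exact H a h1
  | bex t _ h =>
    simp only [BoundedFormula.realize_ex, BoundedFormula.realize_inf, real_leF, real_vT, real_rlb,
      Fin.snoc_last, Fin.snoc_castSucc, abs_term]
    constructor
    · rintro ⟨a, ha, H⟩
      obtain ⟨a, h1, rfl⟩ := le_natCast ha
      rw [cast_snoc, h] at H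
      exact ⟨a, h1, H⟩
    · rintro ⟨a, ha, H⟩
      exact ⟨a, by exact_mod_cast ha, by rw [cast_snoc, h]; exact H⟩

theorem hh_abs (i : Mdl) (e x z : ℕ) : HH (e : i.C) (x : i.C) (z : i.C) ↔ HH e x z := by
  have hd : Del0 (ι := Mdl) (𝓜 := Mdl.C) (fun i v => HH (v 0) (v 1) (v 2) (M := i.C)) (k := 3) :=
    Del0.hh fdt fdt fdt
  obtain ⟨φ, h0, h⟩ := hd
  have h1 := h i (fun j => ((![e,x,z] j : ℕ) : i.C))
  have h2 : φ.Realize (default : Empty → ℕ) ![e,x,z] ↔ HH e x z := by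
    have := h Mdl.N ![e,x,z]
    rw [Subsingleton.elim (default : Empty → ℕ) (@default (Empty → Mdl.N.C) Unique.instInhabited)]
    exact this
  have h3 := abs_d0 h0 i ![e,x,z]
  exact (h1.symm.trans h3).trans h2



/-! ### Σ₁ predicates on the natural numbers -/

/-- Σ₁ predicates of ℕ -/
def S1 {k : ℕ} (P : (Fin k → ℕ) → Prop) : Prop := SigF (ι := Unit) (𝓜 := fun _ => ℕ) 1 (fun _ v => P v)
/-- Functions with Σ₁ graph -/
def Fn1 {k : ℕ} (f : (Fin k → ℕ) → ℕ) : Prop :=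
  S1 (fun v : Fin (k+1) → ℕ => v (Fin.last k) = f (ini v))
/-- variable projections -/
def NVr {m k : ℕ} (g : (Fin m → ℕ) → (Fin k → ℕ)) : Prop := ∃ ρ : Fin k → Fin m, ∀ v, g v = fun j => v (ρ j)

theorem NVr.id {m : ℕ} : NVr (fun (v : Fin m → ℕ) => v) := ⟨fun j => j, fun _ => rfl⟩
theorem NVr.ini {m k : ℕ} {g : (Fin m → ℕ) → (Fin (k+1) → ℕ)} (h : NVr g) :
    NVr (fun v => ini (g v)) := by
  obtain ⟨ρ, h⟩ := h
  exact ⟨fun j => ρ j.castSucc, fun v => by funext j; simp [Guaspari.ini, h]⟩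
theorem NVr.snoc {m k l : ℕ} {g : (Fin m → ℕ) → (Fin k → ℕ)} (h : NVr g)
    {g' : (Fin m → ℕ) → (Fin l → ℕ)} (h' : NVr g') (j : Fin l) :
    NVr (k := k+1) (fun v => (Fin.snoc (g v) (g' v j) : Fin (k+1) → ℕ)) := by
  obtain ⟨ρ, h⟩ := h
  obtain ⟨ρ', h'⟩ := h'
  refine ⟨Fin.snoc (α := fun _ => Fin m) ρ (ρ' j), fun v => ?_⟩
  funext j'
  refine Fin.lastCases ?_ (fun j => ?_) j' <;> simp [h, h']

section
variable {k m : ℕ}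

theorem S1.of_iff {P Q : (Fin k → ℕ) → Prop} (h : S1 P) (e : ∀ v, Q v ↔ P v) : S1 Q :=
  SigF.of_iff h fun _ v => e v
theorem S1.d0 {P : (Fin k → ℕ) → Prop} (h : Del0 (ι := Unit) (𝓜 := fun _ => ℕ) (fun _ v => P v)) : S1 P :=
  h.sig
theorem S1.and {P Q : (Fin k → ℕ) → Prop} (h : S1 P) (h' : S1 Q) : S1 (fun v => P v ∧ Q v) := SigF.and h h'
theorem S1.or {P Q : (Fin k → ℕ) → Prop} (h : S1 P) (h' : S1 Q) : S1 (fun v => P v ∨ Q v) := SigF.or h h'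
theorem S1.ex {P : (Fin k → ℕ) → ℕ → Prop}
    (h : S1 (fun v : Fin (k+1) → ℕ => P (ini v) (v (Fin.last k)))) : S1 (fun v => ∃ y, P v y) :=
  SigF.ex (P := fun _ v y => P v y) h
theorem S1.ren {P : (Fin m → ℕ) → Prop} (ρ : Fin m → Fin k) (h : S1 P) :
    S1 (fun (v : Fin k → ℕ) => P (fun j => v (ρ j))) := SigF.ren ρ h
theorem S1.vr {P : (Fin m → ℕ) → Prop} {g : (Fin k → ℕ) → (Fin m → ℕ)} (hg : NVr g) (h : S1 P) :
    S1 (fun v => P (g v)) := by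
  obtain ⟨ρ, hρ⟩ := hg
  simpa only [hρ] using h.ren ρ
theorem Fn1.ren {f : (Fin m → ℕ) → ℕ} (ρ : Fin m → Fin k) (h : Fn1 f) :
    Fn1 (fun (v : Fin k → ℕ) => f (fun j => v (ρ j))) := by
  refine (S1.ren (k := k+1) (lft ρ) h).of_iff fun v => ?_
  conv_rhs => rw [← snoc_ini v, snoc_lft]
  simp
theorem Fn1.vr {f : (Fin m → ℕ) → ℕ} {g : (Fin k → ℕ) → (Fin m → ℕ)} (hg : NVr g) (h : Fn1 f) :
    Fn1 (fun v => f (g v)) := by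
  obtain ⟨ρ, hρ⟩ := hg
  simpa only [hρ] using h.ren ρ
theorem S1.comp {P : (Fin m → ℕ) → Prop} (hP : S1 P) (f : Fin m → (Fin k → ℕ) → ℕ) (hf : ∀ j, Fn1 (f j)) :
    S1 (fun v => P (fun j => f j v)) := by
  refine comp_gen (ι := Unit) (𝓜 := fun _ => ℕ) (fun P => S1 (P ())) (fun P => Fn1 (P ()))
    (fun P ρ h => h.ren ρ) (fun {m k} P ρ h => h.ren ρ) (fun {k} P f hP hf => ?_) (fun _ => P) hP
    (fun j _ => f j) hf
  refine (S1.ex (P := fun v y => y = f () v ∧ P () (Fin.snoc v y)) (S1.and hf ?_)).of_iff ?_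
  · simpa only [snoc_ini] using hP
  · intro v; simp
theorem S1.comp1 {P : ℕ → Prop} (hP : S1 (fun v : Fin 1 → ℕ => P (v 0)))
    {f : (Fin k → ℕ) → ℕ} (hf : Fn1 f) : S1 (fun v => P (f v)) :=
  hP.comp ![f] (by intro j; fin_cases j; exact hf)
theorem S1.comp2 {P : ℕ → ℕ → Prop} (hP : S1 (fun v : Fin 2 → ℕ => P (v 0) (v 1)))
    {f g : (Fin k → ℕ) → ℕ} (hf : Fn1 f) (hg : Fn1 g) : S1 (fun v => P (f v) (g v)) :=
  hP.comp ![f, g] (by intro j; fin_cases j; exacts [hf, hg])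
theorem S1.comp3 {P : ℕ → ℕ → ℕ → Prop} (hP : S1 (fun v : Fin 3 → ℕ => P (v 0) (v 1) (v 2)))
    {f g h : (Fin k → ℕ) → ℕ} (hf : Fn1 f) (hg : Fn1 g) (hh : Fn1 h) : S1 (fun v => P (f v) (g v) (h v)) :=
  hP.comp ![f, g, h] (by intro j; fin_cases j; exacts [hf, hg, hh])
theorem Fn1.fd {f : (Fin k → ℕ) → ℕ} (h : Fd (ι := Unit) (𝓜 := fun _ => ℕ) (fun _ v => f v)) : Fn1 f :=
  S1.d0 h.choose_spec.2.2
theorem Fn1.var {g : (Fin m → ℕ) → (Fin k → ℕ)} (h : NVr g) (j : Fin k) : Fn1 (fun v => g v j) :=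
  Fn1.vr h (Fn1.fd (Fd.var FVr.id j))
theorem Fn1.const (c : ℕ) : Fn1 (fun _ : Fin k → ℕ => c) := by
  refine Fn1.fd ?_
  simpa using Fd.cast (ι := Unit) (𝓜 := fun _ => ℕ) c
theorem S1.eq {f g : (Fin k → ℕ) → ℕ} (hf : Fn1 f) (hg : Fn1 g) : S1 (fun v => f v = g v) :=
  S1.comp2 (P := fun x y => x = y) (S1.d0 d0t) hf hg
theorem S1.ne {f g : (Fin k → ℕ) → ℕ} (hf : Fn1 f) (hg : Fn1 g) : S1 (fun v => ¬ f v = g v) :=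
  S1.comp2 (P := fun x y => ¬ x = y) (S1.d0 d0t) hf hg
theorem S1.le {f g : (Fin k → ℕ) → ℕ} (hf : Fn1 f) (hg : Fn1 g) : S1 (fun v => f v ≤ g v) :=
  S1.comp2 (P := fun x y => x ≤ y) (S1.d0 d0t) hf hg
theorem S1.lt {f g : (Fin k → ℕ) → ℕ} (hf : Fn1 f) (hg : Fn1 g) : S1 (fun v => f v < g v) :=
  S1.comp2 (P := fun x y => x < y) (S1.d0 (Del0.lt fdt fdt)) hf hg
theorem S1.mem {f g : (Fin k → ℕ) → ℕ} (hf : Fn1 f) (hg : Fn1 g) : S1 (fun v => Mem (f v) (g v)) :=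
  S1.comp2 (P := fun x y => Mem x y) (S1.d0 d0t) hf hg
theorem S1.nmem {f g : (Fin k → ℕ) → ℕ} (hf : Fn1 f) (hg : Fn1 g) : S1 (fun v => ¬ Mem (f v) (g v)) :=
  S1.comp2 (P := fun x y => ¬ Mem x y) (S1.d0 d0t) hf hg
theorem Fn1.comp1 {F : ℕ → ℕ} (hF : Fn1 (fun v : Fin 1 → ℕ => F (v 0)))
    {f : (Fin k → ℕ) → ℕ} (hf : Fn1 f) : Fn1 (fun v => F (f v)) :=
  S1.comp2 (P := fun x y => x = F y) (S1.ren (k := 2) ![1, 0] hF) (Fn1.var NVr.id (Fin.last k))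
    (hf.vr (NVr.ini NVr.id))
theorem Fn1.comp2 {F : ℕ → ℕ → ℕ} (hF : Fn1 (fun v : Fin 2 → ℕ => F (v 0) (v 1)))
    {f g : (Fin k → ℕ) → ℕ} (hf : Fn1 f) (hg : Fn1 g) : Fn1 (fun v => F (f v) (g v)) :=
  S1.comp3 (P := fun x y z => x = F y z) (S1.ren (k := 3) ![1, 2, 0] hF) (Fn1.var NVr.id (Fin.last k))
    (hf.vr (NVr.ini NVr.id)) (hg.vr (NVr.ini NVr.id))
theorem Fn1.add {f g : (Fin k → ℕ) → ℕ} (hf : Fn1 f) (hg : Fn1 g) : Fn1 (fun v => f v + g v) :=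
  Fn1.comp2 (F := fun x y => x + y) (Fn1.fd fdt) hf hg
theorem Fn1.mul {f g : (Fin k → ℕ) → ℕ} (hf : Fn1 f) (hg : Fn1 g) : Fn1 (fun v => f v * g v) :=
  Fn1.comp2 (F := fun x y => x * y) (Fn1.fd fdt) hf hg
theorem Fn1.prm {f g : (Fin k → ℕ) → ℕ} (hf : Fn1 f) (hg : Fn1 g) : Fn1 (fun v => prm (f v) (g v)) :=
  Fn1.comp2 (F := fun x y => Guaspari.prm x y) (Fn1.fd fdt) hf hg
theorem Fn1.p1 {f : (Fin k → ℕ) → ℕ} (hf : Fn1 f) : Fn1 (fun v => p1 (f v)) :=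
  Fn1.comp1 (F := fun x => Guaspari.p1 x) (Fn1.fd fdt) hf
theorem Fn1.p2 {f : (Fin k → ℕ) → ℕ} (hf : Fn1 f) : Fn1 (fun v => p2 (f v)) :=
  Fn1.comp1 (F := fun x => Guaspari.p2 x) (Fn1.fd fdt) hf
theorem Fn1.pair {f g : (Fin k → ℕ) → ℕ} (hf : Fn1 f) (hg : Fn1 g) : Fn1 (fun v => Nat.pair (f v) (g v)) := by
  refine Fn1.comp2 (F := fun x y => Nat.pair x y) ?_ hf hg
  refine S1.of_iff (P := fun v : Fin 3 → ℕ => (v 0 < v 1 ∧ v 2 = v 1 * v 1 + v 0) ∨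
    (v 1 ≤ v 0 ∧ v 2 = v 0 * v 0 + v 0 + v 1)) (S1.or (S1.and (S1.lt (Fn1.var NVr.id _) (Fn1.var NVr.id _))
      (S1.d0 d0t)) (S1.d0 d0t)) fun v => ?_
  show v 2 = Nat.pair (v 0) (v 1) ↔ _
  unfold Nat.pair
  split_ifs with h <;> grind
theorem S1.ball {f : (Fin k → ℕ) → ℕ} {P : (Fin k → ℕ) → ℕ → Prop}
    (hf : Fn1 f) (h : S1 (fun v : Fin (k+1) → ℕ => P (ini v) (v (Fin.last k)))) :
    S1 (fun v => ∀ y, y ≤ f v → P v y) := by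
  refine S1.of_iff (P := fun v => ∃ b, b = f v ∧ ∀ y, y ≤ b → P v y) (S1.ex (S1.and hf ?_)) fun v => by simp
  refine SigF.ball (𝓜 := fun _ => ℕ) (P := fun _ v y => P (ini v) y) (f := fun _ v => v (Fin.last k)) fdt ?_
  exact S1.vr (g := fun v : Fin (k+2) → ℕ => (Fin.snoc (ini (ini v)) (v (Fin.last _)) : Fin (k+1) → ℕ))
    (NVr.snoc (NVr.ini (NVr.ini NVr.id)) NVr.id _) h |>.of_iff fun v => by simp
theorem S1.blt {f : (Fin k → ℕ) → ℕ} {P : (Fin k → ℕ) → ℕ → Prop}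
    (hf : Fn1 f) (h : S1 (fun v : Fin (k+1) → ℕ => P (ini v) (v (Fin.last k)))) :
    S1 (fun v => ∀ y, y < f v → P v y) := by
  refine (S1.ball hf (P := fun v y => y = f v ∨ P v y) (S1.or (S1.eq (Fn1.var NVr.id _) (hf.vr (NVr.ini NVr.id))) h)).of_iff
    fun v => ⟨fun h y hy => ?_, fun h y hy => ?_⟩
  · rcases hy.lt_or_eq with hy | hy
    exacts [.inr (h y hy), .inl hy]
  · rcases h y hy.le with h | h
    exacts [absurd h hy.ne, h]
theorem S1.tru : S1 (fun _ : Fin k → ℕ => True) := S1.d0 d0t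
theorem S1.fls : S1 (fun _ : Fin k → ℕ => False) := S1.d0 d0t
/-- implication with decidable antecedent -/
theorem S1.imp {P Q : (Fin k → ℕ) → Prop} (h : S1 (fun v => ¬ P v)) (h' : S1 Q) : S1 (fun v => P v → Q v) :=
  (h.or h').of_iff fun v => by tauto
end

theorem nvt {p : Prop} (h : p := by repeat' (first | exact NVr.id | apply NVr.ini | apply NVr.snoc)) : p := h
theorem fnt {p : Prop} (h : p := by
  repeat' (first
    | exact Fn1.const _ | apply Fn1.prm | apply Fn1.pair | apply Fn1.p1 | apply Fn1.p2 | apply Fn1.add | apply Fn1.mul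
    | (refine Fn1.var ?_ _; exact nvt))) : p := h
theorem s1t {p : Prop} (h : p := by
  repeat' (first
    | exact S1.tru | exact S1.fls
    | apply S1.and | apply S1.or
    | (refine S1.eq ?_ ?_; exact fnt; exact fnt) | (refine S1.ne ?_ ?_; exact fnt; exact fnt)
    | (refine S1.lt ?_ ?_; exact fnt; exact fnt)
    | (refine S1.le ?_ ?_; exact fnt; exact fnt) | (refine S1.mem ?_ ?_; exact fnt; exact fnt)
    | (refine S1.nmem ?_ ?_; exact fnt; exact fnt)
    | (refine S1.blt ?_ ?_; exact fnt) | (refine S1.ball ?_ ?_; exact fnt) | apply S1.ex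
    | apply S1.imp)) : p := h

/-- universality -/
theorem S1.univ {P : ℕ → Prop} (h : S1 (fun v : Fin 1 → ℕ => P (v 0))) :
    ∃ e : ℕ, ∀ x, P x ↔ ∃ z, HH e (prm 0 x) z := by
  obtain ⟨⟨φ, h0, h1⟩, _⟩ := SigF.fml h
  obtain ⟨pg, h2⟩ := rep_sig h0
  refine ⟨pg.code, fun x => ?_⟩
  have h3 := h2 Mdl.N (fun _ => x)
  have h4 := tr_sem (M := ℕ) 0 pg (prm 0 x)
  refine (h1 () (fun _ => x)).symm.trans ?_
  refine Iff.trans ?_ (h3.trans h4.symm)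
  exact Iff.rfl

/-! inductive definitions -/
/-- finitary inductive definitions with at most two premises -/
inductive Der (A : ℕ → Prop) (R : ℕ → ℕ → ℕ → Prop) : ℕ → Prop
  | ax {x : ℕ} : A x → Der A R x
  | st {x l r : ℕ} : Der A R l → Der A R r → R x l r → Der A R x

theorem fin_code (F : Finset ℕ) : ∃ s : ℕ, ∀ x, Mem x s ↔ x ∈ F := by
  have : Dp (fun v : Fin 1 → ℕ => v 0 ∈ F) := by
    induction F using Finset.induction with
    | empty => simpa using Dp.prop False
    | insert a F _ ih =>
      simp only [Finset.mem_insert]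
      exact Dp.or (Dp.eq tpt (Tp.const _)) ih
  obtain ⟨s, _, h⟩ := compr this (F.sup id + 1)
  refine ⟨s, fun x => (h x).trans ⟨fun h => h.2, fun h => ⟨?_, h⟩⟩⟩
  exact Nat.lt_succ_of_le (Finset.le_sup (f := id) h)

/-- closed finite sets of ranked elements -/
def DGood (A : ℕ → Prop) (R : ℕ → ℕ → ℕ → Prop) (F : ℕ → Prop) : Prop :=
  ∀ y, F y → A (p2 y) ∨ ∃ l r, F l ∧ F r ∧ p1 l < p1 y ∧ p1 r < p1 y ∧ R (p2 y) (p2 l) (p2 r)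

theorem der_iff (A : ℕ → Prop) (R : ℕ → ℕ → ℕ → Prop) (x : ℕ) :
    Der A R x ↔ ∃ s, (∃ r, Mem (prm r x) s) ∧ DGood A R (fun y => Mem y s) := by
  constructor
  · intro h
    suffices h : ∃ F : Finset ℕ, (∃ r, prm r x ∈ F) ∧ DGood A R (· ∈ F) by
      obtain ⟨F, h1, h2⟩ := h
      obtain ⟨s, hs⟩ := fin_code F
      refine ⟨s, by simpa only [hs] using h1, by simpa only [hs] using h2⟩
    induction h with
    | @ax x h =>
      refine ⟨{prm 0 x}, ⟨0, by simp⟩, fun y hy => .inl ?_⟩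
      simp only [Finset.mem_singleton] at hy
      subst hy; simpa using h
    | @st x l r h1 h2 hR ih1 ih2 =>
      obtain ⟨F, ⟨a, ha⟩, hF⟩ := ih1
      obtain ⟨G, ⟨b, hb⟩, hG⟩ := ih2
      refine ⟨insert (prm (a + b + 1) x) (F ∪ G), ⟨_, Finset.mem_insert_self _ _⟩, fun y hy => ?_⟩
      simp only [Finset.mem_insert, Finset.mem_union] at hy ⊢
      rcases hy with rfl | hy | hy
      · refine .inr ⟨prm a l, prm b r, .inr (.inl ha), .inr (.inr hb), ?_, ?_, ?_⟩
        · simp only [p1_prm]; omega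
        · simp only [p1_prm]; omega
        · simpa using hR
      · rcases hF y hy with h | ⟨l, r, h1, h2, h3⟩
        exacts [.inl h, .inr ⟨l, r, .inr (.inl h1), .inr (.inl h2), h3⟩]
      · rcases hG y hy with h | ⟨l, r, h1, h2, h3⟩
        exacts [.inl h, .inr ⟨l, r, .inr (.inr h1), .inr (.inr h2), h3⟩]
  · rintro ⟨s, ⟨r, hr⟩, h⟩
    have key : ∀ n y, p1 y < n → Mem y s → Der A R (p2 y) := by
      intro n
      induction n with
      | zero => intro y hy; exact absurd hy (Nat.not_lt_zero _)
      | succ n ih =>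
        intro y hy hm
        rcases h y hm with h | ⟨l, r, h1, h2, h3, h4, h5⟩
        · exact .ax h
        · exact .st (ih l (by omega) h1) (ih r (by omega) h2) h5
    simpa using key _ _ (Nat.lt_succ_self _) hr

theorem S1.der {A : ℕ → Prop} {R : ℕ → ℕ → ℕ → Prop} (hA : S1 (fun v : Fin 1 → ℕ => A (v 0)))
    (hR : S1 (fun v : Fin 3 → ℕ => R (v 0) (v 1) (v 2))) {k : ℕ} {f : (Fin k → ℕ) → ℕ} (hf : Fn1 f) :
    S1 (fun v => Der A R (f v)) := by
  refine S1.comp1 (P := fun x => Der A R x) ?_ hf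
  refine S1.of_iff (P := fun v : Fin 1 → ℕ => ∃ s, (∃ r, Mem (prm r (v 0)) s) ∧
    ∀ y, y ≤ s → Mem y s → (A (p2 y) ∨ ∃ l r, Mem l s ∧ Mem r s ∧ p1 l < p1 y ∧ p1 r < p1 y ∧ R (p2 y) (p2 l) (p2 r))) ?_ ?_
  · refine S1.ex (S1.and s1t (S1.ball fnt (S1.imp s1t (S1.or (S1.comp1 hA fnt) ?_))))
    refine S1.ex (S1.ex (S1.and s1t (S1.and s1t (S1.and s1t (S1.and s1t ?_)))))
    exact S1.comp3 hR fnt fnt fnt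
  · intro v
    rw [der_iff]
    refine exists_congr fun s => and_congr_right fun _ => ⟨fun h y _ hy => h y hy, fun h y hy => h y hy.lt.le hy⟩



theorem partrec_s1 {f : ℕ →. ℕ} (h : Nat.Partrec f) : S1 (fun v : Fin 2 → ℕ => v 1 ∈ f (v 0)) := by
  induction h with
  | zero => exact S1.of_iff (P := fun v => v 1 = 0) s1t fun v => by simp [pure, PFun.pure]
  | succ => exact S1.of_iff (P := fun v => v 1 = v 0 + 1) s1t fun v => by simp
  | left =>
    refine S1.of_iff (P := fun v => ∃ b, v 0 = Nat.pair (v 1) b) s1t fun v => ?_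
    simp only [PFun.coe_val, Part.mem_some_iff]
    constructor
    · intro h; exact ⟨(v 0).unpair.2, by rw [h, Nat.pair_unpair]⟩
    · rintro ⟨b, h⟩; rw [h, Nat.unpair_pair]
  | right =>
    refine S1.of_iff (P := fun v => ∃ b, v 0 = Nat.pair b (v 1)) s1t fun v => ?_
    simp only [PFun.coe_val, Part.mem_some_iff]
    constructor
    · intro h; exact ⟨(v 0).unpair.1, by rw [h, Nat.pair_unpair]⟩
    · rintro ⟨b, h⟩; rw [h, Nat.unpair_pair]
  | @pair f g _ _ hf hg =>
    refine S1.of_iff (P := fun v => ∃ a b, v 1 = Nat.pair a b ∧ a ∈ f (v 0) ∧ b ∈ g (v 0)) ?_ fun v => ?_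
    · exact S1.ex (S1.ex (S1.and s1t (S1.and (S1.comp2 (P := fun x y => y ∈ f x) hf fnt fnt)
        (S1.comp2 (P := fun x y => y ∈ g x) hg fnt fnt))))
    · simp only [Seq.seq, Part.mem_bind_iff, Part.map_eq_map, Part.mem_map_iff]
      constructor
      · rintro ⟨_, ⟨a, ha, rfl⟩, b, hb, h⟩; exact ⟨a, b, h.symm, ha, hb⟩
      · rintro ⟨a, b, h, ha, hb⟩; exact ⟨_, ⟨a, ha, rfl⟩, b, hb, h.symm⟩
  | @comp f g _ _ hf hg =>
    refine S1.of_iff (P := fun v => ∃ a, a ∈ g (v 0) ∧ v 1 ∈ f a) ?_ fun v => Part.mem_bind_iff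
    exact S1.ex (S1.and (S1.comp2 (P := fun x y => y ∈ g x) hg fnt fnt)
        (S1.comp2 (P := fun x y => y ∈ f x) hf fnt fnt))
  | @prec f g _ _ hf hg =>
    let A : ℕ → Prop := fun x => p1 (p2 x) = 0 ∧ p2 (p2 x) ∈ f (p1 x)
    let R : ℕ → ℕ → ℕ → Prop := fun x l r => p1 l = p1 x ∧ p1 (p2 x) = p1 (p2 l) + 1 ∧
      p2 (p2 x) ∈ g (Nat.pair (p1 x) (Nat.pair (p1 (p2 l)) (p2 (p2 l))))
    have hA : S1 (fun v : Fin 1 → ℕ => A (v 0)) := S1.and s1t (S1.comp2 (P := fun x y => y ∈ f x) hf fnt fnt)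
    have hR : S1 (fun v : Fin 3 → ℕ => R (v 0) (v 1) (v 2)) :=
      S1.and s1t (S1.and s1t (S1.comp2 (P := fun x y => y ∈ g x) hg fnt fnt))
    let F : ℕ → ℕ → Part ℕ := fun a n => Nat.rec (f a) (fun y IH => IH.bind fun i => g (Nat.pair a (Nat.pair y i))) n
    have key : ∀ x, Der A R x ↔ p2 (p2 x) ∈ F (p1 x) (p1 (p2 x)) := by
      intro x
      constructor
      · intro h
        induction h with
        | ax h => obtain ⟨h1, h2⟩ := h; rw [h1]; exact h2
        | st _ _ h ih _ =>
          obtain ⟨h1, h2, h3⟩ := h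
          rw [h2]
          rw [h1] at ih
          exact Part.mem_bind_iff.2 ⟨_, ih, h3⟩
      · have : ∀ n a y, y ∈ F a n → Der A R (prm a (prm n y)) := by
          intro n
          induction n with
          | zero => intro a y h; exact .ax ⟨by simp, by simp only [p1_prm, p2_prm]; exact h⟩
          | succ n ih =>
            intro a y h
            obtain ⟨i, h1, h2⟩ := Part.mem_bind_iff.1 h
            exact .st (ih _ _ h1) (ih _ _ h1) ⟨by simp, by simp, by simpa using h2⟩
        intro h
        by_cases h0 : p1 (p2 x) = 0
        · rw [h0] at h; exact .ax ⟨h0, h⟩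
        · obtain ⟨n, hn⟩ := Nat.exists_eq_succ_of_ne_zero h0
          rw [hn] at h
          obtain ⟨i, h1, h2⟩ := Part.mem_bind_iff.1 h
          exact .st (this _ _ _ h1) (this _ _ _ h1) ⟨by simp, by simp [hn], by simpa using h2⟩
    refine S1.of_iff (P := fun v => ∃ a n, v 0 = Nat.pair a n ∧ Der A R (prm a (prm n (v 1)))) ?_ fun v => ?_
    · exact S1.ex (S1.ex (S1.and s1t (S1.der hA hR fnt)))
    · simp only [key, p1_prm, p2_prm]
      constructor
      · intro h; exact ⟨_, _, (Nat.pair_unpair _).symm, h⟩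
      · rintro ⟨a, n, h, h'⟩
        rw [h]; simpa [Nat.unpaired] using h'
  | @rfind f _ hf =>
    refine S1.of_iff (P := fun v => 0 ∈ f (Nat.pair (v 0) (v 1)) ∧ ∀ m, m < v 1 → ∃ z, ¬ z = 0 ∧
      z ∈ f (Nat.pair (v 0) m)) ?_ fun v => ?_
    · exact S1.and (S1.comp2 (P := fun x y => y ∈ f x) hf fnt fnt) (S1.blt fnt (S1.ex (S1.and s1t
        (S1.comp2 (P := fun x y => y ∈ f x) hf fnt fnt))))
    · refine (Nat.mem_rfind (p := fun n => Part.map (fun m => decide (m = 0)) (f (Nat.pair (v 0) n)))).trans ?_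
      refine and_congr (by simp) (forall_congr' fun m => forall_congr' fun _ => ?_)
      simp only [Part.map_eq_map, Part.mem_map_iff]
      refine exists_congr fun z => ?_
      simp [and_comm]

theorem re_s1 {p : ℕ → Prop} (h : REPred p) : S1 (fun v : Fin 1 → ℕ => p (v 0)) := by
  have h1 : Nat.Partrec _ := h
  refine ((partrec_s1 h1).comp ![fun v => v 0, fun v => 0] (k := 1) ?_).of_iff ?_
  · intro j; fin_cases j <;> exact fnt
  · intro v
    simp
    exact fun _ => ⟨(), rfl⟩

theorem comp_s1 {p : ℕ → Prop} (h : ComputablePred p) : S1 (fun v : Fin 1 → ℕ => p (v 0)) := re_s1 h.to_re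



/-! ### codes of terms and formulas, and their semantics -/

/-- codes of terms -/
def gnT {k : ℕ} : LA.Term (Empty ⊕ Fin k) → ℕ
  | .var (.inl x) => x.elim
  | .var (.inr i) => prm 1 (i : ℕ)
  | @Term.func _ _ 0 f ts => prm 2 0
  | @Term.func _ _ 1 f ts => prm 3 (gnT (ts 0))
  | @Term.func _ _ 2 f ts => cond (show Bool from f) (prm 5 (prm (gnT (ts 0)) (gnT (ts 1))))
      (prm 4 (prm (gnT (ts 0)) (gnT (ts 1))))
  | @Term.func _ _ (_+3) f ts => 0

/-- codes of formulas -/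
def gn {k : ℕ} : LA.BoundedFormula Empty k → ℕ
  | .falsum => prm 6 0
  | .equal t u => prm 7 (prm (gnT t) (gnT u))
  | @BoundedFormula.rel _ _ _ 2 R ts => prm 8 (prm (gnT (ts 0)) (gnT (ts 1)))
  | @BoundedFormula.rel _ _ _ _ R ts => 0
  | .imp φ ψ => prm 9 (prm (gn φ) (gn ψ))
  | .all φ => prm 10 (gn φ)

theorem dec0 {c n : ℕ} (h : c = prm (n+1) (p2 c)) : p2 c < c := by
  have : p2 c < prm (n+1) (p2 c) := by
    simp only [prm]; nlinarith
  rwa [← h] at this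

theorem dec1 {c n : ℕ} (h : c = prm (n+1) (p2 c)) : p1 (p2 c) < c := lt_of_le_of_lt (p1_le _) (dec0 h)
theorem dec2 {c n : ℕ} (h : c = prm (n+1) (p2 c)) : p2 (p2 c) < c := lt_of_le_of_lt (p2_le _) (dec0 h)
theorem dec3 {c n : ℕ} (h : c = prm (n+1) (p2 c)) : p2 (p2 (p2 c)) < c := lt_of_le_of_lt (p2_le _) (dec2 h)
theorem dec4 {c n : ℕ} (h : c = prm (n+1) (p2 c)) : p2 (p1 (p2 c)) < c := lt_of_le_of_lt (p2_le _) (dec1 h)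

theorem upd_snoc {M : Type} (α : ℕ → M) (k : ℕ) (x : M) :
    (fun j : Fin (k+1) => Function.update α k x j) = (Fin.snoc (fun j : Fin k => α j) x : Fin (k+1) → M) := by
  funext j
  refine Fin.lastCases ?_ (fun j => ?_) j
  · simp
  · simp [Function.update, j.2.ne]

section sem
variable {M : Type} [CommSemiring M] [LinearOrder M] [IsStrictOrderedRing M]
    [CanonicallyOrderedAdd M] [LA.Structure M] [PAM M] {k m : ℕ}

/-- value of a term code -/
noncomputable def val (α : ℕ → M) (c : ℕ) : M :=
  if h : c = prm (0+1) (p2 c) then α (p2 c)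
  else if h : c = prm (2+1) (p2 c) then val α (p2 c) + 1
  else if h : c = prm (3+1) (p2 c) then val α (p1 (p2 c)) + val α (p2 (p2 c))
  else if h : c = prm (4+1) (p2 c) then val α (p1 (p2 c)) * val α (p2 (p2 c))
  else 0
termination_by c
decreasing_by
  · exact dec0 h
  · exact dec1 h
  · exact dec2 h
  · exact dec1 h
  · exact dec2 h

theorem val_var (α : ℕ → M) (i : ℕ) : val α (prm 1 i) = α i := by rw [val]; simp
theorem val_zero (α : ℕ → M) : val α (prm 2 0) = 0 := by rw [val]; simp [prm_inj]
theorem val_succ (α : ℕ → M) (t : ℕ) : val α (prm 3 t) = val α t + 1 := by rw [val]; simp [prm_inj]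
theorem val_add (α : ℕ → M) (t u : ℕ) : val α (prm 4 (prm t u)) = val α t + val α u := by
  rw [val]; simp [prm_inj]
theorem val_mul (α : ℕ → M) (t u : ℕ) : val α (prm 5 (prm t u)) = val α t * val α u := by
  rw [val]; simp [prm_inj]

theorem val_gn (α : ℕ → M) (t : LA.Term (Empty ⊕ Fin k)) :
    val α (gnT t) = t.realize (Sum.elim default (fun j : Fin k => α j)) := by
  induction t with
  | var x =>
    rcases x with x | j
    · exact x.elim
    · simp [gnT, val_var]
  | @func l f ts ih =>
    match l, f with
    | 0, f => exact (val_zero α).trans (Cmp.c_zero (M := M) _).symm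
    | 1, f =>
      refine (val_succ α _).trans (Eq.trans ?_ (Cmp.c_succ (M := M) _).symm)
      rw [ih]
    | 2, false =>
      refine (val_add α _ _).trans (Eq.trans ?_ (Cmp.c_add (M := M) _).symm)
      rw [ih, ih]
    | 2, true =>
      refine (val_mul α _ _).trans (Eq.trans ?_ (Cmp.c_mul (M := M) _).symm)
      rw [ih, ih]
    | l+3, f => exact (show Empty from f).elim

/-- satisfaction for formula codes -/
def sat (k : ℕ) (c : ℕ) (α : ℕ → M) : Prop :=
  if h : c = prm (6+1) (p2 c) then val α (p1 (p2 c)) = val α (p2 (p2 c))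
  else if h : c = prm (7+1) (p2 c) then val α (p1 (p2 c)) ≤ val α (p2 (p2 c))
  else if h : c = prm (8+1) (p2 c) then (sat k (p1 (p2 c)) α → sat k (p2 (p2 c)) α)
  else if h : c = prm (9+1) (p2 c) then ∀ x, sat (k+1) (p2 c) (Function.update α k x)
  else False
termination_by c
decreasing_by
  · exact dec1 h
  · exact dec2 h
  · exact dec0 h

theorem sat_bot (α : ℕ → M) : ¬ sat k (prm 6 0) α := by rw [sat]; simp [prm_inj]
theorem sat_eq (α : ℕ → M) (t u : ℕ) : sat k (prm 7 (prm t u)) α ↔ val α t = val α u := by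
  rw [sat]; simp [prm_inj]
theorem sat_le (α : ℕ → M) (t u : ℕ) : sat k (prm 8 (prm t u)) α ↔ val α t ≤ val α u := by
  rw [sat]; simp [prm_inj]
theorem sat_imp (α : ℕ → M) (t u : ℕ) : sat k (prm 9 (prm t u)) α ↔ (sat k t α → sat k u α) := by
  rw [sat]; simp [prm_inj]
theorem sat_all (α : ℕ → M) (t : ℕ) : sat k (prm 10 t) α ↔ ∀ x, sat (k+1) t (Function.update α k x) := by
  rw [sat]; simp [prm_inj]

theorem sat_gn (φ : LA.BoundedFormula Empty k) (α : ℕ → M) :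
    sat k (gn φ) α ↔ φ.Realize default (fun j : Fin k => α j) := by
  induction φ generalizing α with
  | falsum => exact iff_of_false (sat_bot α) id
  | equal t u => simp only [gn, sat_eq, val_gn]; rfl
  | @rel k l R ts =>
    match l, R with
    | 0, R => exact (show Empty from R).elim
    | 1, R => exact (show Empty from R).elim
    | 2, R =>
      simp only [gn, sat_le, val_gn]
      exact (Cmp.c_le (M := M) (fun j => (ts j).realize (Sum.elim default (fun j : Fin k => α j)))).symm
    | l+3, R => exact (show Empty from R).elim
  | imp φ ψ h1 h2 => simp only [gn, sat_imp, h1, h2]; rfl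
  | all φ h => simp only [gn, sat_all, h, upd_snoc]; rfl

/-- interpretation of Henkin elements (first component) and assignments (second component) -/
noncomputable def hin (c : ℕ) : M × (ℕ → M) :=
  open Classical in
  (if h : c = prm (0+1) (p2 c) then val (hin (p2 (p2 c))).2 (p1 (p2 c))
  else if h : c = prm (2+1) (p2 c) then (hin (p2 c)).1 + 1
  else if h : c = prm (3+1) (p2 c) then (hin (p1 (p2 c))).1 + (hin (p2 (p2 c))).1
  else if h : c = prm (4+1) (p2 c) then (hin (p1 (p2 c))).1 * (hin (p2 (p2 c))).1
  else if h : c = prm (5+1) (p2 c) then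
    (if h' : ∃ x, ¬ sat (p1 (p2 c) + 1) (p1 (p2 (p2 c)))
      (Function.update (hin (p2 (p2 (p2 c)))).2 (p1 (p2 c)) x) then h'.choose else 0)
  else 0,
  if h : c = prm (0+1) (p2 c) then
    Function.update (hin (p2 (p2 c))).2 (p1 (p1 (p2 c))) (hin (p2 (p1 (p2 c)))).1
  else fun _ => 0)
termination_by c
decreasing_by
  · exact dec2 h
  · exact dec0 h
  · exact dec1 h
  · exact dec2 h
  · exact dec1 h
  · exact dec2 h
  · exact dec3 h
  · exact dec2 h
  · exact dec4 h

theorem hin_ev (t a : ℕ) : (hin (prm 1 (prm t a)) : M × _).1 = val (hin a).2 t := by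
  rw [hin]; simp [prm_inj]
theorem hin_zero : (hin (prm 2 0) : M × _).1 = 0 := by rw [hin]; simp [prm_inj]
theorem hin_succ (x : ℕ) : (hin (prm 3 x) : M × _).1 = (hin x).1 + 1 := by rw [hin]; simp [prm_inj]
theorem hin_add (x y : ℕ) : (hin (prm 4 (prm x y)) : M × _).1 = (hin x).1 + (hin y).1 := by
  rw [hin]; simp [prm_inj]
theorem hin_mul (x y : ℕ) : (hin (prm 5 (prm x y)) : M × _).1 = (hin x).1 * (hin y).1 := by
  rw [hin]; simp [prm_inj]
theorem hin_asg (i x a : ℕ) : (hin (prm 1 (prm (prm i x) a)) : M × _).2 = Function.update (hin a).2 i (hin x).1 := by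
  rw [hin]; simp [prm_inj]
theorem hin_wit (k p a : ℕ)
    (h : sat (k+1) p (Function.update (hin a : M × _).2 k (hin (prm 6 (prm k (prm p a)))).1)) (x : M) :
    sat (k+1) p (Function.update (hin a : M × _).2 k x) := by
  by_contra hx
  have h' : ∃ x, ¬ sat (k+1) p (Function.update (hin a : M × _).2 k x) := ⟨x, hx⟩
  have e : (hin (prm 6 (prm k (prm p a))) : M × _).1 = h'.choose := by
    rw [hin]; simp [prm_inj, h']
  rw [e] at h
  exact h'.choose_spec h
end sem


/-! ### Henkin clauses -/

/-- equality atom -/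
abbrev eqA (x y : ℕ) : ℕ := prm 0 (prm x y)
/-- order atom -/
abbrev leA (x y : ℕ) : ℕ := prm 1 (prm x y)
/-- satisfaction atom -/
abbrev saA (k p a : ℕ) : ℕ := prm 2 (prm k (prm p a))
/-- evaluation of a term code -/
abbrev ev (t a : ℕ) : ℕ := prm 1 (prm t a)
/-- extended assignment -/
abbrev cns (i x a : ℕ) : ℕ := prm 1 (prm (prm i x) a)

/-- forbidden triples of literals -/
def Forb (Ax : ℕ → Prop) (l1 l2 l3 : ℕ) : Prop := ∃ x y z w : ℕ,
  (l1 = prm x 0 ∧ l2 = prm x 1) ∨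
  (l1 = prm (eqA x x) 0) ∨
  (l1 = prm (eqA x y) 1 ∧ l2 = prm (eqA x z) 1 ∧ l3 = prm (eqA y z) 0) ∨
  (l1 = prm (eqA x y) 1 ∧ l2 = prm (eqA (prm 3 x) (prm 3 y)) 0) ∨
  (l1 = prm (eqA x y) 1 ∧ l2 = prm (eqA (prm 4 (prm x z)) (prm 4 (prm y z))) 0) ∨
  (l1 = prm (eqA x y) 1 ∧ l2 = prm (eqA (prm 4 (prm z x)) (prm 4 (prm z y))) 0) ∨
  (l1 = prm (eqA x y) 1 ∧ l2 = prm (eqA (prm 5 (prm x z)) (prm 5 (prm y z))) 0) ∨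
  (l1 = prm (eqA x y) 1 ∧ l2 = prm (eqA (prm 5 (prm z x)) (prm 5 (prm z y))) 0) ∨
  (l1 = prm (eqA x y) 1 ∧ l2 = prm (leA x z) 1 ∧ l3 = prm (leA y z) 0) ∨
  (l1 = prm (eqA x y) 1 ∧ l2 = prm (leA z x) 1 ∧ l3 = prm (leA z y) 0) ∨
  (l1 = prm (eqA (ev (prm 1 x) (cns x y z)) y) 0) ∨
  (¬ x = w ∧ l1 = prm (eqA (ev (prm 1 x) (cns w y z)) (ev (prm 1 x) z)) 0) ∨
  (l1 = prm (eqA (ev (prm 2 0) x) (prm 2 0)) 0) ∨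
  (l1 = prm (eqA (ev (prm 3 x) y) (prm 3 (ev x y))) 0) ∨
  (l1 = prm (eqA (ev (prm 4 (prm x y)) z) (prm 4 (prm (ev x z) (ev y z)))) 0) ∨
  (l1 = prm (eqA (ev (prm 5 (prm x y)) z) (prm 5 (prm (ev x z) (ev y z)))) 0) ∨
  (l1 = prm (saA w (prm 6 0) x) 1) ∨
  (l1 = prm (saA w (prm 7 (prm x y)) z) 1 ∧ l2 = prm (eqA (ev x z) (ev y z)) 0) ∨
  (l1 = prm (saA w (prm 7 (prm x y)) z) 0 ∧ l2 = prm (eqA (ev x z) (ev y z)) 1) ∨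
  (l1 = prm (saA w (prm 8 (prm x y)) z) 1 ∧ l2 = prm (leA (ev x z) (ev y z)) 0) ∨
  (l1 = prm (saA w (prm 8 (prm x y)) z) 0 ∧ l2 = prm (leA (ev x z) (ev y z)) 1) ∨
  (l1 = prm (saA w (prm 9 (prm x y)) z) 1 ∧ l2 = prm (saA w x z) 1 ∧ l3 = prm (saA w y z) 0) ∨
  (l1 = prm (saA w (prm 9 (prm x y)) z) 0 ∧ l2 = prm (saA w x z) 0) ∨
  (l1 = prm (saA w (prm 9 (prm x y)) z) 0 ∧ l2 = prm (saA w y z) 1) ∨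
  (l1 = prm (saA w (prm 10 x) z) 1 ∧ l2 = prm (saA (w+1) x (cns w y z)) 0) ∨
  (l1 = prm (saA w (prm 10 x) z) 0 ∧ l2 = prm (saA (w+1) x (cns w (prm 6 (prm w (prm x z))) z)) 1) ∨
  (Ax x ∧ l1 = prm (saA 0 x 0) 0)

theorem forb_comp {Ax : ℕ → Prop} (x : ℕ) :
    Forb Ax (prm x 0) (prm x 1) (prm x 0) :=
  ⟨x, 0, 0, 0, .inl ⟨rfl, rfl⟩⟩
theorem forb_refl {Ax : ℕ → Prop} (x : ℕ) :
    Forb Ax (prm (eqA x x) 0) (prm (eqA x x) 0) (prm (eqA x x) 0) :=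
  ⟨x, 0, 0, 0, .inr (.inl rfl)⟩
theorem forb_trans {Ax : ℕ → Prop} (x y z : ℕ) :
    Forb Ax (prm (eqA x y) 1) (prm (eqA x z) 1) (prm (eqA y z) 0) :=
  ⟨x, y, z, 0, .inr (.inr (.inl ⟨rfl, rfl, rfl⟩))⟩
theorem forb_csucc {Ax : ℕ → Prop} (x y : ℕ) :
    Forb Ax (prm (eqA x y) 1) (prm (eqA (prm 3 x) (prm 3 y)) 0) (prm (eqA x y) 1) :=
  ⟨x, y, 0, 0, .inr (.inr (.inr (.inl ⟨rfl, rfl⟩)))⟩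
theorem forb_cadd1 {Ax : ℕ → Prop} (x y z : ℕ) :
    Forb Ax (prm (eqA x y) 1) (prm (eqA (prm 4 (prm x z)) (prm 4 (prm y z))) 0) (prm (eqA x y) 1) :=
  ⟨x, y, z, 0, .inr (.inr (.inr (.inr (.inl ⟨rfl, rfl⟩))))⟩
theorem forb_cadd2 {Ax : ℕ → Prop} (x y z : ℕ) :
    Forb Ax (prm (eqA x y) 1) (prm (eqA (prm 4 (prm z x)) (prm 4 (prm z y))) 0) (prm (eqA x y) 1) :=
  ⟨x, y, z, 0, .inr (.inr (.inr (.inr (.inr (.inl ⟨rfl, rfl⟩)))))⟩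
theorem forb_cmul1 {Ax : ℕ → Prop} (x y z : ℕ) :
    Forb Ax (prm (eqA x y) 1) (prm (eqA (prm 5 (prm x z)) (prm 5 (prm y z))) 0) (prm (eqA x y) 1) :=
  ⟨x, y, z, 0, .inr (.inr (.inr (.inr (.inr (.inr (.inl ⟨rfl, rfl⟩))))))⟩
theorem forb_cmul2 {Ax : ℕ → Prop} (x y z : ℕ) :
    Forb Ax (prm (eqA x y) 1) (prm (eqA (prm 5 (prm z x)) (prm 5 (prm z y))) 0) (prm (eqA x y) 1) :=
  ⟨x, y, z, 0, .inr (.inr (.inr (.inr (.inr (.inr (.inr (.inl ⟨rfl, rfl⟩)))))))⟩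
theorem forb_cle1 {Ax : ℕ → Prop} (x y z : ℕ) :
    Forb Ax (prm (eqA x y) 1) (prm (leA x z) 1) (prm (leA y z) 0) :=
  ⟨x, y, z, 0, .inr (.inr (.inr (.inr (.inr (.inr (.inr (.inr (.inl ⟨rfl, rfl, rfl⟩))))))))⟩
theorem forb_cle2 {Ax : ℕ → Prop} (x y z : ℕ) :
    Forb Ax (prm (eqA x y) 1) (prm (leA z x) 1) (prm (leA z y) 0) :=
  ⟨x, y, z, 0, .inr (.inr (.inr (.inr (.inr (.inr (.inr (.inr (.inr (.inl ⟨rfl, rfl, rfl⟩)))))))))⟩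
theorem forb_evar {Ax : ℕ → Prop} (x y z : ℕ) :
    Forb Ax (prm (eqA (ev (prm 1 x) (cns x y z)) y) 0) (prm (eqA (ev (prm 1 x) (cns x y z)) y) 0) (prm (eqA (ev (prm 1 x) (cns x y z)) y) 0) :=
  ⟨x, y, z, 0, .inr (.inr (.inr (.inr (.inr (.inr (.inr (.inr (.inr (.inr (.inl rfl))))))))))⟩
theorem forb_evne {Ax : ℕ → Prop} (x y z w : ℕ) (h : ¬ x = w) :
    Forb Ax (prm (eqA (ev (prm 1 x) (cns w y z)) (ev (prm 1 x) z)) 0) (prm (eqA (ev (prm 1 x) (cns w y z)) (ev (prm 1 x) z)) 0) (prm (eqA (ev (prm 1 x) (cns w y z)) (ev (prm 1 x) z)) 0) :=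
  ⟨x, y, z, w, .inr (.inr (.inr (.inr (.inr (.inr (.inr (.inr (.inr (.inr (.inr (.inl ⟨h, rfl⟩)))))))))))⟩
theorem forb_ezero {Ax : ℕ → Prop} (x : ℕ) :
    Forb Ax (prm (eqA (ev (prm 2 0) x) (prm 2 0)) 0) (prm (eqA (ev (prm 2 0) x) (prm 2 0)) 0) (prm (eqA (ev (prm 2 0) x) (prm 2 0)) 0) :=
  ⟨x, 0, 0, 0, .inr (.inr (.inr (.inr (.inr (.inr (.inr (.inr (.inr (.inr (.inr (.inr (.inl rfl))))))))))))⟩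
theorem forb_esucc {Ax : ℕ → Prop} (x y : ℕ) :
    Forb Ax (prm (eqA (ev (prm 3 x) y) (prm 3 (ev x y))) 0) (prm (eqA (ev (prm 3 x) y) (prm 3 (ev x y))) 0) (prm (eqA (ev (prm 3 x) y) (prm 3 (ev x y))) 0) :=
  ⟨x, y, 0, 0, .inr (.inr (.inr (.inr (.inr (.inr (.inr (.inr (.inr (.inr (.inr (.inr (.inr (.inl rfl)))))))))))))⟩
theorem forb_eadd {Ax : ℕ → Prop} (x y z : ℕ) :
    Forb Ax (prm (eqA (ev (prm 4 (prm x y)) z) (prm 4 (prm (ev x z) (ev y z)))) 0) (prm (eqA (ev (prm 4 (prm x y)) z) (prm 4 (prm (ev x z) (ev y z)))) 0) (prm (eqA (ev (prm 4 (prm x y)) z) (prm 4 (prm (ev x z) (ev y z)))) 0) :=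
  ⟨x, y, z, 0, .inr (.inr (.inr (.inr (.inr (.inr (.inr (.inr (.inr (.inr (.inr (.inr (.inr (.inr (.inl rfl))))))))))))))⟩
theorem forb_emul {Ax : ℕ → Prop} (x y z : ℕ) :
    Forb Ax (prm (eqA (ev (prm 5 (prm x y)) z) (prm 5 (prm (ev x z) (ev y z)))) 0) (prm (eqA (ev (prm 5 (prm x y)) z) (prm 5 (prm (ev x z) (ev y z)))) 0) (prm (eqA (ev (prm 5 (prm x y)) z) (prm 5 (prm (ev x z) (ev y z)))) 0) :=
  ⟨x, y, z, 0, .inr (.inr (.inr (.inr (.inr (.inr (.inr (.inr (.inr (.inr (.inr (.inr (.inr (.inr (.inr (.inl rfl)))))))))))))))⟩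
theorem forb_sbot {Ax : ℕ → Prop} (x w : ℕ) :
    Forb Ax (prm (saA w (prm 6 0) x) 1) (prm (saA w (prm 6 0) x) 1) (prm (saA w (prm 6 0) x) 1) :=
  ⟨x, 0, 0, w, .inr (.inr (.inr (.inr (.inr (.inr (.inr (.inr (.inr (.inr (.inr (.inr (.inr (.inr (.inr (.inr (.inl rfl))))))))))))))))⟩
theorem forb_seq1 {Ax : ℕ → Prop} (x y z w : ℕ) :
    Forb Ax (prm (saA w (prm 7 (prm x y)) z) 1) (prm (eqA (ev x z) (ev y z)) 0) (prm (saA w (prm 7 (prm x y)) z) 1) :=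
  ⟨x, y, z, w, .inr (.inr (.inr (.inr (.inr (.inr (.inr (.inr (.inr (.inr (.inr (.inr (.inr (.inr (.inr (.inr (.inr (.inl ⟨rfl, rfl⟩)))))))))))))))))⟩
theorem forb_seq0 {Ax : ℕ → Prop} (x y z w : ℕ) :
    Forb Ax (prm (saA w (prm 7 (prm x y)) z) 0) (prm (eqA (ev x z) (ev y z)) 1) (prm (saA w (prm 7 (prm x y)) z) 0) :=
  ⟨x, y, z, w, .inr (.inr (.inr (.inr (.inr (.inr (.inr (.inr (.inr (.inr (.inr (.inr (.inr (.inr (.inr (.inr (.inr (.inr (.inl ⟨rfl, rfl⟩))))))))))))))))))⟩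
theorem forb_sle1 {Ax : ℕ → Prop} (x y z w : ℕ) :
    Forb Ax (prm (saA w (prm 8 (prm x y)) z) 1) (prm (leA (ev x z) (ev y z)) 0) (prm (saA w (prm 8 (prm x y)) z) 1) :=
  ⟨x, y, z, w, .inr (.inr (.inr (.inr (.inr (.inr (.inr (.inr (.inr (.inr (.inr (.inr (.inr (.inr (.inr (.inr (.inr (.inr (.inr (.inl ⟨rfl, rfl⟩)))))))))))))))))))⟩
theorem forb_sle0 {Ax : ℕ → Prop} (x y z w : ℕ) :
    Forb Ax (prm (saA w (prm 8 (prm x y)) z) 0) (prm (leA (ev x z) (ev y z)) 1) (prm (saA w (prm 8 (prm x y)) z) 0) :=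
  ⟨x, y, z, w, .inr (.inr (.inr (.inr (.inr (.inr (.inr (.inr (.inr (.inr (.inr (.inr (.inr (.inr (.inr (.inr (.inr (.inr (.inr (.inr (.inl ⟨rfl, rfl⟩))))))))))))))))))))⟩
theorem forb_simp1 {Ax : ℕ → Prop} (x y z w : ℕ) :
    Forb Ax (prm (saA w (prm 9 (prm x y)) z) 1) (prm (saA w x z) 1) (prm (saA w y z) 0) :=
  ⟨x, y, z, w, .inr (.inr (.inr (.inr (.inr (.inr (.inr (.inr (.inr (.inr (.inr (.inr (.inr (.inr (.inr (.inr (.inr (.inr (.inr (.inr (.inr (.inl ⟨rfl, rfl, rfl⟩)))))))))))))))))))))⟩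
theorem forb_simp2 {Ax : ℕ → Prop} (x y z w : ℕ) :
    Forb Ax (prm (saA w (prm 9 (prm x y)) z) 0) (prm (saA w x z) 0) (prm (saA w (prm 9 (prm x y)) z) 0) :=
  ⟨x, y, z, w, .inr (.inr (.inr (.inr (.inr (.inr (.inr (.inr (.inr (.inr (.inr (.inr (.inr (.inr (.inr (.inr (.inr (.inr (.inr (.inr (.inr (.inr (.inl ⟨rfl, rfl⟩))))))))))))))))))))))⟩
theorem forb_simp3 {Ax : ℕ → Prop} (x y z w : ℕ) :
    Forb Ax (prm (saA w (prm 9 (prm x y)) z) 0) (prm (saA w y z) 1) (prm (saA w (prm 9 (prm x y)) z) 0) :=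
  ⟨x, y, z, w, .inr (.inr (.inr (.inr (.inr (.inr (.inr (.inr (.inr (.inr (.inr (.inr (.inr (.inr (.inr (.inr (.inr (.inr (.inr (.inr (.inr (.inr (.inr (.inl ⟨rfl, rfl⟩)))))))))))))))))))))))⟩
theorem forb_sall1 {Ax : ℕ → Prop} (x y z w : ℕ) :
    Forb Ax (prm (saA w (prm 10 x) z) 1) (prm (saA (w+1) x (cns w y z)) 0) (prm (saA w (prm 10 x) z) 1) :=
  ⟨x, y, z, w, .inr (.inr (.inr (.inr (.inr (.inr (.inr (.inr (.inr (.inr (.inr (.inr (.inr (.inr (.inr (.inr (.inr (.inr (.inr (.inr (.inr (.inr (.inr (.inr (.inl ⟨rfl, rfl⟩))))))))))))))))))))))))⟩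
theorem forb_sall0 {Ax : ℕ → Prop} (x z w : ℕ) :
    Forb Ax (prm (saA w (prm 10 x) z) 0) (prm (saA (w+1) x (cns w (prm 6 (prm w (prm x z))) z)) 1) (prm (saA w (prm 10 x) z) 0) :=
  ⟨x, 0, z, w, .inr (.inr (.inr (.inr (.inr (.inr (.inr (.inr (.inr (.inr (.inr (.inr (.inr (.inr (.inr (.inr (.inr (.inr (.inr (.inr (.inr (.inr (.inr (.inr (.inr (.inl ⟨rfl, rfl⟩)))))))))))))))))))))))))⟩
theorem forb_sax {Ax : ℕ → Prop} (x : ℕ) (h : Ax x) :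
    Forb Ax (prm (saA 0 x 0) 0) (prm (saA 0 x 0) 0) (prm (saA 0 x 0) 0) :=
  ⟨x, 0, 0, 0, .inr (.inr (.inr (.inr (.inr (.inr (.inr (.inr (.inr (.inr (.inr (.inr (.inr (.inr (.inr (.inr (.inr (.inr (.inr (.inr (.inr (.inr (.inr (.inr (.inr (.inr (⟨h, rfl⟩))))))))))))))))))))))))))⟩



theorem fnq {p : Prop} (h : p := by
  repeat' (first
    | with_reducible apply Fn1.prm | with_reducible apply Fn1.add
    | with_reducible exact Fn1.const _
    | (with_reducible refine Fn1.var ?_ _; exact nvt))) : p := h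

theorem S1.forb {Ax : ℕ → Prop} (hA : S1 (fun v : Fin 1 → ℕ => Ax (v 0))) :
    S1 (fun v : Fin 3 → ℕ => Forb Ax (v 0) (v 1) (v 2)) := by
  unfold Forb
  refine S1.ex (S1.ex (S1.ex (S1.ex ?_)))
  repeat' (first
    | with_reducible apply S1.or
    | with_reducible apply S1.and
    | (with_reducible refine S1.ne ?_ ?_; exact fnq; exact fnq)
    | (with_reducible refine S1.eq ?_ ?_; exact fnq; exact fnq)
    | exact S1.comp1 hA fnq)

/-- immediately inconsistent finite sets -/
def BadA (Ax : ℕ → Prop) (s : ℕ) : Prop :=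
  ∃ l1 l2 l3, Mem l1 s ∧ Mem l2 s ∧ Mem l3 s ∧ Forb Ax l1 l2 l3
/-- case split -/
def BadR (s l r : ℕ) : Prop := ∃ x, (∀ y, y ≤ l → Mem y l → Mem y s ∨ y = prm x 1) ∧
  (∀ y, y ≤ r → Mem y r → Mem y s ∨ y = prm x 0)
/-- inconsistent finite sets -/
def Bad (Ax : ℕ → Prop) (s : ℕ) : Prop := Der (BadA Ax) BadR s

theorem S1.bad {Ax : ℕ → Prop} (hA : S1 (fun v : Fin 1 → ℕ => Ax (v 0))) {k : ℕ} {f : (Fin k → ℕ) → ℕ} (hf : Fn1 f) :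
    S1 (fun v => Bad Ax (f v)) := by
  refine S1.der ?_ ?_ hf
  · unfold BadA
    exact S1.ex (S1.ex (S1.ex (S1.and s1t (S1.and s1t (S1.and s1t (S1.comp3 (S1.forb hA) fnt fnt fnt))))))
  · unfold BadR
    exact s1t

/-- literal holds under a valuation -/
def Hd (v : ℕ → Prop) (l : ℕ) : Prop := ∃ x, (l = prm x 1 ∧ v x) ∨ (l = prm x 0 ∧ ¬ v x)

theorem hd1 (v : ℕ → Prop) (x : ℕ) : Hd v (prm x 1) ↔ v x := by
  simp [Hd, prm_inj]
theorem hd0 (v : ℕ → Prop) (x : ℕ) : Hd v (prm x 0) ↔ ¬ v x := by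
  simp [Hd, prm_inj]

/-- valuations satisfying all clauses -/
def Good (Ax : ℕ → Prop) (v : ℕ → Prop) : Prop :=
  ∀ l1 l2 l3, Forb Ax l1 l2 l3 → Hd v l1 → Hd v l2 → Hd v l3 → False

theorem bad_sound {Ax v : ℕ → Prop} (hg : Good Ax v) {s : ℕ} (h : Bad Ax s) : ¬ ∀ y, Mem y s → Hd v y := by
  induction h with
  | @ax s h =>
    intro hs
    obtain ⟨l1, l2, l3, h1, h2, h3, h4⟩ := h
    exact hg _ _ _ h4 (hs _ h1) (hs _ h2) (hs _ h3)
  | @st s l r _ _ hR ih1 ih2 =>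
    intro hs
    obtain ⟨x, h1, h2⟩ := hR
    by_cases hx : v x
    · refine ih1 fun y hy => ?_
      rcases h1 y hy.lt.le hy with h | rfl
      · exact hs _ h
      · exact (hd1 v x).2 hx
    · refine ih2 fun y hy => ?_
      rcases h2 y hy.lt.le hy with h | rfl
      · exact hs _ h
      · exact (hd0 v x).2 hx

theorem ins_code (s a : ℕ) : ∃ s', ∀ y, Mem y s' ↔ (Mem y s ∨ y = a) := by
  classical
  obtain ⟨s', h⟩ := fin_code (insert a ((Finset.range s).filter (fun y => Mem y s)))
  refine ⟨s', fun y => (h y).trans ?_⟩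
  have := fun h : Mem y s => h.lt
  simp only [Finset.mem_insert, Finset.mem_filter, Finset.mem_range]
  tauto

theorem bad_ext {Ax : ℕ → Prop} {s : ℕ} (h : ¬ Bad Ax s) (x : ℕ) :
    ∃ s', ¬ Bad Ax s' ∧ (∀ y, Mem y s → Mem y s') ∧ (Mem (prm x 0) s' ∨ Mem (prm x 1) s') := by
  obtain ⟨l, hl⟩ := ins_code s (prm x 1)
  obtain ⟨r, hr⟩ := ins_code s (prm x 0)
  by_cases h1 : Bad Ax l
  · by_cases h2 : Bad Ax r
    · exact absurd (Der.st h1 h2 ⟨x, fun y _ hy => (hl y).1 hy, fun y _ hy => (hr y).1 hy⟩) h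
    · exact ⟨r, h2, fun y hy => (hr y).2 (.inl hy), .inl ((hr _).2 (.inr rfl))⟩
  · exact ⟨l, h1, fun y hy => (hl y).2 (.inl hy), .inr ((hl _).2 (.inr rfl))⟩

theorem bad_complete {Ax : ℕ → Prop} {s : ℕ} (h : ¬ Bad Ax s) :
    ∃ v, Good Ax v ∧ (∀ x, Mem (prm x 0) s → ¬ v x) ∧ (∀ x, Mem (prm x 1) s → v x) := by
  have key : ∀ (q : {s : ℕ // ¬ Bad Ax s}) (x : ℕ), ∃ q' : {s : ℕ // ¬ Bad Ax s},
      (∀ y, Mem y q.1 → Mem y q'.1) ∧ (Mem (prm x 0) q'.1 ∨ Mem (prm x 1) q'.1) := by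
    intro q x
    obtain ⟨s', h1, h2⟩ := bad_ext q.2 x
    exact ⟨⟨s', h1⟩, h2⟩
  choose nx h1 h2 using key
  let ch : ℕ → {s : ℕ // ¬ Bad Ax s} := fun n => Nat.rec ⟨s, h⟩ (fun n q => nx q n) n
  have hc : ∀ n, ch (n+1) = nx (ch n) n := fun n => rfl
  have mono : ∀ m n, m ≤ n → ∀ y, Mem y (ch m).1 → Mem y (ch n).1 := by
    intro m n hmn
    induction hmn with
    | refl => exact fun y h => h
    | step _ ih => exact fun y hy => by rw [hc]; exact h1 _ _ _ (ih y hy)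
  have hdec : ∀ x, Mem (prm x 0) (ch (x+1)).1 ∨ Mem (prm x 1) (ch (x+1)).1 := fun x => by rw [hc]; exact h2 _ _
  have hno : ∀ a b c l1 l2 l3, Mem l1 (ch a).1 → Mem l2 (ch b).1 → Mem l3 (ch c).1 → ¬ Forb Ax l1 l2 l3 := by
    intro a b c l1 l2 l3 ha hb hc' hf
    exact (ch (a+b+c)).2 (.ax ⟨l1, l2, l3, mono _ _ (by omega) _ ha, mono _ _ (by omega) _ hb, mono _ _ (by omega) _ hc', hf⟩)
  have h0 : ∀ n x, Mem (prm x 0) (ch n).1 → ¬ ∃ m, Mem (prm x 1) (ch m).1 := by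
    rintro n x hn ⟨m, hm⟩
    exact hno _ _ _ _ _ _ hn hm hn (forb_comp x)
  have hh : ∀ l, Hd (fun x => ∃ m, Mem (prm x 1) (ch m).1) l → ∃ n, Mem l (ch n).1 := by
    rintro l ⟨x, ⟨rfl, h⟩ | ⟨rfl, h⟩⟩
    · exact h
    · rcases hdec x with h' | h'
      · exact ⟨x+1, h'⟩
      · exact absurd ⟨x+1, h'⟩ h
  refine ⟨fun x => ∃ m, Mem (prm x 1) (ch m).1, ?_, fun x hx => h0 0 x hx, fun x hx => ⟨0, hx⟩⟩
  intro l1 l2 l3 hf g1 g2 g3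
  obtain ⟨a, ha⟩ := hh _ g1
  obtain ⟨b, hb⟩ := hh _ g2
  obtain ⟨c, hc'⟩ := hh _ g3
  exact hno _ _ _ _ _ _ ha hb hc' hf

section sound
variable {M : Type} [CommSemiring M] [LinearOrder M] [IsStrictOrderedRing M]
    [CanonicallyOrderedAdd M] [LA.Structure M] [PAM M]

/-- truth of atoms in a model -/
def AtS (M : Type) [CommSemiring M] [LinearOrder M] [IsStrictOrderedRing M]
    [CanonicallyOrderedAdd M] [LA.Structure M] [PAM M] (c : ℕ) : Prop :=
  (∃ x y, c = eqA x y ∧ (hin x : M × _).1 = (hin y : M × _).1) ∨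
  (∃ x y, c = leA x y ∧ (hin x : M × _).1 ≤ (hin y : M × _).1) ∨
  (∃ k p a, c = saA k p a ∧ sat k p (hin a : M × _).2)

theorem ats_eq (x y : ℕ) : AtS M (prm 0 (prm x y)) ↔ (hin x : M × _).1 = (hin y : M × _).1 := by
  simp [AtS, prm_inj]
theorem ats_le (x y : ℕ) : AtS M (prm 1 (prm x y)) ↔ (hin x : M × _).1 ≤ (hin y : M × _).1 := by
  simp [AtS, prm_inj]
theorem ats_sa (k p a : ℕ) : AtS M (prm 2 (prm k (prm p a))) ↔ sat k p (hin a : M × _).2 := by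
  simp [AtS, prm_inj]

theorem ats_good {Ax : ℕ → Prop} (h0 : ∀ x, Ax x → sat 0 x (hin 0 : M × _).2) : Good Ax (AtS M) := by
  intro l1 l2 l3 hf
  obtain ⟨x, y, z, w, hf⟩ := hf
  rcases hf with ⟨rfl, rfl⟩ | hf
  · rw [hd0, hd1]; exact fun h h' _ => h h'
  rcases hf with rfl | hf
  · intro h; simp [hd0, ats_eq] at h
  rcases hf with ⟨rfl, rfl, rfl⟩ | hf
  · simp only [hd0, hd1, ats_eq]; intro h h' h''; exact h'' (h.symm.trans h')
  rcases hf with ⟨rfl, rfl⟩ | hf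
  · simp only [hd0, hd1, ats_eq, hin_succ]; intro h h' _; exact h' (by rw [h])
  rcases hf with ⟨rfl, rfl⟩ | hf
  · simp only [hd0, hd1, ats_eq, hin_add]; intro h h' _; exact h' (by rw [h])
  rcases hf with ⟨rfl, rfl⟩ | hf
  · simp only [hd0, hd1, ats_eq, hin_add]; intro h h' _; exact h' (by rw [h])
  rcases hf with ⟨rfl, rfl⟩ | hf
  · simp only [hd0, hd1, ats_eq, hin_mul]; intro h h' _; exact h' (by rw [h])
  rcases hf with ⟨rfl, rfl⟩ | hf
  · simp only [hd0, hd1, ats_eq, hin_mul]; intro h h' _; exact h' (by rw [h])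
  rcases hf with ⟨rfl, rfl, rfl⟩ | hf
  · simp only [hd0, hd1, ats_eq, ats_le]; intro h h' h''; exact h'' (by rwa [← h])
  rcases hf with ⟨rfl, rfl, rfl⟩ | hf
  · simp only [hd0, hd1, ats_eq, ats_le]; intro h h' h''; exact h'' (by rwa [← h])
  rcases hf with rfl | hf
  · intro h; simp [hd0, ats_eq, hin_ev, val_var, hin_asg] at h
  rcases hf with ⟨hxw, rfl⟩ | hf
  · intro h; simp [hd0, ats_eq, hin_ev, val_var, hin_asg, hxw] at h
  rcases hf with rfl | hf
  · intro h; simp [hd0, ats_eq, hin_ev, val_zero, hin_zero] at h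
  rcases hf with rfl | hf
  · intro h; simp [hd0, ats_eq, hin_ev, val_succ, hin_succ] at h
  rcases hf with rfl | hf
  · intro h; simp [hd0, ats_eq, hin_ev, val_add, hin_add] at h
  rcases hf with rfl | hf
  · intro h; simp [hd0, ats_eq, hin_ev, val_mul, hin_mul] at h
  rcases hf with rfl | hf
  · intro h; simp [hd1, ats_sa, sat_bot] at h
  rcases hf with ⟨rfl, rfl⟩ | hf
  · simp only [hd0, hd1, ats_eq, ats_sa, sat_eq, hin_ev]; tauto
  rcases hf with ⟨rfl, rfl⟩ | hf
  · simp only [hd0, hd1, ats_eq, ats_sa, sat_eq, hin_ev]; tauto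
  rcases hf with ⟨rfl, rfl⟩ | hf
  · simp only [hd0, hd1, ats_le, ats_sa, sat_le, hin_ev]; tauto
  rcases hf with ⟨rfl, rfl⟩ | hf
  · simp only [hd0, hd1, ats_le, ats_sa, sat_le, hin_ev]; tauto
  rcases hf with ⟨rfl, rfl, rfl⟩ | hf
  · simp only [hd0, hd1, ats_sa, sat_imp]; tauto
  rcases hf with ⟨rfl, rfl⟩ | hf
  · simp only [hd0, hd1, ats_sa, sat_imp]; tauto
  rcases hf with ⟨rfl, rfl⟩ | hf
  · simp only [hd0, hd1, ats_sa, sat_imp]; tauto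
  rcases hf with ⟨rfl, rfl⟩ | hf
  · simp only [hd0, hd1, ats_sa, sat_all, hin_asg]; intro h h' _; exact h' (h _)
  rcases hf with ⟨rfl, rfl⟩ | ⟨ha, rfl⟩
  · simp only [hd0, hd1, ats_sa, sat_all, hin_asg]; intro h h' _; exact h (hin_wit _ _ _ h')
  · simp only [hd0, ats_sa]; intro h; exact absurd (h0 _ ha) h
end sound



/-! ### the term model -/
section tm
variable {Ax v : ℕ → Prop}

theorem Good.refl (hg : Good Ax v) (x : ℕ) : v (eqA x x) := by
  by_contra h; exact hg _ _ _ (forb_refl x) ((hd0 _ _).2 h) ((hd0 _ _).2 h) ((hd0 _ _).2 h)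
theorem Good.one (hg : Good Ax v) {l : ℕ} (hf : Forb Ax (prm l 0) (prm l 0) (prm l 0)) : v l := by
  by_contra h; exact hg _ _ _ hf ((hd0 _ _).2 h) ((hd0 _ _).2 h) ((hd0 _ _).2 h)
theorem Good.neg (hg : Good Ax v) {l : ℕ} (hf : Forb Ax (prm l 1) (prm l 1) (prm l 1)) : ¬ v l :=
  fun h => hg _ _ _ hf ((hd1 _ _).2 h) ((hd1 _ _).2 h) ((hd1 _ _).2 h)
theorem Good.two (hg : Good Ax v) {l m : ℕ} (hf : Forb Ax (prm l 1) (prm m 0) (prm l 1)) (hl : v l) : v m := by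
  by_contra h; exact hg _ _ _ hf ((hd1 _ _).2 hl) ((hd0 _ _).2 h) ((hd1 _ _).2 hl)
theorem Good.two' (hg : Good Ax v) {l m : ℕ} (hf : Forb Ax (prm l 0) (prm m 1) (prm l 0)) (hl : v m) : v l := by
  by_contra h; exact hg _ _ _ hf ((hd0 _ _).2 h) ((hd1 _ _).2 hl) ((hd0 _ _).2 h)
theorem Good.two0 (hg : Good Ax v) {l m : ℕ} (hf : Forb Ax (prm l 0) (prm m 0) (prm l 0)) (hl : ¬ v m) : v l := by
  by_contra h; exact hg _ _ _ hf ((hd0 _ _).2 h) ((hd0 _ _).2 hl) ((hd0 _ _).2 h)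
theorem Good.three (hg : Good Ax v) {l m n : ℕ} (hf : Forb Ax (prm l 1) (prm m 1) (prm n 0)) (hl : v l) (hm : v m) : v n := by
  by_contra h; exact hg _ _ _ hf ((hd1 _ _).2 hl) ((hd1 _ _).2 hm) ((hd0 _ _).2 h)

theorem Good.symm (hg : Good Ax v) {x y : ℕ} (h : v (eqA x y)) : v (eqA y x) :=
  hg.three (forb_trans x y x) h (hg.refl x)
theorem Good.trans (hg : Good Ax v) {x y z : ℕ} (h : v (eqA x y)) (h' : v (eqA y z)) : v (eqA x z) :=
  hg.three (forb_trans y x z) (hg.symm h) h'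

variable (hg : Good Ax v)

/-- the equivalence relation -/
def stE : Setoid ℕ := ⟨fun x y => v (eqA x y), hg.refl, hg.symm, hg.trans⟩
/-- the carrier -/
def QM : Type := Quotient (stE hg)
/-- classes -/
def qm (x : ℕ) : QM hg := Quotient.mk (stE hg) x
theorem qm_eq {x y : ℕ} : qm hg x = qm hg y ↔ v (eqA x y) :=
  ⟨fun h => Quotient.exact h, fun h => Quotient.sound (s := stE hg) h⟩
theorem qm_surj (q : QM hg) : ∃ x, q = qm hg x := by
  induction q using Quotient.inductionOn with
  | h x => exact ⟨x, rfl⟩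

/-- successor -/
def qS : QM hg → QM hg := Quotient.map (sa := stE hg) (sb := stE hg) (fun x => prm 3 x) (fun x y h => hg.two (forb_csucc x y) h)
/-- addition -/
def qA : QM hg → QM hg → QM hg :=
  Quotient.map₂ (sa := stE hg) (sb := stE hg) (sc := stE hg) (fun x y => prm 4 (prm x y)) (fun x x' h y y' h' =>
    hg.trans (hg.two (forb_cadd1 x x' y) h) (hg.two (forb_cadd2 y y' x') h'))
def qP : QM hg → QM hg → QM hg :=
  Quotient.map₂ (sa := stE hg) (sb := stE hg) (sc := stE hg) (fun x y => prm 5 (prm x y)) (fun x x' h y y' h' =>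
    hg.trans (hg.two (forb_cmul1 x x' y) h) (hg.two (forb_cmul2 y y' x') h'))
def qL : QM hg → QM hg → Prop :=
  Quotient.lift₂ (s₁ := stE hg) (s₂ := stE hg) (fun x y => v (leA x y)) (fun x y x' y' h h' => propext
    ⟨fun hl => hg.three (forb_cle2 y y' x') h' (hg.three (forb_cle1 x x' y) h hl),
     fun hl => hg.three (forb_cle2 y' y x) (hg.symm h') (hg.three (forb_cle1 x' x y') (hg.symm h) hl)⟩)

instance : LA.Structure (QM hg) where
  funMap := fun {l} f w => match l, f, w with
    | 0, _, _ => qm hg (prm 2 0)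
    | 1, _, w => qS hg (w 0)
    | 2, f, w => cond (show Bool from f) (qP hg (w 0) (w 1)) (qA hg (w 0) (w 1))
    | _+3, f, _ => (show Empty from f).elim
  RelMap := fun {l} f w => match l, f, w with
    | 0, f, _ => (show Empty from f).elim
    | 1, f, _ => (show Empty from f).elim
    | 2, _, w => qL hg (w 0) (w 1)
    | _+3, f, _ => (show Empty from f).elim

/-- assignments -/
def qas (a i : ℕ) : QM hg := qm hg (ev (prm 1 i) a)

theorem qas_cns (i x a : ℕ) : qas hg (cns i x a) = Function.update (qas hg a) i (qm hg x) := by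
  funext j
  by_cases h : j = i
  · subst h
    simp only [Function.update_self, qas, qm_eq]
    exact hg.one (forb_evar j x a)
  · rw [Function.update_of_ne h]
    simp only [qas, qm_eq]
    exact hg.one (forb_evne j x a i h)

theorem qm_term {k : ℕ} (t : LA.Term (Empty ⊕ Fin k)) (a : ℕ) :
    qm hg (ev (gnT t) a) = t.realize (Sum.elim default (fun j : Fin k => qas hg a j)) := by
  induction t with
  | var x =>
    rcases x with x | j
    · exact x.elim
    · simp [gnT, qas]
  | @func l f ts ih =>
    match l, f with
    | 0, f => exact (qm_eq hg).2 (hg.one (forb_ezero a))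
    | 1, f =>
      refine ((qm_eq hg).2 (hg.one (forb_esucc (gnT (ts 0)) a))).trans ?_
      show qS hg (qm hg _) = qS hg _
      rw [ih]
    | 2, false =>
      refine ((qm_eq hg).2 (hg.one (forb_eadd (gnT (ts 0)) (gnT (ts 1)) a))).trans ?_
      show qA hg (qm hg _) (qm hg _) = qA hg _ _
      rw [ih, ih]
    | 2, true =>
      refine ((qm_eq hg).2 (hg.one (forb_emul (gnT (ts 0)) (gnT (ts 1)) a))).trans ?_
      show qP hg (qm hg _) (qm hg _) = qP hg _ _
      rw [ih, ih]
    | l+3, f => exact (show Empty from f).elim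

theorem qm_sat {k : ℕ} (φ : LA.BoundedFormula Empty k) (a : ℕ) :
    v (saA k (gn φ) a) ↔ φ.Realize default (fun j : Fin k => qas hg a j) := by
  induction φ generalizing a with
  | @falsum k => exact iff_of_false (hg.neg (forb_sbot a k)) id
  | @equal k t u =>
    refine Iff.trans ?_ (Eq.congr (qm_term hg t a) (qm_term hg u a))
    rw [qm_eq]
    exact ⟨hg.two (forb_seq1 _ _ _ _), hg.two' (forb_seq0 _ _ _ _)⟩
  | @rel k l R ts =>
    match l, R with
    | 0, R => exact (show Empty from R).elim
    | 1, R => exact (show Empty from R).elim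
    | 2, R =>
      have : (BoundedFormula.rel R ts).Realize default (fun j : Fin k => qas hg a j) ↔
        qL hg ((ts 0).realize (Sum.elim default (fun j : Fin k => qas hg a j)))
          ((ts 1).realize (Sum.elim default (fun j : Fin k => qas hg a j))) := Iff.rfl
      rw [this, ← qm_term, ← qm_term]
      exact ⟨hg.two (forb_sle1 (gnT (ts 0)) (gnT (ts 1)) a k), hg.two' (forb_sle0 (gnT (ts 0)) (gnT (ts 1)) a k)⟩
    | l+3, R => exact (show Empty from R).elim
  | @imp k φ ψ h1 h2 =>
    rw [BoundedFormula.realize_imp, ← h1, ← h2]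
    refine ⟨fun h h' => hg.three (forb_simp1 _ _ _ _) h h', fun h => ?_⟩
    by_cases h3 : v (saA k (gn φ) a)
    · exact hg.two' (forb_simp3 _ _ _ _) (h h3)
    · exact hg.two0 (forb_simp2 _ _ _ _) h3
  | @all k φ h =>
    rw [BoundedFormula.realize_all]
    have key : ∀ x, v (saA (k+1) (gn φ) (cns k x a)) ↔
        φ.Realize default (Fin.snoc (fun j : Fin k => qas hg a j) (qm hg x) : Fin (k+1) → QM hg) := by
      intro x
      rw [h, qas_cns, upd_snoc]
    constructor
    · intro h1 q
      obtain ⟨x, rfl⟩ := qm_surj hg q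
      exact (key x).1 (hg.two (forb_sall1 _ _ _ _) h1)
    · intro h1
      exact hg.two' (forb_sall0 _ _ _) ((key _).2 (h1 _))

end tm

theorem qm_models {T : Thy} {Ax v : ℕ → Prop} (hA : ∀ x, Ax x ↔ ∃ φ ∈ T, gn φ = x) (hg : Good Ax v) :
    QM hg ⊨ T := by
  refine ⟨fun φ hφ => ?_⟩
  have h := (qm_sat hg φ 0).1 (hg.one (forb_sax _ ((hA _).2 ⟨φ, hφ, rfl⟩)))
  have e : (fun j : Fin 0 => qas hg 0 j) = default := Subsingleton.elim _ _
  rw [e] at h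
  exact h

theorem ext_mdl {T : Thy} (hE : ExtPA T) {M : Type} [LA.Structure M] [Nonempty M] (h : M ⊨ T) : M ⊨ PAAx :=
  ⟨fun φ hφ => (Theory.models_sentence_iff.1 (hE φ hφ)) ⟨M⟩⟩

/-- numerals -/
def nml : ℕ → ℕ
  | 0 => prm 2 0
  | n+1 => prm 3 (nml n)

theorem nml_lt (n : ℕ) : n ≤ nml n := by
  induction n with
  | zero => exact Nat.zero_le _
  | succ n ih => exact Nat.succ_le_of_lt (lt_of_le_of_lt ih (by
      have := dec0 (c := prm 3 (nml n)) (n := 2) (by simp)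
      simpa [nml] using this))

theorem fn1_nml : Fn1 (fun v : Fin 1 → ℕ => nml (v 0)) := by
  refine S1.of_iff (P := fun v : Fin 2 → ℕ => Der (fun x => x = prm 0 (prm 2 0))
    (fun x l r => x = prm (p1 l + 1) (prm 3 (p2 l))) (prm (v 0) (v 1))) (S1.der s1t s1t fnt) ?_
  intro w
  show w 1 = nml (w 0) ↔ _
  have h1 : ∀ n, Der (fun x => x = prm 0 (prm 2 0)) (fun x l r => x = prm (p1 l + 1) (prm 3 (p2 l))) (prm n (nml n)) := by
    intro n
    induction n with
    | zero => exact .ax rfl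
    | succ n ih => exact .st ih ih (by simp [nml])
  have h2 : ∀ x, Der (fun x => x = prm 0 (prm 2 0)) (fun x l r => x = prm (p1 l + 1) (prm 3 (p2 l))) x →
      p2 x = nml (p1 x) := by
    intro x hx
    induction hx with
    | ax h => subst h; simp [nml]
    | st _ _ hr ih _ => subst hr; simp [nml, ih]
  constructor
  · intro h; rw [h]; exact h1 _
  · intro h; simpa using h2 _ h

theorem hin_nml (i : Mdl) (c : ℕ) : (hin (nml c) : i.C × _).1 = (c : i.C) := by
  induction c with
  | zero => simp [nml, hin_zero]
  | succ c ih => simp [nml, hin_succ, ih]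

theorem cast_gen (i : Mdl) (q : ℕ → i.C) (h0 : q 0 = Structure.funMap fZero default)
    (hs : ∀ c, q (c+1) = Structure.funMap fSucc (fun _ => q c)) (c : ℕ) : (c : i.C) = q c := by
  induction c with
  | zero => rw [h0, Cmp.c_zero, Nat.cast_zero]
  | succ c ih => rw [hs, Cmp.c_succ, Nat.cast_succ, ih]

theorem fn2 {M : Type} (a b : M) (α : ℕ → M) :
    (fun j : Fin 2 => Function.update (Function.update α 0 a) 1 b j) = ![a, b] := by
  funext j
  fin_cases j <;> simp

/-- provability in models is Σ₁ -/
theorem prv_s1 {T : Thy} (hA : S1 (fun v : Fin 1 → ℕ => ∃ φ ∈ T, gn φ = v 0)) (hE : ExtPA T)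
    (θ : LA.BoundedFormula Empty 2) :
    S1 (fun v : Fin 2 → ℕ => ∀ i : Mdl, i.C ⊨ T → θ.Realize default ![((v 0 : ℕ) : i.C), ((v 1 : ℕ) : i.C)]) := by
  let Ax : ℕ → Prop := fun x => ∃ φ ∈ T, gn φ = x
  obtain ⟨L, hLe⟩ : ∃ L : ℕ → ℕ → ℕ, L = fun c e => prm (saA 2 (gn θ) (cns 1 (nml e) (cns 0 (nml c) 0))) 0 := ⟨_, rfl⟩
  have hL : Fn1 (fun v : Fin 2 → ℕ => L (v 0) (v 1)) := by
    rw [hLe]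
    exact Fn1.prm (Fn1.prm (Fn1.const _) (Fn1.prm (Fn1.const _) (Fn1.prm (Fn1.const _) (Fn1.prm (Fn1.const _) (Fn1.prm
      (Fn1.prm (Fn1.const _) (Fn1.comp1 (F := nml) fn1_nml fnq)) (Fn1.prm (Fn1.const _)
       (Fn1.prm (Fn1.prm (Fn1.const _) (Fn1.comp1 (F := nml) fn1_nml fnq)) (Fn1.const _)))))))) (Fn1.const _)
  refine S1.of_iff (P := fun v : Fin 2 → ℕ => ∃ s, (∀ y, y ≤ s → Mem y s → y = L (v 0) (v 1)) ∧ Bad Ax s) ?_ ?_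
  · refine S1.ex (S1.and (S1.ball fnt (S1.imp s1t (S1.eq fnt (Fn1.comp2 (F := L) hL fnt fnt)))) (S1.bad hA fnt))
  intro w
  constructor
  · intro h
    obtain ⟨s, hs⟩ := fin_code {L (w 0) (w 1)}
    refine ⟨s, fun y _ hy => by simpa using (hs y).1 hy, ?_⟩
    by_contra hb
    obtain ⟨v, hg, h0, _⟩ := bad_complete hb
    rw [hLe] at hs
    have h1 := h0 _ ((hs _).2 (Finset.mem_singleton_self _))
    have hT := qm_models (fun _ => Iff.rfl) hg
    have : Nonempty (QM hg) := ⟨qm hg 0⟩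
    obtain ⟨pmi⟩ := exists_PAM (ext_mdl hE hT)
    have h2 := h ⟨QM hg, inferInstance, pmi⟩ hT
    rw [cast_gen _ (fun c => qm hg (nml c)) rfl (fun _ => rfl), cast_gen _ (fun c => qm hg (nml c)) rfl (fun _ => rfl)] at h2
    rw [qm_sat hg, qas_cns, qas_cns, fn2] at h1
    exact h1 h2
  · rintro ⟨s, hs, hb⟩ i hT
    by_contra hθ
    have hg : Good Ax (AtS i.C) := by
      refine ats_good ?_
      rintro x ⟨φ, hφ, rfl⟩
      rw [sat_gn]
      have := hT.realize_of_mem φ hφ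
      have e : (fun j : Fin 0 => (hin 0 : i.C × _).2 j) = default := Subsingleton.elim _ _
      rw [e]
      exact this
    refine bad_sound hg hb fun y hy => ?_
    rw [hs y hy.lt.le hy, hLe, hd0, ats_sa, sat_gn, hin_asg, hin_asg, hin_nml, hin_nml, fn2]
    exact hθ


/-! ### from the official Gödel numbering to our codes -/

theorem fnr {p : Prop} (h : p := by
  repeat' (first
    | with_reducible apply Fn1.prm | with_reducible apply Fn1.pair | with_reducible apply Fn1.add
    | with_reducible apply Fn1.mul
    | with_reducible exact Fn1.const _
    | (with_reducible refine Fn1.var ?_ _; exact nvt))) : p := h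
theorem s1r {p : Prop} (h : p := by
  repeat' (first
    | with_reducible apply S1.or
    | with_reducible apply S1.and
    | with_reducible apply S1.ex
    | (with_reducible refine S1.lt ?_ ?_; exact fnr; exact fnr)
    | (with_reducible refine S1.eq ?_ ?_; exact fnr; exact fnr))) : p := h

/-- list cons on codes -/
abbrev cs (a t : ℕ) : ℕ := Nat.pair a t + 1
/-- list codes with tail -/
def lc {α : Type} [Encodable α] (l : List α) (t : ℕ) : ℕ := l.foldr (fun a t => cs (Encodable.encode a) t) t

theorem lc_nil {α : Type} [Encodable α] (t : ℕ) : lc ([] : List α) t = t := rfl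
theorem lc_cons {α : Type} [Encodable α] (a : α) (l : List α) (t : ℕ) :
    lc (a :: l) t = cs (Encodable.encode a) (lc l t) := rfl
theorem lc_app {α : Type} [Encodable α] (l m : List α) (t : ℕ) : lc (l ++ m) t = lc l (lc m t) := by
  simp [lc]
theorem lc_enc {α : Type} [Encodable α] (l : List α) : lc l 0 = Encodable.encode l := by
  induction l with
  | nil => rfl
  | cons a l ih => rw [lc_cons, ih]; rfl

/-- term encoding -/
def eT {k : ℕ} (τ : LA.Term (Empty ⊕ Fin k)) (t : ℕ) : ℕ := lc τ.listEncode t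
/-- formula encoding -/
def eF {k : ℕ} (φ : LA.BoundedFormula Empty k) (t : ℕ) : ℕ :=
  lc (show List ((Σ k, LA.Term (Empty ⊕ Fin k)) ⊕ ((Σ n, LA.Relations n) ⊕ ℕ)) from φ.listEncode) t

theorem eT_var {k : ℕ} (i : Fin k) (t : ℕ) : eT (.var (.inr i)) t = cs (2*(2*i+1)) t := by
  rfl
theorem eT_zero {k : ℕ} (f : LA.Functions 0) (ts : Fin 0 → LA.Term (Empty ⊕ Fin k)) (t : ℕ) :
    eT (.func f ts) t = cs (2*Nat.pair 0 0+1) t := by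
  rfl
theorem eT_succ {k : ℕ} (f : LA.Functions 1) (ts : Fin 1 → LA.Term (Empty ⊕ Fin k)) (t : ℕ) :
    eT (.func f ts) t = cs (2*Nat.pair 1 0+1) (eT (ts 0) t) := by
  simp only [eT, Term.listEncode, lc_cons, List.finRange_succ, List.finRange_zero, List.map_nil, List.flatMap_cons, List.flatMap_nil, List.append_nil]
  rfl
theorem eT_add {k : ℕ} (ts : Fin 2 → LA.Term (Empty ⊕ Fin k)) (t : ℕ) :
    eT (.func fAdd ts) t = cs (2*Nat.pair 2 0+1) (eT (ts 0) (eT (ts 1) t)) := by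
  simp only [eT, Term.listEncode, lc_cons, lc_app, List.finRange_succ, List.finRange_zero, List.map_nil, List.map_cons, List.flatMap_cons, List.flatMap_nil, List.append_nil]
  rfl
theorem eT_mul {k : ℕ} (ts : Fin 2 → LA.Term (Empty ⊕ Fin k)) (t : ℕ) :
    eT (.func fMul ts) t = cs (2*Nat.pair 2 1+1) (eT (ts 0) (eT (ts 1) t)) := by
  simp only [eT, Term.listEncode, lc_cons, lc_app, List.finRange_succ, List.finRange_zero, List.map_nil, List.map_cons, List.flatMap_cons, List.flatMap_nil, List.append_nil]
  rfl
theorem enc_tm {k : ℕ} (τ : LA.Term (Empty ⊕ Fin k)) :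
    Encodable.encode (Sum.inl ⟨k, τ⟩ : (Σ k, LA.Term (Empty ⊕ Fin k)) ⊕ ((Σ n, LA.Relations n) ⊕ ℕ)) = 2 * Nat.pair k (eT τ 0) := by
  rw [eT, lc_enc]; rfl
theorem eF_bot {k : ℕ} (t : ℕ) : eF (.falsum : LA.BoundedFormula Empty k) t = cs (2*(2*(k+2)+1)+1) t := by
  rfl
theorem eF_eq {k : ℕ} (τ σ : LA.Term (Empty ⊕ Fin k)) (t : ℕ) :
    eF (.equal τ σ) t = cs (2 * Nat.pair k (eT τ 0)) (cs (2 * Nat.pair k (eT σ 0)) t) := by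
  simp only [eF, BoundedFormula.listEncode, lc_cons, lc_nil, enc_tm]
theorem eF_le {k : ℕ} (R : LA.Relations 2) (ts : Fin 2 → LA.Term (Empty ⊕ Fin k)) (t : ℕ) :
    eF (.rel R ts) t = cs (2*(2*Nat.pair 2 0)+1) (cs (2*(2*k+1)+1)
      (cs (2 * Nat.pair k (eT (ts 0) 0)) (cs (2 * Nat.pair k (eT (ts 1) 0)) t))) := by
  simp only [eF, BoundedFormula.listEncode, lc_cons, lc_app, lc_nil, enc_tm, List.finRange_succ, List.finRange_zero, List.map_nil, List.map_cons]
  rfl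
theorem eF_imp {k : ℕ} (φ ψ : LA.BoundedFormula Empty k) (t : ℕ) :
    eF (.imp φ ψ) t = cs (2*(2*0+1)+1) (eF φ (eF ψ t)) := by
  simp only [eF, BoundedFormula.listEncode, lc_cons, lc_app, List.cons_append]
  rfl
theorem eF_all {k : ℕ} (φ : LA.BoundedFormula Empty (k+1)) (t : ℕ) :
    eF (.all φ) t = cs (2*(2*1+1)+1) (eF φ t) := by
  simp only [eF, BoundedFormula.listEncode, lc_cons, lc_app, List.cons_append]
  rfl

theorem gnum_eF (φ : Snt) : gnum φ = eF φ 0 := by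
  rw [eF, lc_enc]; rfl

theorem gnum_inj {φ ψ : Snt} (h : gnum φ = gnum ψ) : φ = ψ := by
  have h1 := BoundedFormula.encoding.encode_injective (Encodable.encode_injective h)
  simpa using h1

/-- nodes -/
abbrev nd (f k c t r : ℕ) : ℕ := prm f (prm k (prm c (prm t r)))

/-- axioms of the translation relation -/
def WA (x : ℕ) : Prop :=
  (∃ k t i, i < k ∧ x = nd 0 k (prm 1 i) t (cs (2*(2*i+1)) t)) ∨
  (∃ k t, x = nd 0 k (prm 2 0) t (cs (2*Nat.pair 0 0+1) t)) ∨
  (∃ k t, x = nd 1 k (prm 6 0) t (cs (2*(2*(k+2)+1)+1) t))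
/-- rules of the translation relation -/
def WR (x l r : ℕ) : Prop := ∃ k t c d p q,
  (l = nd 0 k c t p ∧ x = nd 0 k (prm 3 c) t (cs (2*Nat.pair 1 0+1) p)) ∨
  (l = nd 0 k d t p ∧ r = nd 0 k c p q ∧ x = nd 0 k (prm 4 (prm c d)) t (cs (2*Nat.pair 2 0+1) q)) ∨
  (l = nd 0 k d t p ∧ r = nd 0 k c p q ∧ x = nd 0 k (prm 5 (prm c d)) t (cs (2*Nat.pair 2 1+1) q)) ∨
  (l = nd 0 k c 0 p ∧ r = nd 0 k d 0 q ∧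
    x = nd 1 k (prm 7 (prm c d)) t (cs (2 * Nat.pair k p) (cs (2 * Nat.pair k q) t))) ∨
  (l = nd 0 k c 0 p ∧ r = nd 0 k d 0 q ∧
    x = nd 1 k (prm 8 (prm c d)) t (cs (2*(2*Nat.pair 2 0)+1) (cs (2*(2*k+1)+1)
      (cs (2 * Nat.pair k p) (cs (2 * Nat.pair k q) t))))) ∨
  (l = nd 1 k d t p ∧ r = nd 1 k c p q ∧ x = nd 1 k (prm 9 (prm c d)) t (cs (2*(2*0+1)+1) q)) ∨
  (l = nd 1 (k+1) c t p ∧ x = nd 1 k (prm 10 c) t (cs (2*(2*1+1)+1) p))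

theorem S1.w {k : ℕ} {f : (Fin k → ℕ) → ℕ} (hf : Fn1 f) : S1 (fun v => Der WA WR (f v)) := by
  refine S1.der ?_ ?_ hf
  · unfold WA; exact s1r
  · unfold WR; exact s1r

theorem w_term {k : ℕ} (τ : LA.Term (Empty ⊕ Fin k)) (t : ℕ) : Der WA WR (nd 0 k (gnT τ) t (eT τ t)) := by
  induction τ generalizing t with
  | var x =>
    rcases x with x | j
    · exact x.elim
    · rw [eT_var]; exact .ax (.inl ⟨k, t, j, j.2, rfl⟩)
  | @func l f ts ih =>
    match l, f with
    | 0, f => rw [eT_zero]; exact .ax (.inr (.inl ⟨k, t, rfl⟩))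
    | 1, f => rw [eT_succ]; exact .st (ih 0 t) (ih 0 t) ⟨k, t, _, 0, _, 0, .inl ⟨rfl, rfl⟩⟩
    | 2, false =>
      have := eT_add ts t
      simp only [fAdd] at this
      rw [this]; exact .st (ih 1 t) (ih 0 _) ⟨k, t, _, _, _, _, .inr (.inl ⟨rfl, rfl, rfl⟩)⟩
    | 2, true =>
      have := eT_mul ts t
      simp only [fMul] at this
      rw [this]; exact .st (ih 1 t) (ih 0 _) ⟨k, t, _, _, _, _, .inr (.inr (.inl ⟨rfl, rfl, rfl⟩))⟩
    | l+3, f => exact (show Empty from f).elim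

theorem w_fml {k : ℕ} (φ : LA.BoundedFormula Empty k) (t : ℕ) : Der WA WR (nd 1 k (gn φ) t (eF φ t)) := by
  induction φ generalizing t with
  | @falsum k => rw [eF_bot]; exact .ax (.inr (.inr ⟨k, t, rfl⟩))
  | @equal k τ σ =>
    rw [eF_eq]
    exact .st (w_term τ 0) (w_term σ 0) ⟨k, t, _, _, _, _, .inr (.inr (.inr (.inl ⟨rfl, rfl, rfl⟩)))⟩
  | @rel k l R ts =>
    match l, R with
    | 0, R => exact (show Empty from R).elim
    | 1, R => exact (show Empty from R).elim
    | 2, R =>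
      rw [eF_le]
      exact .st (w_term (ts 0) 0) (w_term (ts 1) 0) ⟨k, t, _, _, _, _, .inr (.inr (.inr (.inr (.inl ⟨rfl, rfl, rfl⟩))))⟩
    | l+3, R => exact (show Empty from R).elim
  | @imp k φ ψ h1 h2 =>
    rw [eF_imp]
    exact .st (h2 t) (h1 _) ⟨k, t, _, _, _, _, .inr (.inr (.inr (.inr (.inr (.inl ⟨rfl, rfl, rfl⟩)))))⟩
  | @all k φ h =>
    rw [eF_all]
    exact .st (h t) (h t) ⟨k, t, _, 0, _, 0, .inr (.inr (.inr (.inr (.inr (.inr ⟨rfl, rfl⟩)))))⟩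

/-- meaning of nodes -/
def WS (x : ℕ) : Prop := ∃ k t,
  (∃ τ : LA.Term (Empty ⊕ Fin k), x = nd 0 k (gnT τ) t (eT τ t)) ∨
  (∃ φ : LA.BoundedFormula Empty k, x = nd 1 k (gn φ) t (eF φ t))

theorem ws0 {k c t r : ℕ} (h : WS (nd 0 k c t r)) : ∃ τ : LA.Term (Empty ⊕ Fin k), c = gnT τ ∧ r = eT τ t := by
  obtain ⟨k', t', ⟨τ, h⟩ | ⟨τ, h⟩⟩ := h
  · simp only [prm_inj, true_and] at h
    obtain ⟨rfl, h1, rfl, h2⟩ := h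
    exact ⟨τ, h1, h2⟩
  · simp [prm_inj] at h
theorem ws1 {k c t r : ℕ} (h : WS (nd 1 k c t r)) : ∃ τ : LA.BoundedFormula Empty k, c = gn τ ∧ r = eF τ t := by
  obtain ⟨k', t', ⟨τ, h⟩ | ⟨τ, h⟩⟩ := h
  · simp [prm_inj] at h
  · simp only [prm_inj, true_and] at h
    obtain ⟨rfl, h1, rfl, h2⟩ := h
    exact ⟨τ, h1, h2⟩

theorem w_sound {x : ℕ} (h : Der WA WR x) : WS x := by
  induction h with
  | @ax x h =>
    rcases h with ⟨k, t, i, hi, rfl⟩ | ⟨k, t, rfl⟩ | ⟨k, t, rfl⟩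
    · exact ⟨k, t, .inl ⟨.var (.inr ⟨i, hi⟩), rfl⟩⟩
    · exact ⟨k, t, .inl ⟨.func fZero Fin.elim0, rfl⟩⟩
    · exact ⟨k, t, .inr ⟨.falsum, rfl⟩⟩
  | @st x l r _ _ hR ih1 ih2 =>
    obtain ⟨k, t, c, d, p, q, hR⟩ := hR
    rcases hR with ⟨rfl, rfl⟩ | hR
    · obtain ⟨τ, rfl, rfl⟩ := ws0 ih1
      exact ⟨k, t, .inl ⟨.func fSucc (fun _ => τ), by rw [eT_succ]; rfl⟩⟩
    rcases hR with ⟨rfl, rfl, rfl⟩ | hR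
    · obtain ⟨τ, rfl, rfl⟩ := ws0 ih1
      obtain ⟨σ, rfl, rfl⟩ := ws0 ih2
      exact ⟨k, t, .inl ⟨.func fAdd ![σ, τ], by rw [eT_add]; rfl⟩⟩
    rcases hR with ⟨rfl, rfl, rfl⟩ | hR
    · obtain ⟨τ, rfl, rfl⟩ := ws0 ih1
      obtain ⟨σ, rfl, rfl⟩ := ws0 ih2
      exact ⟨k, t, .inl ⟨.func fMul ![σ, τ], by rw [eT_mul]; rfl⟩⟩
    rcases hR with ⟨rfl, rfl, rfl⟩ | hR
    · obtain ⟨τ, rfl, rfl⟩ := ws0 ih1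
      obtain ⟨σ, rfl, rfl⟩ := ws0 ih2
      exact ⟨k, t, .inr ⟨.equal τ σ, by rw [eF_eq]; rfl⟩⟩
    rcases hR with ⟨rfl, rfl, rfl⟩ | hR
    · obtain ⟨τ, rfl, rfl⟩ := ws0 ih1
      obtain ⟨σ, rfl, rfl⟩ := ws0 ih2
      exact ⟨k, t, .inr ⟨.rel rLe ![τ, σ], by rw [eF_le]; rfl⟩⟩
    rcases hR with ⟨rfl, rfl, rfl⟩ | ⟨rfl, rfl⟩
    · obtain ⟨τ, rfl, rfl⟩ := ws1 ih1
      obtain ⟨σ, rfl, rfl⟩ := ws1 ih2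
      exact ⟨k, t, .inr ⟨.imp σ τ, by rw [eF_imp]; rfl⟩⟩
    · obtain ⟨τ, rfl, rfl⟩ := ws1 ih1
      exact ⟨k, t, .inr ⟨.all τ, by rw [eF_all]; rfl⟩⟩

/-- Σ₁ axiomatized theories -/
def AxS1 (T : Thy) : Prop := S1 (fun v : Fin 1 → ℕ => ∃ φ ∈ T, gn φ = v 0)

theorem CompThy.axS1 {T : Thy} (h : CompThy T) : AxS1 T := by
  refine S1.of_iff (P := fun v : Fin 1 → ℕ => ∃ m, (∃ φ ∈ T, gnum φ = m) ∧ Der WA WR (nd 1 0 (v 0) 0 m)) ?_ ?_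
  · exact S1.ex (S1.and (S1.comp1 (P := fun m => ∃ φ ∈ T, gnum φ = m) (comp_s1 h) fnr) (S1.w fnr))
  · intro v
    constructor
    · rintro ⟨φ, hφ, h⟩
      refine ⟨_, ⟨φ, hφ, rfl⟩, ?_⟩
      rw [← h, gnum_eF]
      exact w_fml φ 0
    · rintro ⟨m, ⟨φ, hφ, rfl⟩, h⟩
      obtain ⟨ψ, h1, h2⟩ := ws1 (w_sound h)
      rw [← gnum_eF] at h2
      exact ⟨φ, hφ, by rw [h1, gnum_inj h2]⟩

theorem AxS1.insert {T : Thy} (h : AxS1 T) (χ : Snt) : AxS1 (insert χ T) := by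
  refine S1.of_iff (S1.or (S1.eq (Fn1.var NVr.id 0) (Fn1.const (gn χ))) h) ?_
  intro v
  simp only [Set.mem_insert_iff]
  constructor
  · rintro ⟨φ, rfl | hφ, h⟩
    · exact .inl h.symm
    · exact .inr ⟨φ, hφ, h⟩
  · rintro (h | ⟨φ, hφ, h⟩)
    · exact ⟨χ, .inl rfl, h.symm⟩
    · exact ⟨φ, .inr hφ, h⟩


section pam
variable {M : Type} [CommSemiring M] [LinearOrder M] [IsStrictOrderedRing M]
    [CanonicallyOrderedAdd M] [LA.Structure M] [PAM M] {k m : ℕ}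

/-- diagonalised matrix -/
def Hdg (c : M) (j : ℕ) (e w : M) : Prop := HH c (prm 0 (prm c (prm (j : M) e))) w
/-- least refuting witness -/
def Lsz (c z : M) : Prop := Hdg c 2 0 z ∧ ∀ z', z' ≤ z → (¬ Hdg c 2 0 z' ∨ z' = z)
def Sa (k : ℕ) (c : M) : Prop :=
  ∃ z, Lsz c z ∧ ∀ e, e ≤ z → (¬ (∃ w, w ≤ z ∧ Hdg c 0 e w) ∨ Tr k e 0)
/-- the negated `Π` part -/
def Sb (k : ℕ) (c : M) : Prop :=
  ∃ z, Lsz c z ∧ ∃ e, e ≤ z ∧ ((∃ w, w ≤ z ∧ Hdg c 1 e w) ∧ Tr k e 0)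
end pam

section fam
variable {ι : Type*} {𝓜 : ι → Type}
variable [∀ i, CommSemiring (𝓜 i)] [∀ i, LinearOrder (𝓜 i)] [∀ i, IsStrictOrderedRing (𝓜 i)]
    [∀ i, CanonicallyOrderedAdd (𝓜 i)] [∀ i, LA.Structure (𝓜 i)] [∀ i, PAM (𝓜 i)] {k m n : ℕ}

theorem Del0.hdg {f g h : ∀ i, (Fin k → 𝓜 i) → 𝓜 i} (j : ℕ) (hf : Fd f) (hg : Fd g) (hh : Fd h) :
    Del0 (fun i v => Hdg (f i v) j (g i v) (h i v)) :=
  Del0.hh hf (Fd.prm Fd.zero (Fd.prm hf (Fd.prm (Fd.cast j) hg))) hh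

theorem Del0.lsz {f g : ∀ i, (Fin k → 𝓜 i) → 𝓜 i} (hf : Fd f) (hg : Fd g) :
    Del0 (fun i v => Lsz (f i v) (g i v)) :=
  Del0.and (Del0.hdg 2 hf Fd.zero hg) (Del0.ball hg
    (Del0.or (Del0.not (Del0.hdg 2 (hf.vr fvt) Fd.zero fdt)) (Del0.eq fdt (hg.vr fvt))))

theorem SigF.sa (l : ℕ) {f : ∀ i, (Fin k → 𝓜 i) → 𝓜 i} (hf : Fd f) :
    SigF (l+1) (fun i v => Sa l (f i v)) := by
  refine SigF.comp1 (P := fun i c => Sa l c) ?_ hf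
  refine SigF.ex (SigF.and (Del0.lsz fdt fdt).sig (SigF.ball fdt (SigF.or
    (Del0.not (Del0.bex fdt (Del0.hdg 0 fdt fdt fdt))).sig (SigF.tr fdt Fd.zero l))))
theorem SigF.sb (l : ℕ) {f : ∀ i, (Fin k → 𝓜 i) → 𝓜 i} (hf : Fd f) :
    SigF (l+1) (fun i v => Sb l (f i v)) := by
  refine SigF.comp1 (P := fun i c => Sb l c) ?_ hf
  refine SigF.ex (SigF.and (Del0.lsz fdt fdt).sig (SigF.bex fdt (SigF.and
    (Del0.bex fdt (Del0.hdg 1 fdt fdt fdt)).sig (SigF.tr fdt Fd.zero l))))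
end fam

theorem prv_mdl {T : Thy} (hE : ExtPA T) (φ : Snt) : Prv T φ ↔ ∀ i : Mdl, i.C ⊨ T → i.C ⊨ φ := by
  unfold Prv
  rw [Theory.models_sentence_iff]
  constructor
  · intro h i hi
    have := hi
    exact h ⟨i.C⟩
  · intro h M
    obtain ⟨p⟩ := exists_PAM (ext_mdl hE M.is_model)
    exact h ⟨M, M.struc, p⟩ M.is_model

theorem extPA_mono {T T' : Thy} (h : T ⊆ T') (hE : ExtPA T) : ExtPA T' := by
  intro φ hφ
  refine Theory.models_sentence_iff.2 fun M => ?_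
  have : (M : Type) ⊨ T := ⟨fun ψ hψ => M.is_model.realize_of_mem ψ (h hψ)⟩
  exact Theory.models_sentence_iff.1 (hE φ hφ) ⟨M⟩

theorem mdl_insert {T : Thy} {φ : Snt} {M : Type} [LA.Structure M] :
    M ⊨ (insert φ T : Thy) ↔ M ⊨ φ ∧ M ⊨ T := by
  simp [Theory.model_iff]

theorem con_mdl {T : Thy} (hE : ExtPA T) : Con T ↔ ∃ i : Mdl, i.C ⊨ T := by
  unfold Con
  rw [prv_mdl hE]
  constructor
  · intro h
    by_contra hc
    push Not at hc
    exact h fun i hi => absurd hi (hc i)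
  · rintro ⟨i, hi⟩ h
    exact h i hi

theorem snt_not {M : Type} [LA.Structure M] (φ : Snt) : M ⊨ (∼φ : Snt) ↔ ¬ M ⊨ φ := by
  simp [Sentence.Realize, Formula.Realize]
theorem snt_imp {M : Type} [LA.Structure M] (φ ψ : Snt) : M ⊨ (φ ⟹ ψ : Snt) ↔ (M ⊨ φ → M ⊨ ψ) := by
  simp [Sentence.Realize, Formula.Realize]
theorem snt_inf {M : Type} [LA.Structure M] (φ ψ : Snt) : M ⊨ (φ ⊓ ψ : Snt) ↔ (M ⊨ φ ∧ M ⊨ ψ) := by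
  simp [Sentence.Realize, Formula.Realize]
theorem snt_sup {M : Type} [LA.Structure M] (φ ψ : Snt) : M ⊨ (φ ⊔ ψ : Snt) ↔ (M ⊨ φ ∨ M ⊨ ψ) := by
  simp [Sentence.Realize, Formula.Realize]

theorem sub_mdl {V T : Thy} (h : SubThy V T) {φ : Snt} (hp : Prv V φ) {i : Mdl} (hi : i.C ⊨ T)
    (hE : ExtPA T) : i.C ⊨ φ := (prv_mdl hE φ).1 (h.2 φ hp) i hi

/-- extraction of sentences -/
theorem SigF.snt {n : ℕ} {P : ∀ i : Mdl, Prop}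
    (h : SigF (ι := Mdl) (𝓜 := fun i => i.C) (k := 0) n (fun i _ => P i)) :
    (∃ φ ∈ SigmaS n, ∀ i : Mdl, i.C ⊨ φ ↔ P i) ∧ (∃ φ ∈ PiS n, ∀ i : Mdl, i.C ⊨ φ ↔ ¬ P i) := by
  obtain ⟨⟨φ, h1, h2⟩, ⟨ψ, h3, h4⟩⟩ := h.fml
  exact ⟨⟨φ, h1, fun i => h2 i default⟩, ⟨ψ, h3, fun i => h4 i default⟩⟩

theorem sig_code {l : ℕ} {σ : Snt} (h : σ ∈ SigmaS (l+1)) : ∃ e : ℕ, ∀ i : Mdl, i.C ⊨ σ ↔ Tr l (e : i.C) 0 := by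
  obtain ⟨pg, hp⟩ := rep_sig (φ := σ) h
  exact ⟨pg.code, fun i => (hp i default).trans (tr_sem l pg (0 : i.C)).symm⟩
theorem pi_code {l : ℕ} {σ : Snt} (h : σ ∈ PiS (l+1)) : ∃ e : ℕ, ∀ i : Mdl, i.C ⊨ σ ↔ ¬ Tr l (e : i.C) 0 := by
  obtain ⟨pg, hp⟩ := rep_pi (φ := σ) h
  exact ⟨pg.code, fun i => (hp i default).trans (not_congr (tr_sem l pg (0 : i.C)).symm)⟩

/-- diagonal index -/
theorem diag (l : ℕ) {T U : Thy} (aT : AxS1 T) (aU : AxS1 U) (eT : ExtPA T) (eU : ExtPA U) :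
    ∃ a : ℕ, (∀ e : ℕ, (∃ z, Hdg a 0 e z) ↔ ∀ i : Mdl, i.C ⊨ U → ¬ (Sa l (a : i.C) ∧ ¬ Sb l (a : i.C)) → Tr l (e : i.C) 0) ∧
      (∀ e : ℕ, (∃ z, Hdg a 1 e z) ↔ ∀ i : Mdl, i.C ⊨ U → ¬ (Sa l (a : i.C) ∧ ¬ Sb l (a : i.C)) → ¬ Tr l (e : i.C) 0) ∧
      ((∃ z, Hdg a 2 0 z) ↔ ∀ i : Mdl, i.C ⊨ T → ¬ (Sa l (a : i.C) ∧ ¬ Sb l (a : i.C))) := by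
  obtain ⟨fa, _, ha⟩ := (SigF.sa (ι := Mdl) (𝓜 := fun i => i.C) l (f := fun i (v : Fin 2 → i.C) => v 0) fdt).fml.1
  obtain ⟨fb, _, hb⟩ := (SigF.sb (ι := Mdl) (𝓜 := fun i => i.C) l (f := fun i (v : Fin 2 → i.C) => v 0) fdt).fml.1
  obtain ⟨ft, _, ht⟩ := (SigF.tr (ι := Mdl) (𝓜 := fun i => i.C) (f := fun i (v : Fin 2 → i.C) => v 1)
    (g := fun i v => 0) fdt Fd.zero l).fml.1
  have s0 := prv_s1 aU eU ((∼(fa ⊓ ∼fb)) ⟹ ft)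
  have s1 := prv_s1 aU eU ((∼(fa ⊓ ∼fb)) ⟹ ∼ft)
  have s2 := prv_s1 aT eT (∼(fa ⊓ ∼fb))
  simp only [BoundedFormula.realize_imp, BoundedFormula.realize_not, BoundedFormula.realize_inf,
    ha, hb, ht, Matrix.cons_val_zero, Matrix.cons_val_one] at s0 s1 s2
  obtain ⟨R0, e0⟩ : ∃ R : ℕ → ℕ → Prop, R = fun c e => ∀ i : Mdl, i.C ⊨ U → ¬ (Sa l (c : i.C) ∧ ¬ Sb l (c : i.C)) → Tr l (e : i.C) 0 := ⟨_, rfl⟩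
  obtain ⟨R1, e1⟩ : ∃ R : ℕ → ℕ → Prop, R = fun c e => ∀ i : Mdl, i.C ⊨ U → ¬ (Sa l (c : i.C) ∧ ¬ Sb l (c : i.C)) → ¬ Tr l (e : i.C) 0 := ⟨_, rfl⟩
  obtain ⟨R2, e2⟩ : ∃ R : ℕ → ℕ → Prop, R = fun c e => ∀ i : Mdl, i.C ⊨ T → ¬ (Sa l (c : i.C) ∧ ¬ Sb l (c : i.C)) := ⟨_, rfl⟩
  have s0 : S1 (fun v : Fin 2 → ℕ => R0 (v 0) (v 1)) := by rw [e0]; exact s0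
  have s1 : S1 (fun v : Fin 2 → ℕ => R1 (v 0) (v 1)) := by rw [e1]; exact s1
  have s2 : S1 (fun v : Fin 2 → ℕ => R2 (v 0) (v 1)) := by rw [e2]; exact s2
  have hs : S1 (fun v : Fin 1 → ℕ => ∃ c e, (v 0 = prm c (prm 0 e) ∧ R0 c e) ∨
      (v 0 = prm c (prm 1 e) ∧ R1 c e) ∨ (v 0 = prm c (prm 2 e) ∧ R2 c e)) := by
    refine S1.ex (S1.ex (S1.or (S1.and (S1.eq fnr fnr) (S1.comp2 (P := R0) s0 fnr fnr))
      (S1.or (S1.and (S1.eq fnr fnr) (S1.comp2 (P := R1) s1 fnr fnr))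
      (S1.and (S1.eq fnr fnr) (S1.comp2 (P := R2) s2 fnr fnr)))))
  obtain ⟨a, h⟩ := S1.univ (P := fun x => ∃ c e, (x = prm c (prm 0 e) ∧ R0 c e) ∨
      (x = prm c (prm 1 e) ∧ R1 c e) ∨ (x = prm c (prm 2 e) ∧ R2 c e)) hs
  have k0 : ∀ e, (∃ z, Hdg a 0 e z) ↔ R0 a e := by
    intro e
    refine (h (prm a (prm 0 e))).symm.trans ⟨?_, fun h => ⟨a, e, .inl ⟨rfl, h⟩⟩⟩
    rintro ⟨c, e', ⟨h, h'⟩ | ⟨h, h'⟩ | ⟨h, h'⟩⟩ <;> simp only [prm_inj] at h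
    · obtain ⟨rfl, -, rfl⟩ := h; exact h'
    · omega
    · omega
  have k1 : ∀ e, (∃ z, Hdg a 1 e z) ↔ R1 a e := by
    intro e
    refine (h (prm a (prm 1 e))).symm.trans ⟨?_, fun h => ⟨a, e, .inr (.inl ⟨rfl, h⟩)⟩⟩
    rintro ⟨c, e', ⟨h, h'⟩ | ⟨h, h'⟩ | ⟨h, h'⟩⟩ <;> simp only [prm_inj] at h
    · omega
    · obtain ⟨rfl, -, rfl⟩ := h; exact h'
    · omega
  have k2 : ∀ e, (∃ z, Hdg a 2 e z) ↔ R2 a e := by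
    intro e
    refine (h (prm a (prm 2 e))).symm.trans ⟨?_, fun h => ⟨a, e, .inr (.inr ⟨rfl, h⟩)⟩⟩
    rintro ⟨c, e', ⟨h, h'⟩ | ⟨h, h'⟩ | ⟨h, h'⟩⟩ <;> simp only [prm_inj] at h
    · omega
    · omega
    · obtain ⟨rfl, -, rfl⟩ := h; exact h'
  refine ⟨a, ?_, ?_, ?_⟩
  · intro e; rw [k0, e0]
  · intro e; rw [k1, e1]
  · rw [k2, e2]

theorem hd_abs (i : Mdl) (a j e w : ℕ) : Hdg (a : i.C) j (e : i.C) (w : i.C) ↔ Hdg a j e w := by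
  have := hh_abs i a (prm 0 (prm a (prm j e))) w
  simpa [Hdg] using this

theorem key (l : ℕ) {T U : Thy} (aT : AxS1 T) (aU : AxS1 U) (eT : ExtPA T) (eU : ExtPA U)
    (hC : Con (T ∪ ThIn (SigAndPiS (l+1)) U)) :
    ∃ φ ∈ BSigmaS (l+1), HConsIn (SigAndPiS (l+1)) U φ ∧ ¬ Prv T φ := by
  obtain ⟨a, k0, k1, k2⟩ := diag l aT aU eT eU
  obtain ⟨sa, hsa, ha⟩ := (SigF.snt (P := fun i => Sa l (a : i.C)) (SigF.sa l (Fd.cast a))).1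
  obtain ⟨sb, hsb, hb⟩ := (SigF.snt (P := fun i => Sb l (a : i.C)) (SigF.sb l (Fd.cast a))).1
  have hφ : ∀ i : Mdl, i.C ⊨ (∼(sa ⊓ ∼sb) : Snt) ↔ ¬ (Sa l (a : i.C) ∧ ¬ Sb l (a : i.C)) := by
    intro i; rw [snt_not, snt_inf, snt_not, ha, hb]
  obtain ⟨⟨tr, htr, htr'⟩, fl, hfl, hfl'⟩ := SigF.snt (n := l+1) (P := fun i => True) (Del0.tru.sig)
  obtain ⟨⟨fl1, _⟩, tr1, htr1, htr1'⟩ := SigF.snt (n := l+1) (P := fun i => False) (Del0.fls.sig)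
  -- claim one
  have c1 : ¬ ∃ z, Hdg a 2 0 z := by
    intro hz
    have hnT := k2.1 hz
    classical
    obtain ⟨z0, hz0, hmin⟩ : ∃ z0, Hdg a 2 0 z0 ∧ ∀ m < z0, ¬ Hdg a 2 0 m :=
      ⟨Nat.find hz, Nat.find_spec hz, fun m hm => Nat.find_min hz hm⟩
    have hl : ∀ (i : Mdl) (z : i.C), Lsz (a : i.C) z ↔ z = (z0 : i.C) := by
      intro i z
      have h0 : Hdg (a : i.C) 2 0 (z0 : i.C) := by
        have := (hd_abs i a 2 0 z0).2 hz0
        simpa using this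
      have h1 : ∀ z, Hdg (a : i.C) 2 0 z → (z0 : i.C) ≤ z := by
        intro z hz
        by_contra hc
        obtain ⟨m, hm, rfl⟩ := le_natCast (not_le.1 hc).le
        have h3 : Hdg a 2 0 m := by
          have := (hd_abs i a 2 0 m).1 (by simpa using hz)
          exact this
        have h4 : m < z0 := by
          rcases lt_or_eq_of_le hm with h | h
          · exact h
          · rw [h] at hc; exact absurd le_rfl hc
        exact hmin m h4 h3
      constructor
      · rintro ⟨h2, h3⟩
        rcases h3 _ (h1 z h2) with h | h
        · exact absurd h0 h
        · exact h.symm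
      · rintro rfl
        refine ⟨h0, fun z' hz' => ?_⟩
        by_cases h : Hdg (a : i.C) 2 0 z'
        · exact .inr (le_antisymm hz' (h1 z' h))
        · exact .inl h
    have hsa' : ∀ i : Mdl, Sa l (a : i.C) ↔ ∀ e ≤ z0, (∃ w ≤ z0, Hdg a 0 e w) → Tr l (e : i.C) 0 := by
      intro i
      unfold Sa
      simp only [hl, exists_eq_left]
      constructor
      · rintro h e he ⟨w, hw, hw'⟩
        rcases h e (Nat.mono_cast he) with h | h
        · exact absurd ⟨(w : i.C), Nat.mono_cast hw, (hd_abs i a 0 e w).2 hw'⟩ h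
        · exact h
      · intro h e he
        obtain ⟨m, hm, rfl⟩ := le_natCast he
        by_cases hc : ∃ w ≤ z0, Hdg a 0 m w
        · exact .inr (h m hm hc)
        · refine .inl ?_
          rintro ⟨w, hw, hw'⟩
          obtain ⟨w, hwn, rfl⟩ := le_natCast hw
          exact hc ⟨w, hwn, (hd_abs i a 0 m w).1 hw'⟩
    have hsb' : ∀ i : Mdl, Sb l (a : i.C) ↔ ∃ e ≤ z0, (∃ w ≤ z0, Hdg a 1 e w) ∧ Tr l (e : i.C) 0 := by
      intro i
      unfold Sb
      simp only [hl, exists_eq_left]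
      constructor
      · rintro ⟨e, he, ⟨w, hw, hw'⟩, ht⟩
        obtain ⟨e, hen, rfl⟩ := le_natCast he
        obtain ⟨w, hwn, rfl⟩ := le_natCast hw
        exact ⟨e, hen, ⟨w, hwn, (hd_abs i a 1 e w).1 hw'⟩, ht⟩
      · rintro ⟨e, he, ⟨w, hw, hw'⟩, ht⟩
        exact ⟨e, Nat.mono_cast he, ⟨w, Nat.mono_cast hw, (hd_abs i a 1 e w).2 hw'⟩, ht⟩
    -- U proves everything relevant
    have hU : ∀ i : Mdl, i.C ⊨ U → Sa l (a : i.C) ∧ ¬ Sb l (a : i.C) := by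
      intro i hi
      by_contra hc
      refine hc ⟨(hsa' i).2 ?_, fun h => ?_⟩
      · rintro e he ⟨w, hw, hw'⟩
        exact (k0 e).1 ⟨w, hw'⟩ i hi hc
      · obtain ⟨e, he, ⟨w, hw, hw'⟩, ht⟩ := (hsb' i).1 h
        exact (k1 e).1 ⟨w, hw'⟩ i hi hc ht
    obtain ⟨i, hi⟩ := (con_mdl (extPA_mono Set.subset_union_left eT)).1 hC
    have hiT : i.C ⊨ T := ⟨fun ψ hψ => hi.realize_of_mem ψ (.inl hψ)⟩
    have hiU : ∀ ψ ∈ SigAndPiS (l+1), (∀ j : Mdl, j.C ⊨ U → j.C ⊨ ψ) → i.C ⊨ ψ := by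
      intro ψ hψ h
      exact hi.realize_of_mem ψ (.inr ⟨hψ, (prv_mdl eU ψ).2 h⟩)
    have hte : ∀ e : ℕ, SigF (ι := Mdl) (𝓜 := fun i => i.C) (k := 0) (l+1) (fun i _ => Tr l (e : i.C) 0) :=
      fun e => SigF.tr (Fd.cast e) Fd.zero l
    refine hnT i hiT ⟨(hsa' i).2 ?_, fun h => ?_⟩
    · intro e he hw
      obtain ⟨s, hs, hs'⟩ := (SigF.snt (hte e)).1
      have := hiU (s ⊓ tr1) ⟨s, hs, tr1, htr1, rfl⟩ (fun j hj => by
        rw [snt_inf, hs', htr1']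
        exact ⟨(hsa' j).1 (hU j hj).1 e he hw, fun h => h⟩)
      rw [snt_inf, hs'] at this
      exact this.1
    · obtain ⟨e, he, hw, ht⟩ := (hsb' i).1 h
      obtain ⟨s, hs, hs'⟩ := (SigF.snt (hte e)).2
      have := hiU (tr ⊓ s) ⟨tr, htr, s, hs, rfl⟩ (fun j hj => by
        rw [snt_inf, hs', htr']
        exact ⟨trivial, fun h => (hU j hj).2 ((hsb' j).2 ⟨e, he, hw, h⟩)⟩)
      rw [snt_inf, hs'] at this
      exact this.2 ht
  refine ⟨∼(sa ⊓ ∼sb), .not (.inf (.base hsa) (.not (.base hsb))), ?_, ?_⟩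
  · rintro V hV γ ⟨σ, hσ, π, hπ, rfl⟩ hp
    have eV := hV.1
    rw [prv_mdl (T := add V _) (extPA_mono (Set.subset_insert _ _) eV)] at hp
    have hp' : ∀ i : Mdl, i.C ⊨ V → ¬ (Sa l (a : i.C) ∧ ¬ Sb l (a : i.C)) → i.C ⊨ σ ∧ i.C ⊨ π := by
      intro i hi h
      have := hp i (mdl_insert.2 ⟨(hφ i).2 h, hi⟩)
      rwa [snt_inf] at this
    have hUp : ∀ i : Mdl, i.C ⊨ U → ¬ (Sa l (a : i.C) ∧ ¬ Sb l (a : i.C)) → i.C ⊨ σ ∧ i.C ⊨ π := by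
      have h1 : Prv V ((∼(sa ⊓ ∼sb)) ⟹ (σ ⊓ π)) := by
        rw [prv_mdl eV]
        intro i hi
        rw [snt_imp, hφ, snt_inf]
        exact hp' i hi
      have h2 := (prv_mdl eU _).1 (hV.2 _ h1)
      intro i hi
      have := h2 i hi
      rwa [snt_imp, hφ, snt_inf] at this
    obtain ⟨e, he⟩ := sig_code hσ
    obtain ⟨f, hf⟩ := pi_code hπ
    obtain ⟨w, hw⟩ := (k0 e).2 (fun i hi h => (he i).1 (hUp i hi h).1)
    obtain ⟨w', hw'⟩ := (k1 f).2 (fun i hi h => (hf i).1 (hUp i hi h).2)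
    rw [prv_mdl eV]
    intro i hi
    rw [snt_inf]
    by_cases hc : Sa l (a : i.C) ∧ ¬ Sb l (a : i.C)
    swap
    · exact hp' i hi hc
    obtain ⟨⟨z, hz, h1⟩, h2⟩ := hc
    have hns : ∀ m : ℕ, (m : i.C) ≤ z := by
      intro m
      by_contra hc
      obtain ⟨m, hm, rfl⟩ := le_natCast (not_le.1 hc).le
      exact c1 ⟨m, (hd_abs i a 2 0 m).1 (by simpa using hz.1)⟩
    constructor
    · rw [he]
      rcases h1 e (hns e) with h | h
      · exact absurd ⟨_, hns w, (hd_abs i a 0 e w).2 hw⟩ h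
      · exact h
    · rw [hf]
      intro h
      exact h2 ⟨z, hz, _, hns f, ⟨_, hns w', (hd_abs i a 1 f w').2 hw'⟩, h⟩
  · intro hp
    rw [prv_mdl eT] at hp
    exact c1 (k2.2 fun i hi => (hφ i).1 (hp i hi))

theorem hcons_sup {Γ : Set Snt} {T : Thy} {φ χ ψ : Snt} (h : HConsIn Γ T φ)
    (hi : ∀ (i : Mdl), i.C ⊨ φ → i.C ⊨ ψ) : HConsIn Γ T ψ := by
  intro V hV γ hγ hp
  refine h V hV γ hγ ?_
  have eV := hV.1
  rw [prv_mdl (T := add V _) (extPA_mono (Set.subset_insert _ _) eV)] at hp ⊢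
  intro i hm
  obtain ⟨h1, h2⟩ := mdl_insert.1 hm
  exact hp i (mdl_insert.2 ⟨hi i h1, h2⟩)

theorem one_two (l : ℕ) {T U : Thy} (aT : AxS1 T) (aU : AxS1 U) (eT : ExtPA T) (eU : ExtPA U)
    (hC : Con (T ∪ ThIn (SigAndPiS (l+1)) U)) :
    ∃ φ ∈ BSigmaS (l+1), HConsIn (SigAndPiS (l+1)) T φ ∧ HConsIn (SigAndPiS (l+1)) U φ ∧ φ ∉ Th T := by
  obtain ⟨φ, b1, h1, p1⟩ := key l aT aU eT eU hC
  have eT' : ExtPA (insert (∼φ) T) := extPA_mono (Set.subset_insert _ _) eT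
  obtain ⟨χ, b2, h2, p2⟩ := key l (aT.insert (∼φ)) aT eT' eT (by
    rw [con_mdl (extPA_mono Set.subset_union_left eT')]
    rw [prv_mdl eT] at p1
    push Not at p1
    obtain ⟨i, hi, hn⟩ := p1
    refine ⟨i, ⟨?_⟩⟩
    rintro ψ ((rfl | h) | h)
    · exact (snt_not φ).2 hn
    · exact hi.realize_of_mem ψ h
    · exact (prv_mdl eT ψ).1 h.2 i hi)
  refine ⟨φ ⊔ χ, .sup b1 b2, hcons_sup h2 (χ := χ) fun i h => (snt_sup _ _).2 (.inr h),
    hcons_sup h1 (χ := χ) fun i h => (snt_sup _ _).2 (.inl h), fun hp => p2 ?_⟩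
  rw [prv_mdl eT']
  intro i hi
  obtain ⟨n1, n2⟩ := mdl_insert.1 hi
  rcases (snt_sup _ _).1 ((prv_mdl eT _).1 hp i n2) with h | h
  · exact absurd h ((snt_not φ).1 n1)
  · exact h

theorem three_one (n : ℕ) {T U : Thy} (eT : ExtPA T) (eU : ExtPA U) {φ : Snt}
    (h : HConsIn (SigAndPiS n) U φ) (hp : φ ∉ Th T) : Con (T ∪ ThIn (SigAndPiS n) U) := by
  have hp : ¬ Prv T φ := hp
  rw [prv_mdl eT] at hp
  push Not at hp
  obtain ⟨i, hi, hn⟩ := hp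
  rw [con_mdl (extPA_mono Set.subset_union_left eT)]
  refine ⟨i, ⟨?_⟩⟩
  rintro ψ (hψ | ⟨hψ, hψ'⟩)
  · exact hi.realize_of_mem ψ hψ
  let V : Thy := insert (φ ⟹ ψ) PAAx
  have ePA : ExtPA PAAx := fun χ hχ => Theory.models_sentence_iff.2 fun M => M.is_model.realize_of_mem χ hχ
  have eV : ExtPA V := extPA_mono (Set.subset_insert _ _) ePA
  have hV : SubThy V U := by
    refine ⟨eV, fun χ hχ => ?_⟩
    rw [prv_mdl eV] at hχ
    rw [prv_mdl eU]
    intro j hj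
    refine hχ j (mdl_insert.2 ⟨(snt_imp _ _).2 fun _ => (prv_mdl eU ψ).1 hψ' j hj, ⟨fun χ h => ?_⟩⟩)
    exact (prv_mdl eU χ).1 (eU χ h) j hj
  have hg := h V hV ψ hψ (by
    rw [prv_mdl (T := add V _) (extPA_mono (Set.subset_insert _ _) eV)]
    intro j hj
    obtain ⟨h1, h2⟩ := mdl_insert.1 hj
    exact (snt_imp _ _).1 (mdl_insert.1 h2).1 h1)
  refine (prv_mdl eV ψ).1 hg i (mdl_insert.2 ⟨(snt_imp _ _).2 fun h => absurd h hn, ⟨fun χ h => ?_⟩⟩)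
  exact (prv_mdl eT χ).1 (eT χ h) i hi


/-- Theorem 8.1. -/
theorem stmt_17 (T U : Thy) (hT : GoodThy T) (hU : GoodThy U) (n : ℕ) (hn : 1 ≤ n) :
    List.TFAE
      [Con (T ∪ ThIn (SigAndPiS n) U),
       ∃ φ ∈ BSigmaS n, HConsIn (SigAndPiS n) T φ ∧ HConsIn (SigAndPiS n) U φ ∧ φ ∉ Th T,
       ∃ φ : Snt, HConsIn (SigAndPiS n) U φ ∧ φ ∉ Th T] := by
  obtain ⟨l, rfl⟩ : ∃ l, n = l + 1 := ⟨n - 1, by omega⟩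
  obtain ⟨cT, _, eT⟩ := hT
  obtain ⟨cU, _, eU⟩ := hU
  tfae_have 1 → 2 := one_two l cT.axS1 cU.axS1 eT eU
  tfae_have 2 → 3 := by
    rintro ⟨φ, _, _, h, h'⟩
    exact ⟨φ, h, h'⟩
  tfae_have 3 → 1 := by
    rintro ⟨φ, h, h'⟩
    exact three_one (l+1) eT eU h h'
  tfae_finish

end Guaspari
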